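/- Let θ > 0, α > 0 and integers M ≥ N ≥ 1. Let y be distributed as the β-Jacobi ensemble P_θ^{α,M,N}, let m ≥ 1 and let k_1,…,k_m be positive integers. Suppose radii ρ_{i,j} > 0 (1 ≤ i ≤ m, 1 ≤ j ≤ k_i), ordered lexicographically in (i,j), satisfy ρ_{i',j'} − ρ_{i,j} > max(θ,1) whenever (i,j) < (i',j') and ρ_{m,k_m} < θ(N+α+M−1); let the u_{i,j}-contour be the positively oriented circle of radius ρ_{i,j} centered at −θN. Then E[∏_{i=1}^m 𝔓_{k_i}(y)] = (−θ)^{−m} (2πi)^{−(k_1+⋯+k_m)} ∮⋯∮ ∏_{1≤i<i'≤m} ∏_{j=1}^{k_i} ∏_{j'=1}^{k_{i'}} F(u_{i',j'} − u_{i,j}) × ∏_{i=1}^m [ ∏_{a=1}^{k_i−1} (u_{i,a+1} − u_{i,a} + 1 − θ)^{−1} · ∏_{1≤a<b≤k_i} F(u_{i,b} − u_{i,a}) · ∏_{j=1}^{k_i} (u_{i,j}/(u_{i,j}+θN)) · ((u_{i,j} − θ(α−1))/(u_{i,j} − θ(α+M−1))) ] ∏_{i,j} du_{i,j}, where F(w)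 := w(w+1−θ)/((w+1)(w−θ)). -/

import Mathlib

open MeasureTheory

/-- The (unnormalized) β-Jacobi density `∏_{i<j}|x_i−x_j|^{2θ} ∏_i x_i^{θα−1}(1−x_i)^{θ(M−N)+θ−1}`
with `β = 2θ`. -/
noncomputable def jacobiDensity (θ α : ℝ) (M N : ℕ) (x : Fin N → ℝ) : ℝ :=
  (∏ p ∈ Finset.univ.filter (fun p : Fin N × Fin N => p.1 < p.2),
      |x p.1 - x p.2| ^ (2 * θ)) *
    ∏ i : Fin N, (x i ^ (θ * α - 1) * (1 - x i) ^ (θ * ((M : ℝ) - (N : ℝ)) + θ - 1))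

/-- The unnormalized β-Jacobi measure on `[0,1]^N`. -/
noncomputable def jacobiMeasureRaw (θ α : ℝ) (M N : ℕ) : Measure (Fin N → ℝ) :=
  (volume.restrict (Set.univ.pi fun _ : Fin N => Set.Icc (0 : ℝ) 1)).withDensity
    fun x => ENNReal.ofReal (jacobiDensity θ α M N x)

/-- The β-Jacobi ensemble `P_θ^{α,M,N}`: the normalized β-Jacobi measure on `[0,1]^N`. -/
noncomputable def jacobiEnsemble (θ α : ℝ) (M N : ℕ) : Measure (Fin N → ℝ) :=
  (jacobiMeasureRaw θ α M N Set.univ)⁻¹ • jacobiMeasureRaw θ α M N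


/-- Iterated contour integral over positively oriented circles: for each index `i`, the
variable `u i` runs over the circle of radius `R i` centered at `c i`. This equals the
iterated integral `∮ … ∮ f(u) ∏ᵢ du_i` by Fubini. -/
noncomputable def multiCircleIntegral {ι : Type*} [Fintype ι] (f : (ι → ℂ) → ℂ)
    (c : ι → ℂ) (R : ι → ℝ) : ℂ :=
  ∫ t : ι → ℝ in Set.univ.pi fun _ => Set.Icc 0 (2 * Real.pi),
    (∏ i, ((R i : ℂ) * Complex.exp (t i * Complex.I) * Complex.I)) *
      f (fun i => c i + (R i : ℂ) * Complex.exp (t i * Complex.I))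
    ∂(Measure.pi fun _ => volume)

/-- The cross factor `F(w) = w(w+1−θ)/((w+1)(w−θ))` appearing in the moment formulas. -/
noncomputable def crossF (θ : ℝ) (w : ℂ) : ℂ := w * (w + 1 - θ) / ((w + 1) * (w - θ))

/-- Lexicographic order on the index set `Σ i, Fin (k i)`. -/
def lexLt {m : ℕ} {k : Fin m → ℕ} (p q : (i : Fin m) × Fin (k i)) : Prop :=
  p.1 < q.1 ∨ (p.1 = q.1 ∧ (p.2 : ℕ) < (q.2 : ℕ))


namespace JMF

/-- Relations of the (degenerate) affine Hecke-type operators. -/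
structure DH {E : Type*} [Ring E] [Algebra ℝ E] (n : ℕ) (θ : ℝ) (T : ℕ → E) (p : E) (y : ℕ → E) :
    Prop where
  Tsq : ∀ i, i < n → T i * T i = 1
  braid : ∀ i, i + 1 < n → T i * T (i+1) * T i = T (i+1) * T i * T (i+1)
  far : ∀ i j, i + 1 < j → j < n → T i * T j = T j * T i
  pT : ∀ i, i + 1 < n → p * T (i+1) = T i * p
  ppT : ∀ i, i + 1 = n → p * p * T 0 = T i * p * p
  yT : ∀ i, i < n → y i * T i = T i * y (i+1) + θ • (1 : E)
  yT' : ∀ i, i < n → y (i+1) * T i = T i * y i - θ • (1 : E)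
  y0T : ∀ i, i + 1 < n → y 0 * T (i+1) = T (i+1) * y 0
  yn : y n * p = p * y 0 + p
  y0p : 0 < n → y 0 * p = p * y 1

section
variable {E : Type*} [Ring E] [Algebra ℝ E]

/-- `W j = T 0 * ... * T (j-1)` -/
def W (T : ℕ → E) : ℕ → E
  | 0 => 1
  | j+1 => W T j * T j

/-- `W1 j = T 1 * ... * T j` -/
def W1 (T : ℕ → E) : ℕ → E
  | 0 => 1
  | j+1 => W1 T j * T (j+1)

/-- commuting elements -/
def Xo (n : ℕ) (T : ℕ → E) (p : E) : ℕ → E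
  | 0 => W T n * p
  | i+1 => T i * Xo n T p i * T i

/-- `sg k` is the transposition `(0, k+1)` -/
def sg (T : ℕ → E) : ℕ → E
  | 0 => T 0
  | k+1 => T (k+1) * sg T k * T (k+1)

lemma W_succ {E : Type*} [Ring E] (T : ℕ → E) (j : ℕ) : W T (j+1) = T 0 * W1 T j := by
  induction j with
  | zero => simp [W, W1]
  | succ j ih => rw [W, ih, W1, mul_assoc]

variable {n : ℕ} {θ : ℝ} {T : ℕ → E} {p : E} {y : ℕ → E}

namespace DH
variable (h : DH n θ T p y)
include h

lemma sq' (i : ℕ) (hi : i < n) (a : E) : T i * (T i * a) = a := by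
  rw [← mul_assoc, h.Tsq i hi, one_mul]

lemma br' (i : ℕ) (hi : i + 1 < n) (a : E) :
    T i * (T (i+1) * (T i * a)) = T (i+1) * (T i * (T (i+1) * a)) := by
  have := congrArg (· * a) (h.braid i hi)
  simpa only [mul_assoc] using this

lemma L0 (k i : ℕ) (hik : i < k) (hk : k < n) : Commute (T k) (W T i) := by
  induction i with
  | zero => exact Commute.one_right _
  | succ i ih =>
    exact (ih (by omega)).mul_right (h.far i k (by omega) hk).symm

lemma L1 (i j : ℕ) (hij : i + 1 < j) (hj : j ≤ n) : T (i+1) * W T j = W T j * T i := by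
  induction j, hij using Nat.le_induction with
  | base =>
    have h0 := (h.L0 (i+1) i (by omega) (by omega)).eq
    simp only [W]
    rw [← mul_assoc, ← mul_assoc, h0]
    simp only [mul_assoc]
    rw [← mul_assoc (T i), h.braid i (by omega), mul_assoc]
  | succ j hij ih =>
    simp only [W]
    rw [← mul_assoc, ih (by omega), mul_assoc, mul_assoc, h.far i j (by omega) (by omega)]

lemma L2 (i : ℕ) (hi : i + 1 < n) : Commute (T (i+1)) (Xo n T p 0) := by
  change T (i+1) * (W T n * p) = (W T n * p) * T (i+1)
  rw [← mul_assoc, h.L1 i n hi le_rfl, mul_assoc, mul_assoc, h.pT i hi]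

lemma pW1 (j : ℕ) (hj : j < n) : p * W1 T j = W T j * p := by
  induction j with
  | zero => simp [W, W1]
  | succ j ih =>
    rw [W, W1, ← mul_assoc, ih (by omega), mul_assoc, h.pT j hj, mul_assoc]

lemma W1W (j : ℕ) (hj : j < n) : W1 T j * W T n = W T n * W T j := by
  induction j with
  | zero => simp [W, W1]
  | succ j ih =>
    rw [W, W1, mul_assoc, h.L1 j n hj le_rfl, ← mul_assoc, ih (by omega), mul_assoc]

lemma L3 (hn : 0 < n) : Commute (Xo n T p 0) (Xo n T p 1) := by
  obtain ⟨m, rfl⟩ : ∃ m, n = m + 1 := ⟨n - 1, by omega⟩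
  have e1 : T 0 * Xo (m+1) T p 0 = W1 T m * p := by
    simp only [Xo]
    rw [W_succ, mul_assoc, h.sq' 0 hn]
  have e2 : Xo (m+1) T p 1 = W1 T m * p * T 0 := by
    rw [← e1]; rfl
  have hpp := h.ppT m rfl
  have hW := h.W1W m (by omega)
  have hp := h.pW1 m (by omega)
  change Xo (m+1) T p 0 * Xo (m+1) T p 1 = Xo (m+1) T p 1 * Xo (m+1) T p 0
  calc Xo (m+1) T p 0 * Xo (m+1) T p 1 = W T (m+1) * ((p * W1 T m) * p * T 0) := by
        rw [e2]; simp only [Xo, mul_assoc]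
    _ = W T (m+1) * W T m * (p * p * T 0) := by rw [hp]; simp only [mul_assoc]
    _ = W1 T m * W T (m+1) * (T m * p * p) := by rw [hpp, hW]
    _ = W1 T m * (W T m * p) * p := by
        simp only [W, mul_assoc]; rw [h.sq' m (by omega)]
    _ = W1 T m * p * (T 0 * Xo (m+1) T p 0) := by rw [← hp, e1]; simp only [mul_assoc]
    _ = _ := by rw [e2]; simp only [mul_assoc]

lemma L4 (i j : ℕ) (hi : i ≤ n) (hj : j < n) (h1 : j + 1 ≠ i) (h2 : j ≠ i) :
    Commute (T j) (Xo n T p i) := by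
  induction i using Nat.strong_induction_on generalizing j with
  | _ i ih =>
  match i with
  | 0 =>
    obtain ⟨j, rfl⟩ : ∃ m, j = m + 1 := ⟨j - 1, by omega⟩
    exact h.L2 j hj
  | i+1 =>
    by_cases hji : j + 1 = i
    · subst hji
      have hc := (ih j (by omega) (j+1) (by omega) (by omega) (by omega) (by omega)).eq
      change T j * (T (j+1) * (T j * Xo n T p j * T j) * T (j+1)) =
        (T (j+1) * (T j * Xo n T p j * T j) * T (j+1)) * T j
      have hh : j + 1 < n := by omega
      simp only [mul_assoc]
      rw [h.br' j hh]
      rw [← mul_assoc (T (j+1)) (Xo n T p j), hc]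
      have := h.braid j hh
      simp only [mul_assoc] at this ⊢
      rw [this]
    · have a : Commute (T j) (T i) := by
        rcases lt_or_gt_of_ne (show j ≠ i by omega) with h3 | h3
        · exact h.far j i (by omega) (by omega)
        · exact (h.far i j (by omega) hj).symm
      have b := ih i (by omega) j (by omega) hj hji (by omega)
      exact (a.mul_right b).mul_right a

lemma L5a (j : ℕ) (hj : j + 1 ≤ n) : Commute (Xo n T p 0) (Xo n T p (j+1)) := by
  induction j with
  | zero => exact h.L3 (by omega)
  | succ j ih =>
    have a := (h.L4 0 (j+1) (by omega) (by omega) (by omega) (by omega)).symm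
    exact (a.mul_right (ih (by omega))).mul_right a

lemma L5b (i j : ℕ) (hij : i < j) (hj : j ≤ n) : Commute (Xo n T p i) (Xo n T p j) := by
  induction i with
  | zero =>
    obtain ⟨j, rfl⟩ : ∃ m, j = m + 1 := ⟨j - 1, by omega⟩
    exact h.L5a j hj
  | succ i ih =>
    have a := h.L4 j i hj (by omega) (by omega) (by omega)
    exact (a.mul_left (ih (by omega))).mul_left a

lemma L5 (i j : ℕ) (hi : i ≤ n) (hj : j ≤ n) : Commute (Xo n T p i) (Xo n T p j) := by
  rcases lt_trichotomy i j with h1 | h1 | h1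
  · exact h.L5b i j h1 hj
  · subst h1; exact Commute.refl _
  · exact (h.L5b j i h1 hi).symm

lemma TX (i : ℕ) (hi : i < n) : T i * Xo n T p i = Xo n T p (i+1) * T i := by
  simp only [Xo, mul_assoc]; rw [h.Tsq i hi, mul_one]

lemma TX' (i : ℕ) (hi : i < n) : T i * Xo n T p (i+1) = Xo n T p i * T i := by
  simp only [Xo, mul_assoc]; rw [h.sq' i hi]

lemma L6 (k : ℕ) (hk : k < n) : sg T k * Xo n T p 0 = Xo n T p (k+1) * sg T k := by
  induction k with
  | zero => exact h.TX 0 hk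
  | succ k ih =>
    have a := (h.L4 0 (k+1) (by omega) (by omega) (by omega) (by omega)).eq
    calc sg T (k+1) * Xo n T p 0 = T (k+1) * (sg T k * (T (k+1) * Xo n T p 0)) := by
          simp only [sg, mul_assoc]
      _ = T (k+1) * ((sg T k * Xo n T p 0) * T (k+1)) := by rw [a]; simp only [mul_assoc]
      _ = (T (k+1) * Xo n T p (k+1)) * sg T k * T (k+1) := by
          rw [ih (by omega)]; simp only [mul_assoc]
      _ = _ := by rw [h.TX (k+1) hk]; simp only [sg, mul_assoc]

lemma L6' (k : ℕ) (hk : k < n) : sg T k * Xo n T p (k+1) = Xo n T p 0 * sg T k := by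
  induction k with
  | zero => exact h.TX' 0 hk
  | succ k ih =>
    have a := (h.L4 0 (k+1) (by omega) (by omega) (by omega) (by omega)).eq
    calc sg T (k+1) * Xo n T p (k+1+1) = T (k+1) * (sg T k * (T (k+1) * Xo n T p (k+1+1))) := by
          simp only [sg, mul_assoc]
      _ = T (k+1) * ((sg T k * Xo n T p (k+1)) * T (k+1)) := by
          rw [h.TX' (k+1) hk]; simp only [mul_assoc]
      _ = (T (k+1) * Xo n T p 0) * sg T k * T (k+1) := by
          rw [ih (by omega)]; simp only [mul_assoc]
      _ = _ := by rw [a]; simp only [sg, mul_assoc]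

lemma L6c (k j : ℕ) (hk : k < n) (hj : j + 1 ≤ n) (hjk : j ≠ k) :
    Commute (sg T k) (Xo n T p (j+1)) := by
  induction k with
  | zero => exact h.L4 (j+1) 0 hj hk (by omega) (by omega)
  | succ k ih =>
    by_cases hkj : j = k
    · subst hkj
      have c : Commute (sg T j) (Xo n T p (j+1+1)) := by
        clear ih
        have : ∀ i, i ≤ j → Commute (sg T i) (Xo n T p (j+1+1)) := by
          intro i
          induction i with
          | zero => intro _; exact h.L4 (j+1+1) 0 (by omega) (by omega) (by omega) (by omega)
          | succ i ih =>
            intro hi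
            have a := h.L4 (j+1+1) (i+1) (by omega) (by omega) (by omega) (by omega)
            exact (a.mul_left (ih (by omega))).mul_left a
        exact this j le_rfl
      change sg T (j+1) * Xo n T p (j+1) = Xo n T p (j+1) * sg T (j+1)
      calc sg T (j+1) * Xo n T p (j+1) = T (j+1) * (sg T j * (T (j+1) * Xo n T p (j+1))) := by
            simp only [sg, mul_assoc]
        _ = T (j+1) * ((sg T j * Xo n T p (j+1+1)) * T (j+1)) := by
          rw [h.TX (j+1) hk]; simp only [mul_assoc]
        _ = (T (j+1) * Xo n T p (j+1+1)) * sg T j * T (j+1) := by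
          rw [c.eq]; simp only [mul_assoc]
        _ = _ := by rw [h.TX' (j+1) hk]; simp only [sg, mul_assoc]
    · have a := h.L4 (j+1) (k+1) hj hk (by omega) (by omega)
      exact (a.mul_left (ih (by omega) hkj)).mul_left a

lemma L7 (j : ℕ) (hj : j < n) : sg T j * W T (j+1) = W T j := by
  induction j with
  | zero => simp [sg, W, h.Tsq 0 hj]
  | succ j ih =>
    have c := (h.L0 (j+1) j (by omega) hj).eq
    calc sg T (j+1) * W T (j+1+1) = T (j+1) * (sg T j * ((T (j+1) * W T j) * (T j * T (j+1)))) := by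
          simp only [sg, W, mul_assoc]
      _ = T (j+1) * (sg T j * (W T j * (T (j+1) * T j * T (j+1)))) := by
          rw [c]; simp only [mul_assoc]
      _ = T (j+1) * ((sg T j * W T (j+1)) * (T (j+1) * T j)) := by
          rw [← h.braid j hj]; simp only [W, mul_assoc]
      _ = (T (j+1) * W T j) * T (j+1) * T j := by rw [ih (by omega)]; simp only [mul_assoc]
      _ = _ := by rw [c]; simp only [W, mul_assoc]; rw [h.sq' (j+1) hj]

lemma L8 (j : ℕ) (hj : j ≤ n) :
    y 0 * W T j = W T j * y j + θ • ∑ k ∈ Finset.range j, sg T k * W T j := by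
  induction j with
  | zero => simp [W]
  | succ j ih =>
    rw [Finset.sum_range_succ, h.L7 j (by omega)]
    conv_lhs => rw [W, ← mul_assoc, ih (by omega), add_mul, mul_assoc, h.yT j (by omega)]
    simp only [W, mul_add, smul_add, Finset.sum_mul, smul_mul_assoc, mul_smul_comm, mul_one,
      mul_assoc]
    abel

lemma L9 : y 0 * Xo n T p 0 = Xo n T p 0 * y 0 + Xo n T p 0
    + θ • ∑ k ∈ Finset.range n, Xo n T p (k+1) * sg T k := by
  have : ∑ k ∈ Finset.range n, Xo n T p (k+1) * sg T k
      = ∑ k ∈ Finset.range n, sg T k * W T n * p := by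
    refine Finset.sum_congr rfl fun k hk => ?_
    rw [← h.L6 k (Finset.mem_range.1 hk)]; simp only [Xo, mul_assoc]
  rw [this]
  simp only [Xo]
  rw [← mul_assoc, h.L8 n le_rfl, add_mul, mul_assoc, h.yn, mul_add, smul_mul_assoc,
    Finset.sum_mul, mul_assoc]

lemma L10a (hn : 0 < n) : y 1 * Xo n T p 0 = Xo n T p 0 * y 1 - θ • (T 0 * Xo n T p 0) := by
  obtain ⟨m, rfl⟩ : ∃ m, n = m + 1 := ⟨n - 1, by omega⟩
  have c : ∀ j, j ≤ m → Commute (y 0) (W1 T j) := by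
    intro j
    induction j with
    | zero => intro _; exact Commute.one_right _
    | succ j ih => intro hj; exact (ih (by omega)).mul_right (h.y0T j (by omega))
  have e1 : T 0 * Xo (m+1) T p 0 = W1 T m * p := by
    simp only [Xo]
    rw [W_succ, mul_assoc, h.sq' 0 hn]
  rw [e1]
  simp only [Xo]
  rw [W_succ]
  calc y 1 * (T 0 * W1 T m * p) = (y 1 * T 0) * (W1 T m * p) := by simp only [mul_assoc]
    _ = T 0 * ((y 0 * W1 T m) * p) - θ • (W1 T m * p) := by
      rw [show (1:ℕ) = 0 + 1 from rfl, h.yT' 0 hn]; simp only [sub_mul, mul_assoc, smul_mul_assoc, one_mul]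
    _ = _ := by rw [(c m le_rfl).eq, mul_assoc, h.y0p hn]; simp only [mul_assoc]

lemma L10 (k : ℕ) (hk : k < n) :
    y 0 * Xo n T p (k+1) = Xo n T p (k+1) * y 0 - θ • (Xo n T p (k+1) * sg T k) := by
  induction k with
  | zero =>
    have e : Xo n T p (0+1) * sg T 0 = T 0 * Xo n T p 0 := (h.TX 0 hk).symm
    rw [e]
    calc y 0 * Xo n T p (0+1) = (y 0 * T 0) * (Xo n T p 0 * T 0) := by simp only [Xo, mul_assoc]
      _ = T 0 * ((y 1 * Xo n T p 0) * T 0) + θ • (Xo n T p 0 * T 0) := by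
        rw [h.yT 0 hk]; simp only [add_mul, smul_mul_assoc, one_mul, mul_assoc, zero_add]
      _ = T 0 * Xo n T p 0 * (y 1 * T 0) := by
        rw [h.L10a hk]
        simp only [sub_mul, mul_sub, smul_mul_assoc, mul_smul_comm, mul_assoc]
        rw [h.sq' 0 hk]; abel
      _ = _ := by
        rw [show (1:ℕ) = 0 + 1 from rfl, h.yT' 0 hk]
        simp only [Xo, mul_sub, mul_smul_comm, mul_one, mul_assoc]
  | succ k ih =>
    have c := h.y0T k hk
    calc y 0 * Xo n T p (k+1+1) = (y 0 * T (k+1)) * (Xo n T p (k+1) * T (k+1)) := by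
          simp only [Xo, mul_assoc]
      _ = T (k+1) * ((y 0 * Xo n T p (k+1)) * T (k+1)) := by rw [c]; simp only [mul_assoc]
      _ = T (k+1) * Xo n T p (k+1) * (y 0 * T (k+1))
          - θ • (T (k+1) * Xo n T p (k+1) * sg T k * T (k+1)) := by
        rw [ih (by omega)]
        simp only [sub_mul, mul_sub, smul_mul_assoc, mul_smul_comm, mul_assoc]
      _ = _ := by
        rw [c, h.TX (k+1) hk]
        conv_rhs => rw [sg]
        have : Xo n T p (k+1+1) * y 0 = Xo n T p (k+1+1) * T (k+1) * (T (k+1) * y 0) := by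
          simp only [mul_assoc]; rw [h.sq' (k+1) hk]
        rw [this]
        simp only [mul_assoc]
end DH
end
end JMF

namespace JMF
open MvPolynomial

lemma exists_ev {E : Type*} [Ring E] [Algebra ℝ E] {N : ℕ} (x : Fin N → E)
    (hx : ∀ i j, Commute (x i) (x j)) :
    ∃ φ : MvPolynomial (Fin N) ℝ →ₐ[ℝ] E, ∀ i, φ (X i) = x i := by
  have hc : ∀ a ∈ Set.range x, ∀ b ∈ Set.range x, a * b = b * a := by
    rintro _ ⟨i, rfl⟩ _ ⟨j, rfl⟩; exact (hx i j).eq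
  let _ : CommRing (Algebra.adjoin ℝ (Set.range x)) :=
    { (inferInstance : Ring (Algebra.adjoin ℝ (Set.range x))) with
      mul_comm := (Algebra.isMulCommutative_adjoin ℝ hc).is_comm.comm }
  let z : Fin N → Algebra.adjoin ℝ (Set.range x) :=
    fun i => ⟨x i, Algebra.subset_adjoin (Set.mem_range_self i)⟩
  refine ⟨(Algebra.adjoin ℝ (Set.range x)).val.comp (MvPolynomial.aeval z), fun i => ?_⟩
  simp [z]

/-- The loop equation for a functional on polynomials. -/
def Loop (n : ℕ) (θ a c : ℝ) (L : MvPolynomial (Fin (n+1)) ℝ →ₗ[ℝ] ℂ) : Prop :=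
  ∀ (G : MvPolynomial (Fin (n+1)) ℝ) (Q : Fin n → MvPolynomial (Fin (n+1)) ℝ),
    (∀ k : Fin n, (X 0 - X k.succ) * Q k = G - rename (Equiv.swap 0 k.succ) G) →
    L (X 0 * (1 - X 0) * pderiv 0 G + θ • ∑ k : Fin n, X k.succ * (1 - X k.succ) * Q k
      + θ • ∑ k : Fin n, (1 - X 0 - X k.succ) * G + (C a - C c * X 0) * G) = 0

/-- Symmetric functional. -/
def SymL (n : ℕ) (L : MvPolynomial (Fin (n+1)) ℝ →ₗ[ℝ] ℂ) : Prop :=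
  ∀ (σ : Equiv.Perm (Fin (n+1))) G, L (rename σ G) = L G

section
variable {E : Type*} [Ring E] [Algebra ℝ E] {n : ℕ} {θ : ℝ} {T : ℕ → E} {p : E} {y : ℕ → E}

lemma DH.comm_ev (h : DH n θ T p y) (φ : MvPolynomial (Fin (n+1)) ℝ →ₐ[ℝ] E)
    (hφ : ∀ i : Fin (n+1), φ (X i) = Xo n T p i) (G : MvPolynomial (Fin (n+1)) ℝ) :
    ∃ Q : Fin n → MvPolynomial (Fin (n+1)) ℝ,
      (∀ k : Fin n, (X 0 - X k.succ) * Q k = G - rename (Equiv.swap 0 k.succ) G) ∧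
      y 0 * φ G = φ G * y 0 + φ (X 0 * pderiv 0 G)
        + θ • ∑ k : Fin n, φ (X k.succ * Q k) * sg T k := by
  induction G using MvPolynomial.induction_on with
  | C a =>
    refine ⟨0, fun k => by simp, ?_⟩
    have : φ (C a) = algebraMap ℝ E a := φ.commutes a
    rw [this]
    simp [Algebra.commutes]
  | add G H hG hH =>
    obtain ⟨Q, h1, h2⟩ := hG
    obtain ⟨Q', h1', h2'⟩ := hH
    refine ⟨Q + Q', fun k => ?_, ?_⟩
    · simp only [Pi.add_apply, mul_add, h1, h1', map_add]; ring
    · simp only [Pi.add_apply, map_add, mul_add, add_mul, h2, h2', Finset.sum_add_distrib, smul_add]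
      abel
  | mul_X G i hG =>
    obtain ⟨Q, h1, h2⟩ := hG
    have hX0 : φ (X 0) = Xo n T p 0 := hφ 0
    have hXs : ∀ k : Fin n, φ (X k.succ) = Xo n T p (k+1) := fun k => hφ k.succ
    have L9 : y 0 * Xo n T p 0 = Xo n T p 0 * y 0 + Xo n T p 0
        + θ • ∑ k : Fin n, Xo n T p (k+1) * sg T k := by
      rw [h.L9, Finset.sum_range (n := n)]
    rcases Fin.eq_zero_or_eq_succ i with rfl | ⟨i, rfl⟩
    · refine ⟨fun k => G + Q k * X k.succ, fun k => ?_, ?_⟩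
      · have := h1 k
        simp only [map_mul, rename_X, Equiv.swap_apply_left]
        linear_combination X k.succ * this
      · rw [map_mul, ← mul_assoc, h2]
        have e : ∀ k : Fin n, φ (X k.succ * Q k) * sg T k * Xo n T p 0 + φ G * (Xo n T p (k+1) * sg T k)
            = φ (X k.succ * (G + Q k * X k.succ)) * sg T k := by
          intro k
          rw [mul_assoc, h.L6 k k.2, ← hXs, ← mul_assoc, ← mul_assoc, ← map_mul, ← map_mul, ← add_mul,
            ← map_add]
          congr 2; ring
        simp only [← e, Finset.sum_add_distrib, hX0]
        simp only [add_mul, mul_assoc, L9, smul_mul_assoc, Finset.sum_mul, ← Finset.mul_sum, mul_add,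
          mul_smul_comm, smul_add]
        have e2 : φ (X 0 * pderiv 0 (G * X 0)) = φ (X 0 * pderiv 0 G) * Xo n T p 0 + φ G * Xo n T p 0 := by
          rw [← hX0, ← map_mul, ← map_mul, ← map_add]
          congr 1
          rw [Derivation.leibniz, pderiv_X_self]
          simp only [smul_eq_mul]; ring
        rw [e2]
        abel
    · refine ⟨Function.update (fun k => Q k * X i.succ) i (Q i * X 0 - G), fun k => ?_, ?_⟩
      · have := h1 k
        by_cases hk : k = i
        · subst hk
          simp only [map_mul, rename_X, Equiv.swap_apply_right, Function.update_self]
          linear_combination X 0 * this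
        · rw [Function.update_of_ne hk]
          have : Equiv.swap 0 k.succ i.succ = i.succ := by
            apply Equiv.swap_apply_of_ne_of_ne (Fin.succ_ne_zero _)
            simpa using fun h => hk h.symm
          simp only [map_mul, rename_X, this]
          linear_combination X i.succ * h1 k
      · rw [map_mul, ← mul_assoc, h2]
        have e : ∀ k : Fin n, φ (X k.succ * (Function.update (fun k => Q k * X i.succ) i (Q i * X 0 - G) k)) * sg T k
            = φ (X k.succ * Q k) * sg T k * Xo n T p (i+1) -
              (if k = i then φ G * Xo n T p (i+1) * sg T i else 0) := by
          intro k
          by_cases hk : k = i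
          · subst hk
            simp only [Function.update_self, if_true]
            rw [mul_assoc _ (sg T k), h.L6' k k.2, ← hXs, ← hX0, ← mul_assoc, ← map_mul, ← map_mul, ← sub_mul, ← map_sub]
            congr 2; ring
          · rw [Function.update_of_ne hk, if_neg hk, sub_zero, mul_assoc _ (sg T k),
              (h.L6c k i k.2 (by omega) (by simpa [Fin.ext_iff] using fun h => hk (Fin.ext h.symm))).eq, ← hXs]
            simp only [map_mul, mul_assoc]
        simp only [e, Finset.sum_sub_distrib, Finset.sum_ite_eq', Finset.mem_univ, if_true]
        have e2 : φ (X 0 * pderiv 0 (G * X i.succ)) = φ (X 0 * pderiv 0 G) * Xo n T p (i+1) := by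
          rw [← hXs, ← map_mul]
          congr 1
          rw [Derivation.leibniz, pderiv_X_of_ne (by simp)]
          simp only [smul_eq_mul]; ring
        rw [e2, hXs]
        simp only [add_mul, mul_assoc, h.L10 i i.2, smul_mul_assoc, Finset.sum_mul, mul_sub,
          mul_smul_comm, smul_sub]
        abel
end

section
variable {V : Type*} [AddCommGroup V] [Module ℝ V] {n : ℕ} {θ : ℝ} {T : ℕ → Module.End ℝ V}
  {p : Module.End ℝ V} {y : ℕ → Module.End ℝ V}

lemma W_fix (v : V) (hv : ∀ i, i < n → T i v = v) (j : ℕ) (hj : j ≤ n) : W T j v = v := by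
  induction j with
  | zero => rfl
  | succ j ih => rw [W, Module.End.mul_apply, hv j hj, ih (by omega)]

lemma sg_fix (v : V) (hv : ∀ i, i < n → T i v = v) (j : ℕ) (hj : j < n) : sg T j v = v := by
  induction j with
  | zero => exact hv 0 hj
  | succ j ih =>
    rw [sg, Module.End.mul_apply, Module.End.mul_apply, hv _ hj, ih (by omega), hv _ hj]

lemma DH.base_eq (h : DH n θ T p y) (v : V) (hv : ∀ i, i < n → T i v = v) (A B : ℝ)
    (hp : y n (p v) - B • p v = y n v - A • v) :
    y 0 (Xo n T p 0 v) - B • Xo n T p 0 v - θ • ∑ k ∈ Finset.range n, Xo n T p (k+1) v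
      = y 0 v - (A + θ * n) • v := by
  have h8 := fun w : V => congrArg (fun f : Module.End ℝ V => f w) (h.L8 n le_rfl)
  simp only [Module.End.mul_apply, LinearMap.add_apply, LinearMap.smul_apply, LinearMap.sum_apply] at h8
  have e1 := h8 v
  have e2 := h8 (p v)
  have s1 : ∑ k ∈ Finset.range n, sg T k (W T n v) = n • v := by
    rw [Finset.sum_congr rfl (g := fun _ => v)]
    · simp
    · intro k hk
      rw [W_fix v hv n le_rfl, sg_fix v hv k (Finset.mem_range.1 hk)]
  have s2 : ∑ k ∈ Finset.range n, sg T k (W T n (p v)) = ∑ k ∈ Finset.range n, Xo n T p (k+1) v := by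
    refine Finset.sum_congr rfl fun k hk => ?_
    have := congrArg (fun f : Module.End ℝ V => f v) (h.L6 k (Finset.mem_range.1 hk))
    simp only [Module.End.mul_apply, sg_fix v hv k (Finset.mem_range.1 hk)] at this
    rw [← this]; rfl
  rw [s1] at e1
  rw [s2] at e2
  have hp' := congrArg (fun w => W T n w) hp
  simp only [map_sub, map_smul] at hp'
  rw [W_fix v hv n le_rfl] at e1 hp'
  have e0 : Xo n T p 0 v = W T n (p v) := rfl
  rw [e0, e2, e1, add_sub_right_comm, hp', add_smul, mul_smul]
  rw [← Nat.cast_smul_eq_nsmul ℝ]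
  abel

lemma DH.loop (h : DH n θ T p y) (φ : MvPolynomial (Fin (n+1)) ℝ →ₐ[ℝ] Module.End ℝ V)
    (hφ : ∀ i : Fin (n+1), φ (X i) = Xo n T p i)
    (v : V) (hv : ∀ i, i < n → T i v = v) (e : V →ₗ[ℝ] ℂ)
    (he : ∀ i, i < n → ∀ w, e (T i w) = e w) (hey : ∀ w, e (y 0 w) = -(θ • e w)) (A B : ℝ)
    (hp : y n (p v) - B • p v = y n v - A • v) (L : MvPolynomial (Fin (n+1)) ℝ →ₗ[ℝ] ℂ)
    (hL : ∀ G, L G = e (φ G v)) :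
    Loop n θ (A + θ) (B + θ - θ * n) L ∧ SymL n L := by
  have key : ∀ G (Q : Fin n → MvPolynomial (Fin (n+1)) ℝ),
    (∀ k : Fin n, (X 0 - X k.succ) * Q k = G - rename (Equiv.swap 0 k.succ) G) →
     φ G (y 0 v) = y 0 (φ G v) - φ (X 0 * pderiv 0 G) v - θ • ∑ k : Fin n, φ (X k.succ * Q k) v := by
    intro G Q hQ
    obtain ⟨Q', h1, h2⟩ := h.comm_ev φ hφ G
    have : Q' = Q := by
      funext k
      have hne : (X 0 - X k.succ : MvPolynomial (Fin (n+1)) ℝ) ≠ 0 := by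
        rw [sub_ne_zero]
        intro hh
        exact (Fin.succ_ne_zero k) (X_injective hh).symm
      exact mul_left_cancel₀ hne ((h1 k).trans (hQ k).symm)
    subst this
    have := congrArg (fun f : Module.End ℝ V => f v) h2
    simp only [Module.End.mul_apply, LinearMap.add_apply, LinearMap.smul_apply, LinearMap.sum_apply] at this
    rw [this]
    have : ∀ k : Fin n, sg T k v = v := fun k => sg_fix v hv k k.2
    simp only [this]
    abel
  have hb := h.base_eq v hv A B hp
  rw [Finset.sum_range] at hb
  have hX0 : φ (X 0) = Xo n T p 0 := hφ 0
  have hXs : ∀ k : Fin n, φ (X k.succ) = Xo n T p (k+1) := fun k => hφ k.succ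
  constructor
  · intro G Q hQ
    have k1 := congrArg e (key G Q hQ)
    have k2 := congrArg e (key (G * X 0) (fun k => G + Q k * X k.succ) (by
      intro k
      have := hQ k
      simp only [map_mul, rename_X, Equiv.swap_apply_left]
      linear_combination X k.succ * this))
    have L9 := congrArg (fun f : Module.End ℝ V => f v) h.L9
    rw [Finset.sum_range] at L9
    have : ∀ k : Fin n, sg T k v = v := fun k => sg_fix v hv k k.2
    simp only [Module.End.mul_apply, LinearMap.add_apply, LinearMap.smul_apply, LinearMap.sum_apply, this] at L9
    rw [L9] at hb
    have k3 := congrArg (fun w => e (φ G w)) hb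
    simp only [map_mul, hX0, Module.End.mul_apply] at k1 k2 k3 ⊢
    simp only [map_add, map_sub, map_smul, map_sum, hey] at k1 k2 k3
    have d : pderiv 0 (G * X 0) = X 0 * pderiv 0 G + G := by
      rw [Derivation.leibniz, pderiv_X_self]
      simp only [smul_eq_mul]; ring
    have E1 : e (φ G (Xo n T p 0 v)) = L (X 0 * G) := by
      rw [hL, mul_comm, map_mul, hX0]; rfl
    have E1' : e (φ G v) = L G := (hL G).symm
    have E2 : ∀ k : Fin n, e (φ G (Xo n T p (k+1) v)) = L (X k.succ * G) := by
      intro k; rw [hL, mul_comm, map_mul, hXs]; rfl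
    have E3 : ∀ k : Fin n, e (φ (X k.succ) (φ (Q k) v)) = L (X k.succ * Q k) := by
      intro k; rw [hL, map_mul]; rfl
    have E4 : ∀ k : Fin n, e (φ (X k.succ) (φ G v)) = L (X k.succ * G) := by
      intro k; rw [hL, map_mul]; rfl
    have E5 : ∀ k : Fin n, e (φ (X k.succ) (φ (Q k * X k.succ) v)) = L (X k.succ * Q k * X k.succ) := by
      intro k; rw [hL, mul_assoc]; simp only [map_mul, Module.End.mul_apply]
    have E6 : e (Xo n T p 0 (φ (pderiv 0 G) v)) = L (X 0 * pderiv 0 G) := by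
      rw [hL, map_mul, hX0]; rfl
    have E7 : e (Xo n T p 0 (φ (pderiv 0 (G * X 0)) v)) = L (X 0 * (X 0 * pderiv 0 G + G)) := by
      rw [d, hL, map_mul φ, hX0]; rfl
    simp only [LinearMap.add_apply, map_add, Module.End.mul_apply, E1, E1', E2, E3, E4, E5, E6, E7] at k1 k2 k3
    have Z : X 0 * (1 - X 0) * pderiv 0 G + θ • ∑ k : Fin n, X k.succ * (1 - X k.succ) * Q k
      + θ • ∑ k : Fin n, (1 - X 0 - X k.succ) * G + (C (A + θ) - C (B + θ - θ * n) * X 0) * G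
      = X 0 * pderiv 0 G - X 0 * (X 0 * pderiv 0 G + G) + X 0 * G
        + θ • ∑ k : Fin n, X k.succ * Q k - θ • ∑ k : Fin n, X k.succ * Q k * X k.succ
        + (A + θ + θ * n) • G - (B + θ) • (X 0 * G) - θ • ∑ k : Fin n, X k.succ * G := by
      have s1 : ∑ k : Fin n, X k.succ * (1 - X k.succ) * Q k = ∑ k : Fin n, X k.succ * Q k
        - ∑ k : Fin n, X k.succ * Q k * X k.succ := by
        rw [← Finset.sum_sub_distrib]; exact Finset.sum_congr rfl fun k _ => by ring
      have s2 : ∑ k : Fin n, (1 - X 0 - X k.succ) * G = (n : MvPolynomial (Fin (n+1)) ℝ) * (G - X 0 * G)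
        - ∑ k : Fin n, X k.succ * G := by
        simp only [sub_mul, Finset.sum_sub_distrib]
        simp [mul_sub]
      rw [s1, s2]
      simp only [smul_eq_C_mul, map_add, map_sub, map_mul, map_natCast]
      ring
    rw [Z]
    simp only [map_add, map_sub, map_smul, map_sum, Complex.real_smul, Finset.sum_add_distrib] at *
    push_cast at *
    linear_combination k3 - k2 + k1
  · have hadj : ∀ (i : Fin n) G, T i * φ G = φ (rename (Equiv.swap i.castSucc i.succ) G) * T i := by
      intro i G
      induction G using MvPolynomial.induction_on with
      | C a =>
        have : φ (C a) = algebraMap ℝ _ a := φ.commutes a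
        rw [rename_C, this, Algebra.commutes]
      | add G H hG hH => simp only [map_add, mul_add, add_mul, hG, hH]
      | mul_X G j hG =>
        rw [map_mul, map_mul, map_mul, ← mul_assoc, hG, mul_assoc, mul_assoc]
        congr 1
        rw [rename_X, hφ, hφ]
        by_cases h1 : j = i.castSucc
        · subst h1
          rw [Equiv.swap_apply_left]; exact h.TX i i.2
        · by_cases h2 : j = i.succ
          · subst h2
            rw [Equiv.swap_apply_right]; exact h.TX' i i.2
          · rw [Equiv.swap_apply_of_ne_of_ne h1 h2]
            refine (h.L4 j i (by omega) i.2 ?_ ?_).eq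
            · intro hh; exact h2 (Fin.ext (by simp [← hh]))
            · intro hh; exact h1 (Fin.ext (by simp [← hh]))
    intro σ
    have hmem : σ ∈ Submonoid.closure
        (Set.range fun i : Fin n => Equiv.swap i.castSucc i.succ) := by
      rw [Equiv.Perm.mclosure_swap_castSucc_succ]; trivial
    induction hmem using Submonoid.closure_induction with
    | mem x hx =>
      obtain ⟨i, rfl⟩ := hx
      intro G
      have := congrArg (fun f : Module.End ℝ V => e (f v)) (hadj i G)
      simp only [Module.End.mul_apply, hv i i.2, he i i.2] at this
      rw [hL, hL, ← this]
    | one => intro G; simp [rename_id]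
    | mul a b _ _ ha hb =>
      intro G
      rw [Equiv.Perm.coe_mul, ← rename_rename, ha, hb]
end
end JMF

namespace JMF
open MvPolynomial

/-- monomial with exponents `s` -/
noncomputable def mon {N : ℕ} (s : Fin N → ℕ) : MvPolynomial (Fin N) ℝ := ∏ i, X i ^ s i

/-- remaining factor -/
noncomputable def monR {n : ℕ} (s : Fin (n+1) → ℕ) (k : Fin n) : MvPolynomial (Fin (n+1)) ℝ :=
  ∏ i ∈ (Finset.univ.erase 0).erase k.succ, X i ^ s i

lemma mon_split {n : ℕ} (s : Fin (n+1) → ℕ) (k : Fin n) (p q : ℕ) :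
    X 0 ^ p * (X k.succ ^ q * monR s k)
      = mon (Function.update (Function.update s 0 p) k.succ q) := by
  have h0 : (0 : Fin (n+1)) ≠ k.succ := (Fin.succ_ne_zero k).symm
  rw [mon, ← Finset.mul_prod_erase Finset.univ _ (Finset.mem_univ 0),
    ← Finset.mul_prod_erase (Finset.univ.erase 0) _ (a := k.succ) (by simp)]
  rw [Function.update_of_ne h0, Function.update_self, Function.update_self, monR]
  congr 2
  refine Finset.prod_congr rfl fun i hi => ?_
  simp only [Finset.mem_erase, Finset.mem_univ, and_true] at hi
  rw [Function.update_of_ne hi.1, Function.update_of_ne hi.2]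

lemma sum_split {n : ℕ} (f : ℕ → ℕ) (s : Fin (n+1) → ℕ) (k : Fin n) (p q : ℕ) :
    ∑ i, f (Function.update (Function.update s 0 p) k.succ q i) + f (s 0) + f (s k.succ)
      = ∑ i, f (s i) + f p + f q := by
  have h0 : (0 : Fin (n+1)) ≠ k.succ := (Fin.succ_ne_zero k).symm
  rw [← Finset.add_sum_erase Finset.univ _ (Finset.mem_univ 0),
    ← Finset.add_sum_erase (Finset.univ.erase 0) _ (a := k.succ) (by simp)]
  rw [← Finset.add_sum_erase Finset.univ (fun i => f (s i)) (Finset.mem_univ 0),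
    ← Finset.add_sum_erase (Finset.univ.erase 0) (fun i => f (s i)) (a := k.succ) (by simp)]
  rw [Function.update_of_ne h0, Function.update_self, Function.update_self]
  have : ∑ i ∈ (Finset.univ.erase 0).erase k.succ, f (Function.update (Function.update s 0 p) k.succ q i)
    = ∑ i ∈ (Finset.univ.erase 0).erase k.succ, f (s i) := by
    refine Finset.sum_congr rfl fun i hi => ?_
    simp only [Finset.mem_erase, Finset.mem_univ, and_true] at hi
    rw [Function.update_of_ne hi.1, Function.update_of_ne hi.2]
  rw [this]; omega

lemma rename_monR {n : ℕ} (s : Fin (n+1) → ℕ) (k : Fin n) :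
    rename (Equiv.swap 0 k.succ) (monR s k) = monR s k := by
  rw [monR, map_prod]
  refine Finset.prod_congr rfl fun i hi => ?_
  simp only [Finset.mem_erase, Finset.mem_univ, and_true] at hi
  rw [map_pow, rename_X, Equiv.swap_apply_of_ne_of_ne hi.2 hi.1]

lemma rename_split {n : ℕ} (s : Fin (n+1) → ℕ) (k : Fin n) (p q : ℕ) :
    rename (Equiv.swap 0 k.succ) (X 0 ^ p * (X k.succ ^ q * monR s k))
      = X 0 ^ q * (X k.succ ^ p * monR s k) := by
  rw [map_mul, map_mul, map_pow, map_pow, rename_X, rename_X, rename_monR, Equiv.swap_apply_left,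
    Equiv.swap_apply_right]; ring

lemma uniq_step {n : ℕ} (L : MvPolynomial (Fin (n+1)) ℝ →ₗ[ℝ] ℂ) (hs : SymL n L)
    (s : Fin (n+1) → ℕ) (a : ℕ) (ha : s 0 = a + 1) (hmax : ∀ j, s j ≤ s 0)
    (IH1 : ∀ t : Fin (n+1) → ℕ, ∑ i, t i < ∑ i, s i → L (mon t) = 0)
    (IH2 : ∀ t : Fin (n+1) → ℕ, ∑ i, t i = ∑ i, s i → ∑ i, (t i)^2 < ∑ i, (s i)^2 → L (mon t) = 0)
    (G : MvPolynomial (Fin (n+1)) ℝ) (hG : G = mon (Function.update s 0 a)) (k : Fin n) :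
    ∃ Q, (X 0 - X k.succ) * Q = G - rename (Equiv.swap 0 k.succ) G ∧ L (X k.succ * Q) = 0 ∧
      ∃ c : ℝ, 0 ≤ c ∧ L (X k.succ * X k.succ * Q + X k.succ * G) = c • L (mon s) := by
  set R := monR s k with hR
  set b := s k.succ with hb
  have h0 : (0 : Fin (n+1)) ≠ k.succ := (Fin.succ_ne_zero k).symm
  have hG' : G = X 0 ^ a * (X k.succ ^ b * R) := by
    rw [mon_split, hG]; congr 1
    rw [Function.update_comm h0, hb, Function.update_eq_self]
  have hms : mon s = X 0 ^ (a+1) * (X k.succ ^ b * R) := by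
    rw [mon_split, ← ha, hb, Function.update_eq_self, Function.update_eq_self]
  have d1 : ∀ p q, p + q < a + 1 + b → L (X 0 ^ p * (X k.succ ^ q * R)) = 0 := by
    intro p q h
    rw [hR, mon_split]
    apply IH1
    have := sum_split (fun x => x) s k p q
    omega
  have d2 : ∀ p q, p + q = a + 1 + b → p ≤ a → q ≤ a → L (X 0 ^ p * (X k.succ ^ q * R)) = 0 := by
    intro p q h hp hq
    rw [hR, mon_split]
    apply IH2
    · have := sum_split (fun x => x) s k p q
      omega
    · have := sum_split (fun x => x^2) s k p q
      have h3 : p^2 + q^2 < (s 0)^2 + (s k.succ)^2 := by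
        rw [ha, ← hb]
        obtain ⟨x, rfl⟩ := Nat.exists_eq_add_of_le hp
        have : q = x + 1 + b := by omega
        subst this
        obtain ⟨z, rfl⟩ : ∃ z, p = z + 1 + b := ⟨p - 1 - b, by omega⟩
        nlinarith [Nat.zero_le (x*z), Nat.zero_le x, Nat.zero_le z]
      omega
  have d3 : L (X 0 ^ b * (X k.succ ^ (a+1) * R)) = L (mon s) := by
    rw [hms, ← rename_split, hs]
  have hren : rename (Equiv.swap 0 k.succ) G = X 0 ^ b * (X k.succ ^ a * R) := by
    rw [hG', rename_split]
  rw [hren, hG', hms]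
  have hba : b ≤ a + 1 := by rw [← ha]; exact hmax _
  rcases Nat.lt_or_ge a b with h1 | h1
  · have : b = a + 1 := by omega
    rw [this] at *
    refine ⟨-(X 0 ^ a * (X k.succ ^ a * R)), by ring, ?_, 0, le_rfl, ?_⟩
    · rw [show X k.succ * -(X 0 ^ a * (X k.succ ^ a * R)) = -(X 0 ^ a * (X k.succ ^ (a+1) * R)) by ring,
        map_neg, d1 _ _ (by omega), neg_zero]
    · rw [show X k.succ * X k.succ * -(X 0 ^ a * (X k.succ ^ a * R)) + X k.succ * (X 0 ^ a * (X k.succ ^ (a+1) * R))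
        = 0 by ring]; simp
  · rcases h1.eq_or_lt with h2 | h2
    · subst h2
      refine ⟨0, by ring, by simp, 1, zero_le_one, ?_⟩
      rw [one_smul, ← hms, ← d3]
      congr 1; ring
    · obtain ⟨e, rfl⟩ : ∃ e, a = b + 1 + e := ⟨a - b - 1, by omega⟩
      refine ⟨(∑ j ∈ Finset.range (e+1), X 0 ^ (e - j) * X k.succ ^ j) * (X 0 ^ b * (X k.succ ^ b * R)), ?_, ?_, 1, zero_le_one, ?_⟩
      · have := (Commute.all (X 0 : MvPolynomial (Fin (n+1)) ℝ) (X k.succ)).mul_geom_sum₂ (e+1)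
        have e2 : ∑ j ∈ Finset.range (e+1), X 0 ^ (e - j) * X k.succ ^ j
           = ∑ i ∈ Finset.range (e + 1), (X 0 : MvPolynomial (Fin (n+1)) ℝ) ^ i * X k.succ ^ (e + 1 - 1 - i) := by
          rw [← Finset.sum_range_reflect]
          refine Finset.sum_congr rfl fun i hi => ?_
          rw [Finset.mem_range] at hi
          congr 2 <;> omega
        rw [e2]
        linear_combination (X 0 ^ b * (X k.succ ^ b * R)) * this
      · rw [Finset.sum_mul, Finset.mul_sum, map_sum]
        refine Finset.sum_eq_zero fun j hj => ?_
        rw [Finset.mem_range] at hj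
        rw [show X k.succ * (X 0 ^ (e - j) * X k.succ ^ j * (X 0 ^ b * (X k.succ ^ b * R)))
          = X 0 ^ (e - j + b) * (X k.succ ^ (b + j + 1) * R) by ring]
        exact d1 _ _ (by omega)
      · rw [one_smul, map_add, ← hms]
        rw [show X k.succ * (X 0 ^ (b + 1 + e) * (X k.succ ^ b * R)) = X 0 ^ (b + 1 + e) * (X k.succ ^ (b+1) * R) by ring,
          d2 _ _ (by omega) (by omega) (by omega), add_zero, Finset.sum_mul, Finset.mul_sum, map_sum,
          Finset.sum_range_succ, Finset.sum_eq_zero, zero_add, ← d3]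
        · congr 1
          rw [Nat.sub_self]; ring
        · intro j hj
          rw [Finset.mem_range] at hj
          rw [show X k.succ * X k.succ * (X 0 ^ (e - j) * X k.succ ^ j * (X 0 ^ b * (X k.succ ^ b * R)))
            = X 0 ^ (e - j + b) * (X k.succ ^ (b + j + 2) * R) by ring]
          exact d2 _ _ (by omega) (by omega) (by omega)

lemma uniq {n : ℕ} {θ a c : ℝ} (hθ : 0 < θ) (hc : 0 < c)
    (L : MvPolynomial (Fin (n+1)) ℝ →ₗ[ℝ] ℂ) (hs : SymL n L) (hL : Loop n θ a c L) (h1 : L 1 = 0) :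
    L = 0 := by
  have main : ∀ d S : ℕ, ∀ s : Fin (n+1) → ℕ, ∑ i, s i = d → ∑ i, (s i)^2 = S → L (mon s) = 0 := by
    intro d
    induction d using Nat.strong_induction_on with
    | _ d ihd =>
    intro S
    induction S using Nat.strong_induction_on with
    | _ S ihS =>
    intro s hsd hsS
    obtain ⟨i0, -, hi0⟩ := Finset.exists_max_image Finset.univ s ⟨0, Finset.mem_univ _⟩
    -- symmetrize
    set t : Fin (n+1) → ℕ := s ∘ (Equiv.swap 0 i0) with ht
    have htm : L (mon t) = L (mon s) := by
      rw [← hs (Equiv.swap 0 i0) (mon t)]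
      congr 1
      rw [mon, map_prod, mon]
      rw [← Equiv.prod_comp (Equiv.swap 0 i0) (fun i => X i ^ s i)]
      simp [ht, rename_X]
    have htd : ∑ i, t i = d := by rw [← hsd, ← Equiv.sum_comp (Equiv.swap 0 i0) s]; rfl
    have htS : ∑ i, (t i)^2 = S := by
      rw [← hsS, ← Equiv.sum_comp (Equiv.swap 0 i0) (fun i => (s i)^2)]; rfl
    have ht0 : ∀ j, t j ≤ t 0 := by
      intro j; simp only [ht, Function.comp, Equiv.swap_apply_left]; exact hi0 _ (Finset.mem_univ _)
    rw [← htm]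
    rcases Nat.eq_zero_or_pos (t 0) with h0 | h0
    · have : mon t = 1 := by
        rw [mon]
        refine Finset.prod_eq_one fun i _ => ?_
        have := ht0 i
        rw [show t i = 0 by omega, pow_zero]
      rw [this, h1]
    obtain ⟨p, hp⟩ : ∃ p, t 0 = p + 1 := ⟨t 0 - 1, by omega⟩
    set G := mon (Function.update t 0 p) with hG
    have IH1 : ∀ r : Fin (n+1) → ℕ, ∑ i, r i < ∑ i, t i → L (mon r) = 0 := fun r hr =>
      ihd _ (by omega) _ r rfl rfl
    have IH2 : ∀ r : Fin (n+1) → ℕ, ∑ i, r i = ∑ i, t i → ∑ i, (r i)^2 < ∑ i, (t i)^2 → L (mon r) = 0 :=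
      fun r hr hr2 => ihS _ (by omega) r (by omega) rfl
    choose Q hQ hQ1 cc hcc hQ2 using uniq_step L hs t p hp ht0 IH1 IH2 G hG
    have hloop := hL G Q hQ
    have hG0 : G = X 0 ^ p * ∏ i ∈ Finset.univ.erase 0, X i ^ t i := by
      rw [hG, mon, ← Finset.mul_prod_erase Finset.univ _ (Finset.mem_univ 0), Function.update_self]
      congr 1
      refine Finset.prod_congr rfl fun i hi => ?_
      rw [Function.update_of_ne (Finset.ne_of_mem_erase hi)]
    have hXG : X 0 * G = mon t := by
      rw [hG0, mon, ← Finset.mul_prod_erase Finset.univ _ (Finset.mem_univ 0), hp]; ring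
    have hLG : L G = 0 := by
      apply IH1
      have e1 := Finset.add_sum_erase Finset.univ t (Finset.mem_univ 0)
      have e2 := Finset.add_sum_erase Finset.univ (Function.update t 0 p) (Finset.mem_univ 0)
      rw [Function.update_self] at e2
      have : ∑ i ∈ Finset.univ.erase 0, Function.update t 0 p i = ∑ i ∈ Finset.univ.erase 0, t i := by
        refine Finset.sum_congr rfl fun i hi => ?_
        rw [Function.update_of_ne (Finset.ne_of_mem_erase hi)]
      omega
    have hder : X 0 * pderiv 0 G = (p : ℝ) • G := by
      rw [hG0, Derivation.leibniz, Derivation.leibniz_pow, pderiv_X_self]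
      have : pderiv (R := ℝ) (0 : Fin (n+1)) (∏ i ∈ Finset.univ.erase 0, X i ^ t i) = 0 := by
        refine Finset.prod_induction _ (fun f => pderiv (R := ℝ) (0 : Fin (n+1)) f = 0) ?_ (by simp) ?_
        · intro f g hf hg; rw [Derivation.leibniz, hf, hg]; simp
        intro i hi
        rw [Derivation.leibniz_pow, pderiv_X_of_ne (Finset.ne_of_mem_erase hi)]
        simp
      rw [this]
      rcases p with _ | p
      · simp
      · simp only [smul_zero, Nat.add_sub_cancel, smul_eq_mul, mul_one, zero_add, smul_eq_C_mul, nsmul_eq_mul]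
        rw [show C ((p + 1 : ℕ) : ℝ) = ((p + 1 : ℕ) : MvPolynomial (Fin (n+1)) ℝ) from map_natCast _ _]
        ring
    have Z : X 0 * (1 - X 0) * pderiv 0 G + θ • ∑ k : Fin n, X k.succ * (1 - X k.succ) * Q k
      + θ • ∑ k : Fin n, (1 - X 0 - X k.succ) * G + (C a - C c * X 0) * G
      = (p : ℝ) • G - (p : ℝ) • mon t + θ • ∑ k, X k.succ * Q k + (θ * n + a) • G - (θ * n + c) • mon t
        - θ • ∑ k : Fin n, (X k.succ * X k.succ * Q k + X k.succ * G) := by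
      have s1 : ∑ k : Fin n, X k.succ * (1 - X k.succ) * Q k = ∑ k : Fin n, X k.succ * Q k
        - ∑ k : Fin n, X k.succ * X k.succ * Q k := by
        rw [← Finset.sum_sub_distrib]; exact Finset.sum_congr rfl fun k _ => by ring
      have s2 : ∑ k : Fin n, (1 - X 0 - X k.succ) * G = (n : MvPolynomial (Fin (n+1)) ℝ) * (G - X 0 * G)
        - ∑ k : Fin n, X k.succ * G := by
        simp only [sub_mul, Finset.sum_sub_distrib]
        simp [mul_sub]
      rw [s1, s2, ← hXG, Finset.sum_add_distrib]
      simp only [smul_eq_C_mul, map_add, map_mul, map_natCast] at hder ⊢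
      linear_combination (1 - X 0) * hder
    rw [Z] at hloop
    rw [map_sub, map_sub, map_add, map_add, map_sub] at hloop
    simp only [map_smul, map_sum, hLG, hQ1, hQ2, smul_zero,
      Finset.sum_const_zero, add_zero, zero_sub] at hloop
    have hh : ((p : ℝ) + (θ * n + c) + θ * ∑ k, cc k) • L (mon t) = 0 := by
      rw [← Finset.sum_smul] at hloop
      simp only [Complex.real_smul] at hloop ⊢
      push_cast at hloop ⊢
      linear_combination -hloop
    refine (smul_eq_zero.1 hh).resolve_left (ne_of_gt ?_)
    have : 0 ≤ ∑ k, cc k := Finset.sum_nonneg fun k _ => hcc k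
    positivity
  apply LinearMap.ext
  intro G
  induction G using MvPolynomial.induction_on' with
  | monomial s r =>
    have : monomial s r = r • mon (fun i => s i) := by
      rw [mon, smul_eq_C_mul, monomial_eq, Finsupp.prod_fintype _ _ (by simp)]
    rw [this, map_smul, main _ _ _ rfl rfl]; simp
  | add p q hp hq => rw [map_add, hp, hq]; simp
end JMF

namespace JMF

/-- The set of generic points. -/
def Ug (n : ℕ) : Type :=
  {r : Fin (n+1) → ℂ // (∀ i, (r i).re < 0) ∧ ∀ i j, i ≠ j → ∀ z : ℤ, r i - r j ≠ z}

namespace Ug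
variable {n : ℕ}
lemma ne (r : Ug n) {i j : Fin (n+1)} (h : i ≠ j) : r.1 i - r.1 j ≠ 0 := by
  simpa using r.2.2 i j h 0

/-- permute coordinates -/
def perm (σ : Equiv.Perm (Fin (n+1))) (r : Ug n) : Ug n :=
  ⟨fun i => r.1 (σ i), fun i => r.2.1 _, fun i j h z => r.2.2 _ _ (by simpa using h) z⟩

/-- cyclic shift -/
def cyc (r : Ug n) : Ug n :=
  ⟨Fin.cons (r.1 (Fin.last n) - 1) (fun i : Fin n => r.1 i.castSucc), by
    intro i
    refine Fin.cases ?_ (fun i => ?_) i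
    · have := r.2.1 (Fin.last n)
      simp; linarith
    · simpa using r.2.1 i.castSucc, by
    intro i j
    refine Fin.cases ?_ (fun i => ?_) i <;> refine Fin.cases ?_ (fun j => ?_) j
    · simp
    · intro _ z h
      simp only [Fin.cons_zero, Fin.cons_succ] at h
      refine r.2.2 (Fin.last n) j.castSucc (Fin.castSucc_lt_last j).ne' (z+1) ?_
      push_cast; linear_combination h
    · intro _ z h
      simp only [Fin.cons_zero, Fin.cons_succ] at h
      refine r.2.2 i.castSucc (Fin.last n) (Fin.castSucc_lt_last i).ne (z-1) ?_
      push_cast; linear_combination h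
    · intro h z
      simp only [Fin.cons_succ]
      exact r.2.2 _ _ (by simpa using h) z⟩

@[simp] lemma perm_val (σ : Equiv.Perm (Fin (n+1))) (r : Ug n) (i) : (perm σ r).1 i = r.1 (σ i) := rfl
@[simp] lemma cyc_zero (r : Ug n) : (cyc r).1 0 = r.1 (Fin.last n) - 1 := rfl
@[simp] lemma cyc_succ (r : Ug n) (i : Fin n) : (cyc r).1 i.succ = r.1 i.castSucc := rfl

lemma perm_perm (σ τ : Equiv.Perm (Fin (n+1))) (r : Ug n) : perm σ (perm τ r) = perm (τ * σ) r := rfl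
lemma perm_one (r : Ug n) : perm 1 r = r := rfl
end Ug
open Ug

/-- Space of functions. -/
abbrev VV (n : ℕ) := Ug n → ℂ

/-- Demazure-Lusztig type operator -/
noncomputable def Top {n : ℕ} (θ : ℝ) (a b : Fin (n+1)) : Module.End ℝ (VV n) where
  toFun ψ r := ψ (perm (Equiv.swap a b) r)
    + θ / (r.1 a - r.1 b) * (ψ r - ψ (perm (Equiv.swap a b) r))
  map_add' ψ χ := by funext r; simp only [Pi.add_apply]; ring
  map_smul' c ψ := by
    funext r; simp only [Pi.smul_apply, RingHom.id_apply, Complex.real_smul]; ring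

/-- shift operator -/
noncomputable def pop {n : ℕ} (g : ℂ → ℂ) : Module.End ℝ (VV n) where
  toFun ψ r := g (r.1 (Fin.last n)) * ψ (cyc r)
  map_add' ψ χ := by funext r; simp only [Pi.add_apply]; ring
  map_smul' c ψ := by
    funext r; simp only [Pi.smul_apply, RingHom.id_apply, Complex.real_smul]; ring

/-- multiplication operator -/
noncomputable def mulop {n : ℕ} (a : Fin (n+1)) : Module.End ℝ (VV n) where
  toFun ψ r := r.1 a * ψ r
  map_add' ψ χ := by funext r; simp only [Pi.add_apply]; ring
  map_smul' c ψ := by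
    funext r; simp only [Pi.smul_apply, RingHom.id_apply, Complex.real_smul]; ring

lemma Top_apply {n : ℕ} (θ : ℝ) (a b : Fin (n+1)) (ψ : VV n) (r : Ug n) :
  Top θ a b ψ r = ψ (perm (Equiv.swap a b) r)
    + θ / (r.1 a - r.1 b) * (ψ r - ψ (perm (Equiv.swap a b) r)) := rfl
lemma pop_apply {n : ℕ} (g : ℂ → ℂ) (ψ : VV n) (r : Ug n) :
  pop g ψ r = g (r.1 (Fin.last n)) * ψ (cyc r) := rfl
lemma mulop_apply {n : ℕ} (a : Fin (n+1)) (ψ : VV n) (r : Ug n) :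
  mulop a ψ r = r.1 a * ψ r := rfl

section
variable {n : ℕ} (θ : ℝ)

lemma Top_sq {a b : Fin (n+1)} (h : a ≠ b) : Top θ a b * Top θ a b = 1 := by
  ext ψ r
  simp only [Module.End.mul_apply, Top_apply, perm_perm, perm_val, Equiv.swap_apply_left,
    Equiv.swap_apply_right, Equiv.swap_mul_self, perm_one, Module.End.one_apply]
  have h1 := r.ne h
  have h2 := r.ne h.symm
  field_simp
  ring

lemma Top_braid {a b c : Fin (n+1)} (h : a ≠ b) (h' : b ≠ c) (hac : a ≠ c) :
    Top θ a b * Top θ b c * Top θ a b = Top θ b c * Top θ a b * Top θ b c := by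
  ext ψ r
  have e1 : Equiv.swap a b * Equiv.swap b c * Equiv.swap a b =
    Equiv.swap b c * Equiv.swap a b * Equiv.swap b c := by
    rw [Equiv.swap_mul_swap_mul_swap h hac, Equiv.swap_comm a b, Equiv.swap_comm b c,
      Equiv.swap_mul_swap_mul_swap h'.symm hac.symm, Equiv.swap_comm]
  have q1 : Equiv.swap b c * Equiv.swap b c * Equiv.swap a b = Equiv.swap a b := by simp
  simp only [Module.End.mul_apply, Top_apply, perm_perm, perm_val, Equiv.swap_apply_left,
    Equiv.swap_apply_right, Equiv.swap_mul_self, perm_one, Equiv.Perm.mul_apply,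
    Equiv.swap_apply_of_ne_of_ne h hac, Equiv.swap_apply_of_ne_of_ne hac.symm h'.symm,
    e1]
  have h1 := r.ne h
  have h2 := r.ne h'
  have h3 := r.ne hac
  have h1' := r.ne h.symm
  have h2' := r.ne h'.symm
  have h3' := r.ne hac.symm
  generalize ψ r = p0
  generalize ψ (perm (Equiv.swap a b) r) = p1
  generalize ψ (perm (Equiv.swap b c) r) = p2
  generalize ψ (perm (Equiv.swap b c * Equiv.swap a b * Equiv.swap b c) r) = p3
  generalize ψ (perm (Equiv.swap b c * Equiv.swap a b) r) = p4
  generalize ψ (perm (Equiv.swap a b * Equiv.swap b c) r) = p5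
  generalize r.1 a = x at *
  generalize r.1 b = y at *
  generalize r.1 c = z at *
  have k1 : y - x = -(x - y) := by ring
  have k2 : z - y = -(y - z) := by ring
  have k3 : z - x = -(x - z) := by ring
  rw [k1, k2]
  field_simp
  ring

lemma Top_far {a b c d : Fin (n+1)} (hac : a ≠ c) (had : a ≠ d) (hbc : b ≠ c) (hbd : b ≠ d) :
    Top θ a b * Top θ c d = Top θ c d * Top θ a b := by
  ext ψ r
  have e1 : Equiv.swap a b * Equiv.swap c d = Equiv.swap c d * Equiv.swap a b := by
    ext x
    simp only [Equiv.Perm.mul_apply, Equiv.swap_apply_def]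
    split_ifs <;> simp_all
  simp only [Module.End.mul_apply, Top_apply, perm_perm, perm_val, 
    Equiv.swap_apply_of_ne_of_ne hac had, Equiv.swap_apply_of_ne_of_ne hbc hbd,
    Equiv.swap_apply_of_ne_of_ne hac.symm hbc.symm, Equiv.swap_apply_of_ne_of_ne had.symm hbd.symm,
    e1]
  ring

/-- ℕ-indexed operators -/
noncomputable def Tn (n : ℕ) (θ : ℝ) (i : ℕ) : Module.End ℝ (VV n) :=
  if h : i < n then Top θ ⟨i, by omega⟩ ⟨i+1, by omega⟩ else 1

/-- ℕ-indexed operators -/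
noncomputable def yn (n : ℕ) (i : ℕ) : Module.End ℝ (VV n) :=
  if h : i < n + 1 then mulop ⟨i, h⟩ else 1

lemma Tn_of_lt {i : ℕ} (h : i < n) : Tn n θ i = Top θ ⟨i, by omega⟩ ⟨i+1, by omega⟩ := dif_pos h
lemma yn_of_lt {i : ℕ} (h : i < n + 1) : yn n i = mulop ⟨i, h⟩ := dif_pos h

lemma yT_aux {a b : Fin (n+1)} (h : a ≠ b) : mulop a * Top θ a b = Top θ a b * mulop b + θ • (1 : Module.End ℝ (VV n)) := by
  ext ψ r
  simp only [Module.End.mul_apply, LinearMap.add_apply, LinearMap.smul_apply, Module.End.one_apply, Pi.add_apply,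
    Pi.smul_apply, Top_apply, mulop_apply, perm_val, Equiv.swap_apply_right, Complex.real_smul]
  have h1 := r.ne h
  field_simp
  ring

lemma yT_aux' {a b : Fin (n+1)} (h : a ≠ b) : mulop b * Top θ a b = Top θ a b * mulop a - θ • (1 : Module.End ℝ (VV n)) := by
  ext ψ r
  simp only [Module.End.mul_apply, LinearMap.sub_apply, LinearMap.smul_apply, Module.End.one_apply, Pi.sub_apply,
    Pi.smul_apply, Top_apply, mulop_apply, perm_val, Equiv.swap_apply_left, Complex.real_smul]
  have h1 := r.ne h
  field_simp
  ring

lemma yT_far {a b c : Fin (n+1)} (h : c ≠ a) (h' : c ≠ b) : mulop c * Top θ a b = Top θ a b * mulop c := by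
  ext ψ r
  simp only [Module.End.mul_apply, Top_apply, mulop_apply, perm_val, Equiv.swap_apply_of_ne_of_ne h h']
  ring

lemma cyc_perm (a b : Fin n) (r : Ug n) :
    cyc (perm (Equiv.swap a.castSucc b.castSucc) r) = perm (Equiv.swap a.succ b.succ) (cyc r) := by
  apply Subtype.ext
  funext j
  refine Fin.cases ?_ (fun j => ?_) j
  · rw [perm_val, cyc_zero, perm_val, 
      Equiv.swap_apply_of_ne_of_ne (Fin.castSucc_lt_last a).ne' (Fin.castSucc_lt_last b).ne',
      Equiv.swap_apply_of_ne_of_ne (Fin.succ_ne_zero a).symm (Fin.succ_ne_zero b).symm, cyc_zero]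
  · rw [perm_val, cyc_succ, perm_val, (Fin.castSucc_injective n).swap_apply,
      (Fin.succ_injective n).swap_apply, cyc_succ]

lemma pT_aux (g : ℂ → ℂ) (a b : Fin n) :
    pop g * Top θ a.succ b.succ = Top θ a.castSucc b.castSucc * pop g := by
  ext ψ r
  simp only [Module.End.mul_apply, Top_apply, pop_apply, cyc_perm, cyc_succ, perm_val,
    Equiv.swap_apply_of_ne_of_ne (Fin.castSucc_lt_last a).ne' (Fin.castSucc_lt_last b).ne']
  ring

lemma ppT_aux {m : ℕ} (g : ℂ → ℂ) :
    pop g * pop g * Top θ (0 : Fin (m+1+1)) (Fin.succ 0) =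
      Top θ (Fin.last m).castSucc (Fin.last (m+1)) * pop g * pop g := by
  ext ψ r
  have e : cyc (cyc (perm (Equiv.swap (Fin.last m).castSucc (Fin.last (m+1))) r))
    = perm (Equiv.swap 0 (Fin.succ 0)) (cyc (cyc r)) := by
    apply Subtype.ext
    funext j
    refine Fin.cases ?_ (fun j => ?_) j
    · rw [perm_val, Equiv.swap_apply_left, cyc_zero, cyc_succ, Fin.castSucc_zero, cyc_zero,
        ← Fin.succ_last, cyc_succ, Fin.succ_last, perm_val, Equiv.swap_apply_left]
    · refine Fin.cases ?_ (fun j => ?_) j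
      · rw [perm_val, Equiv.swap_apply_right, cyc_zero, cyc_succ, Fin.castSucc_zero, cyc_zero,
          ← Fin.succ_last, cyc_succ, Fin.succ_last, perm_val, Equiv.swap_apply_right]
      · rw [perm_val, Equiv.swap_apply_of_ne_of_ne (Fin.succ_ne_zero _)
          (fun h => Fin.succ_ne_zero _ (Fin.succ_injective _ h)),
          cyc_succ, cyc_succ, ← Fin.succ_castSucc, cyc_succ, cyc_succ, perm_val]
        rw [Equiv.swap_apply_of_ne_of_ne]
        · intro h
          have := congrArg Fin.val h
          simp at this
          omega
        · intro h
          have := congrArg Fin.val h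
          simp at this
          omega
  have hl : ∀ r : Ug (m+1), (cyc r).1 (Fin.last (m+1)) = r.1 (Fin.last m).castSucc := by
    intro r; rw [← Fin.succ_last, cyc_succ]
  have h0 : (cyc (cyc r)).1 0 = r.1 (Fin.last m).castSucc - 1 := by rw [cyc_zero, hl]
  have h1 : (cyc (cyc r)).1 (Fin.succ 0) = r.1 (Fin.last (m+1)) - 1 := by
    rw [cyc_succ, Fin.castSucc_zero, cyc_zero]
  simp only [Module.End.mul_apply, Top_apply, pop_apply, e, hl, h0, h1, perm_val, Equiv.swap_apply_left,
    Equiv.swap_apply_right]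
  ring

lemma model (g : ℂ → ℂ) : DH n θ (Tn n θ) (pop g) (yn n) where
  Tsq i hi := by rw [Tn_of_lt θ hi, Top_sq]; simp
  braid i hi := by
    rw [Tn_of_lt θ hi, Tn_of_lt θ (show i < n by omega), Top_braid] <;> simp <;> omega
  far i j hij hj := by
    rw [Tn_of_lt θ hj, Tn_of_lt θ (show i < n by omega), Top_far] <;> simp <;> omega
  pT i hi := by
    rw [Tn_of_lt θ hi, Tn_of_lt θ (show i < n by omega)]
    exact pT_aux θ g ⟨i, by omega⟩ ⟨i+1, hi⟩
  ppT i hi := by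
    subst hi
    rw [Tn_of_lt θ (show i < i + 1 by omega), Tn_of_lt θ (show 0 < i + 1 by omega)]
    exact ppT_aux θ g
  yT i hi := by
    rw [Tn_of_lt θ hi, yn_of_lt (show i < n+1 by omega), yn_of_lt (show i+1 < n+1 by omega)]
    exact yT_aux θ (by simp)
  yT' i hi := by
    rw [Tn_of_lt θ hi, yn_of_lt (show i < n+1 by omega), yn_of_lt (show i+1 < n+1 by omega)]
    exact yT_aux' θ (by simp)
  y0T i hi := by
    rw [Tn_of_lt θ hi, yn_of_lt (show 0 < n+1 by omega)]
    exact yT_far θ (by simp) (by simp)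
  yn := by
    rw [yn_of_lt (show n < n+1 by omega), yn_of_lt (show 0 < n+1 by omega)]
    ext ψ r
    simp only [Module.End.mul_apply, LinearMap.add_apply, Pi.add_apply, mulop_apply, pop_apply]
    have : (cyc r).1 ⟨0, by omega⟩ = r.1 (Fin.last n) - 1 := cyc_zero r
    rw [this]
    change r.1 (Fin.last n) * _ = _
    ring
  y0p hn := by
    rw [yn_of_lt (show 0 < n+1 by omega), yn_of_lt (show 1 < n+1 by omega)]
    ext ψ r
    simp only [Module.End.mul_apply, mulop_apply, pop_apply]
    have : (cyc r).1 ⟨1, by omega⟩ = r.1 ⟨0, by omega⟩ := cyc_succ r ⟨0, hn⟩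
    rw [this]
    ring
end
end JMF

namespace JMF
open Ug MvPolynomial

/-- base point -/
noncomputable def r0 (n : ℕ) (θ : ℝ) (hθ : 0 < θ) (hi : Irrational θ) : Ug n :=
  ⟨fun j => -(θ : ℂ) * ((j : ℕ) + 1), by
    intro i
    have : (-(θ : ℂ) * ((i : ℕ) + 1)) = ((-(θ * ((i : ℕ) + 1)) : ℝ) : ℂ) := by push_cast; ring
    beta_reduce
    rw [this, Complex.ofReal_re]
    have : 0 < θ * ((i : ℕ) + 1) := by positivity
    linarith, by
    intro i j hij z h
    have h2 : (θ * ((((j : ℕ) : ℤ) - ((i : ℕ) : ℤ) : ℤ) : ℝ)) = (z : ℝ) := by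
      have : ((θ * ((((j : ℕ) : ℤ) - ((i : ℕ) : ℤ) : ℤ) : ℝ) : ℝ) : ℂ) = ((z : ℝ) : ℂ) := by
        push_cast; push_cast at h; rw [← h]; ring
      exact_mod_cast this
    have hne : (((j : ℕ) : ℤ) - ((i : ℕ) : ℤ) : ℤ) ≠ 0 := by
      intro h0; apply hij; ext; omega
    have := hi.mul_intCast hne
    rw [h2] at this
    exact Int.not_irrational z this⟩

lemma r0_val (n : ℕ) (θ : ℝ) (hθ : 0 < θ) (hi : Irrational θ) (j : Fin (n+1)) :
    (r0 n θ hθ hi).1 j = -(θ : ℂ) * ((j : ℕ) + 1) := rfl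

/-- evaluation -/
noncomputable def evr {n : ℕ} (r : Ug n) : VV n →ₗ[ℝ] ℂ where
  toFun ψ := ψ r
  map_add' _ _ := rfl
  map_smul' _ _ := rfl

lemma Tn_r0 (n : ℕ) (θ : ℝ) (hθ : 0 < θ) (hi : Irrational θ) (i : ℕ) (h : i < n) (ψ : VV n) :
    Tn n θ i ψ (r0 n θ hθ hi) = ψ (r0 n θ hθ hi) := by
  rw [Tn_of_lt θ h, Top_apply, r0_val, r0_val]
  have h0 : (θ : ℂ) ≠ 0 := by exact_mod_cast hθ.ne'
  have : (θ : ℂ) / (-(θ : ℂ) * ((i : ℕ) + 1) - -(θ : ℂ) * (((i + 1 : ℕ) : ℂ) + 1)) = 1 := by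
    push_cast
    rw [show (-(θ : ℂ) * (i + 1) - -θ * (i + 1 + 1)) = θ by ring]
    exact div_self h0
  rw [this]; ring

lemma Tn_one (n : ℕ) (θ : ℝ) (i : ℕ) (h : i < n) : Tn n θ i (fun _ => 1) = fun _ => 1 := by
  rw [Tn_of_lt θ h]; ext r; rw [Top_apply]; ring

theorem algebraic_functional (n : ℕ) (θ : ℝ) (hθ : 0 < θ) (hi : Irrational θ) (A B : ℝ) (hB : 0 ≤ B)
    (g : ℂ → ℂ) (hg : ∀ u, g u = (u - A) / (u - B)) :
    ∃ (φ : MvPolynomial (Fin (n+1)) ℝ →ₐ[ℝ] Module.End ℝ (VV n)) (L : MvPolynomial (Fin (n+1)) ℝ →ₗ[ℝ] ℂ),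
      (∀ i : Fin (n+1), φ (X i) = Xo n (Tn n θ) (pop g) i) ∧
      (∀ G, L G = φ G (fun _ => 1) (r0 n θ hθ hi)) ∧ L 1 = 1 ∧
      Loop n θ (A + θ) (B + θ - θ * n) L ∧ SymL n L := by
  have h := model (n := n) θ g
  obtain ⟨φ, hφ⟩ := exists_ev (fun i : Fin (n+1) => Xo n (Tn n θ) (pop g) i)
    (fun i j => h.L5 i j (by omega) (by omega))
  let L : MvPolynomial (Fin (n+1)) ℝ →ₗ[ℝ] ℂ :=
    (evr (r0 n θ hθ hi)).comp ((LinearMap.applyₗ (fun _ => 1 : VV n)).comp φ.toLinearMap)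
  have hL : ∀ G, L G = φ G (fun _ => 1) (r0 n θ hθ hi) := fun G => rfl
  refine ⟨φ, L, hφ, hL, by rw [hL, map_one]; rfl, ?_⟩
  refine h.loop φ hφ (fun _ => 1) (fun i hi => Tn_one n θ i hi) (evr (r0 n θ hθ hi))
    (fun i hi' w => Tn_r0 n θ hθ hi i hi' w) ?_ A B ?_ L (fun G => rfl)
  · intro w
    rw [yn_of_lt (by omega)]
    change (r0 n θ hθ hi).1 0 * w (r0 n θ hθ hi) = -(θ • w (r0 n θ hθ hi))
    rw [r0_val]; simp
  · ext r
    rw [yn_of_lt (by omega)]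
    simp only [Pi.sub_apply, Pi.smul_apply, mulop_apply, pop_apply, Complex.real_smul, mul_one, hg]
    have : r.1 (Fin.last n) - B ≠ 0 := by
      intro h0
      have h1 := congrArg Complex.re h0
      have h2 := r.2.1 (Fin.last n)
      simp at h1
      linarith
    change r.1 (Fin.last n) * _ - _ = r.1 (Fin.last n) - _
    field_simp
end JMF

namespace JMF
open MeasureTheory MvPolynomial Set Filter Topology

/-- one-dimensional weight -/
noncomputable def w1 (a b t : ℝ) : ℝ := t ^ a * (1 - t) ^ b
/-- Lebesgue measure on the unit interval -/
noncomputable def mu1 : Measure ℝ := volume.restrict (Ioo (0:ℝ) 1)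
noncomputable def muN (n : ℕ) : Measure (Fin n → ℝ) := Measure.pi (fun _ => mu1)
noncomputable def wN (n : ℕ) (a b : ℝ) (x : Fin n → ℝ) : ℝ := ∏ i, w1 a b (x i)

instance : IsFiniteMeasure mu1 := by unfold mu1; infer_instance

lemma w1_int (a b : ℝ) (ha : -1 < a) (hb : -1 < b) : Integrable (w1 a b) mu1 := by
  have h := Complex.betaIntegral_convergent (u := ((a + 1 : ℝ) : ℂ)) (v := ((b + 1 : ℝ) : ℂ))
    (by simp; linarith) (by simp; linarith)
  rw [intervalIntegrable_iff_integrableOn_Ioo_of_le zero_le_one] at h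
  have h2 := h.norm
  refine (integrable_congr ?_).mp h2
  filter_upwards [ae_restrict_mem measurableSet_Ioo] with t ht
  have e1 : ((a + 1 : ℝ) : ℂ) - 1 = ((a : ℝ) : ℂ) := by push_cast; ring
  have e2 : ((b + 1 : ℝ) : ℂ) - 1 = ((b : ℝ) : ℂ) := by push_cast; ring
  have e3 : (1 - (t : ℂ)) = ((1 - t : ℝ) : ℂ) := by push_cast; ring
  rw [e1, e2, e3, norm_mul, Complex.norm_cpow_eq_rpow_re_of_pos ht.1,
    Complex.norm_cpow_eq_rpow_re_of_pos (by linarith [ht.2])]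
  simp [w1]

lemma wN_int (n : ℕ) (a b : ℝ) (ha : -1 < a) (hb : -1 < b) : Integrable (wN n a b) (muN n) :=
  Integrable.fintype_prod (fun _ => w1_int a b ha hb)

lemma muN_mem (n : ℕ) : ∀ᵐ x ∂(muN n), ∀ i, x i ∈ Ioo (0:ℝ) 1 := by
  rw [ae_all_iff]
  intro i
  have : ∀ᵐ t ∂mu1, t ∈ Ioo (0:ℝ) 1 := ae_restrict_mem measurableSet_Ioo
  exact (Measure.tendsto_eval_ae_ae (μ := fun _ : Fin n => mu1) (i := i)).eventually this

lemma int_bdd (n : ℕ) (a b : ℝ) (ha : -1 < a) (hb : -1 < b) (f : (Fin n → ℝ) → ℝ)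
    (hf : Continuous f) : Integrable (fun x => f x * wN n a b x) (muN n) := by
  have hK : IsCompact (univ.pi fun _ : Fin n => Icc (0:ℝ) 1) := isCompact_univ_pi fun _ => isCompact_Icc
  obtain ⟨C, hC⟩ := hK.exists_bound_of_continuousOn hf.continuousOn
  refine (wN_int n a b ha hb).bdd_mul hf.aestronglyMeasurable (c := C) ?_
  filter_upwards [muN_mem n] with x hx
  exact hC x (fun i _ => Ioo_subset_Icc_self (hx i))

lemma one_dim (a b : ℝ) (ha : -1 < a) (hb : -1 < b) (p p' : ℝ → ℝ) (hp : ∀ t, HasDerivAt p (p' t) t)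
    (hp' : Continuous p') :
    ∫ t, (((a+1)*(1-t) - (b+1)*t) * p t + t*(1-t)*p' t) * w1 a b t ∂mu1 = 0 := by
  have hpc : Continuous p := continuous_iff_continuousAt.2 fun t => (hp t).continuousAt
  have hintg : IntegrableOn (fun t => (((a+1)*(1-t) - (b+1)*t) * p t + t*(1-t)*p' t) * w1 a b t) (Ioo 0 1) := by
    have hcont : Continuous (fun t => (((a+1)*(1-t) - (b+1)*t) * p t + t*(1-t)*p' t)) := by fun_prop
    obtain ⟨C, hC⟩ := isCompact_Icc (a := (0:ℝ)) (b := 1) |>.exists_bound_of_continuousOn hcont.continuousOn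
    refine (w1_int a b ha hb).bdd_mul hcont.aestronglyMeasurable (c := C) ?_
    filter_upwards [ae_restrict_mem measurableSet_Ioo] with x hx
    exact hC x (Ioo_subset_Icc_self hx)
  have h := intervalIntegral.integral_eq_sub_of_hasDerivAt_of_le (a := (0:ℝ)) (b := 1)
    (f := fun t => t^(a+1) * (1-t)^(b+1) * p t) (f' := fun t => (((a+1)*(1-t) - (b+1)*t) * p t + t*(1-t)*p' t) * w1 a b t)
    zero_le_one ?_ ?_ ?_
  · rw [intervalIntegral.integral_of_le zero_le_one, integral_Ioc_eq_integral_Ioo] at h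
    unfold mu1
    rw [h]
    simp [Real.zero_rpow (show a + 1 ≠ 0 by linarith), Real.zero_rpow (show b + 1 ≠ 0 by linarith)]
  · have h1 : Continuous fun t : ℝ => t ^ (a+1) := Real.continuous_rpow_const (by linarith)
    have h2 : Continuous fun t : ℝ => (1-t) ^ (b+1) := (Real.continuous_rpow_const (by linarith)).comp (by fun_prop)
    exact ((h1.mul h2).mul hpc).continuousOn
  · intro t ht
    have h1 : HasDerivAt (fun t : ℝ => t^(a+1)) ((a+1) * t^a) t := by
      simpa using Real.hasDerivAt_rpow_const (x := t) (p := a+1) (Or.inl ht.1.ne')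
    have h2 : HasDerivAt (fun t : ℝ => (1-t)^(b+1)) (-((b+1) * (1-t)^b)) t := by
      have := (Real.hasDerivAt_rpow_const (x := 1-t) (p := b+1) (Or.inl (by linarith [ht.2]))).comp t
        ((hasDerivAt_id t).const_sub 1)
      simpa [Function.comp_def] using this
    convert! (h1.mul h2).mul (hp t) using 1
    have e1 : t^(a+1) = t^a * t := by rw [Real.rpow_add_one ht.1.ne']
    have e2 : (1-t)^(b+1) = (1-t)^b * (1-t) := by rw [Real.rpow_add_one (by linarith [ht.2])]
    simp only [Pi.mul_apply, w1, e1, e2]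
    ring
  · rwa [intervalIntegrable_iff_integrableOn_Ioo_of_le zero_le_one]

lemma muN_succ_integral (n : ℕ) (f : (Fin (n+1) → ℝ) → ℝ) (hf : Integrable f (muN (n+1))) :
    ∫ x, f x ∂(muN (n+1)) = ∫ z, ∫ t, f (Fin.cons t z) ∂mu1 ∂(muN n) := by
  have h := measurePreserving_piFinSuccAbove (fun _ : Fin (n+1) => mu1) 0
  have h2 := h.symm
  unfold muN at *
  rw [← h2.integral_comp' f]
  have hf' := (h2.integrable_comp_emb (MeasurableEquiv.measurableEmbedding _)).2 hf
  refine (integral_prod_symm _ hf').trans ?_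
  have e : ∀ t (z : Fin n → ℝ), (MeasurableEquiv.piFinSuccAbove (fun _ : Fin (n+1) => ℝ) 0).symm (t, z)
      = Fin.cons t z := by
    intro t z
    funext i
    refine Fin.cases ?_ (fun j => ?_) i <;> simp [MeasurableEquiv.piFinSuccAbove]
  simp only [Function.comp_apply, e]

lemma n_dim (n : ℕ) (a b : ℝ) (ha : -1 < a) (hb : -1 < b) (Φ Φ' : (Fin (n+1) → ℝ) → ℝ)
    (hΦ : Continuous Φ) (hΦ' : Continuous Φ')
    (hd : ∀ z t, HasDerivAt (fun t => Φ (Fin.cons t z)) (Φ' (Fin.cons t z)) t) :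
    ∫ x, (((a+1)*(1-x 0) - (b+1)*x 0) * Φ x + x 0*(1-x 0)*Φ' x) * wN (n+1) a b x ∂(muN (n+1)) = 0 := by
  rw [muN_succ_integral n _ (int_bdd _ a b ha hb _ (by fun_prop))]
  rw [integral_eq_zero_of_ae]
  refine Eventually.of_forall fun z => ?_
  have hc : Continuous fun t : ℝ => (Fin.cons t z : Fin (n+1) → ℝ) := by
    refine continuous_pi fun i => ?_
    refine Fin.cases ?_ (fun j => ?_) i <;> simp <;> fun_prop
  have := one_dim a b ha hb _ _ (hd z) (hΦ'.comp hc)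
  simp only [Fin.cons_zero, wN, Fin.prod_univ_succ, Fin.cons_succ, Pi.zero_apply]
  simp_rw [← mul_assoc]
  rw [integral_mul_const, this, zero_mul]

end JMF

namespace JMF
open MeasureTheory MvPolynomial Set Filter Topology

/-- regularized Vandermonde weight -/
noncomputable def VE (θ ε : ℝ) {n : ℕ} (x : Fin n → ℝ) : ℝ :=
  ∏ i, ∏ j, if i < j then ((x i - x j)^2 + ε)^θ else 1

lemma VE_succ (θ ε : ℝ) {n : ℕ} (x : Fin (n+1) → ℝ) :
    VE θ ε x = (∏ k : Fin n, ((x 0 - x k.succ)^2 + ε)^θ) * VE θ ε (fun k => x k.succ) := by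
  simp [VE, Fin.prod_univ_succ]

lemma VE_nonneg (θ ε : ℝ) (hε : 0 ≤ ε) {n : ℕ} (x : Fin n → ℝ) : 0 ≤ VE θ ε x := by
  refine Finset.prod_nonneg fun i _ => Finset.prod_nonneg fun j _ => ?_
  split_ifs
  · positivity
  · norm_num

lemma VE_sq (θ ε : ℝ) {n : ℕ} (x : Fin n → ℝ) :
    VE θ ε x ^ 2 = ∏ i, ∏ j, if i = j then 1 else ((x i - x j)^2 + ε)^θ := by
  have h2 : VE θ ε x = ∏ i, ∏ j, if j < i then ((x i - x j)^2 + ε)^θ else 1 := by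
    unfold VE
    rw [Finset.prod_comm]
    refine Finset.prod_congr rfl fun i _ => Finset.prod_congr rfl fun j _ => ?_
    rw [show (x j - x i)^2 = (x i - x j)^2 by ring]
  rw [sq]
  nth_rw 1 [h2]
  unfold VE
  rw [← Finset.prod_mul_distrib]
  refine Finset.prod_congr rfl fun i _ => ?_
  rw [← Finset.prod_mul_distrib]
  refine Finset.prod_congr rfl fun j _ => ?_
  rcases lt_trichotomy i j with h | h | h
  · simp [h, h.ne, h.not_gt]
  · simp [h]
  · simp [h, h.ne', h.not_gt]

lemma VE_perm (θ ε : ℝ) (hε : 0 ≤ ε) {n : ℕ} (x : Fin n → ℝ) (σ : Equiv.Perm (Fin n)) :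
    VE θ ε (x ∘ σ) = VE θ ε x := by
  refine (sq_eq_sq₀ (VE_nonneg _ _ hε _) (VE_nonneg _ _ hε _)).1 ?_
  rw [VE_sq, VE_sq]
  rw [← Equiv.prod_comp σ (fun i => ∏ j, if i = j then 1 else ((x i - x j)^2 + ε)^θ)]
  refine Finset.prod_congr rfl fun i _ => ?_
  rw [← Equiv.prod_comp σ (fun j => if σ i = j then 1 else ((x (σ i) - x j)^2 + ε)^θ)]
  refine Finset.prod_congr rfl fun j _ => ?_
  simp

lemma VE_cont (θ ε : ℝ) (hθ : 0 < θ) {n : ℕ} : Continuous (VE θ ε (n := n)) := by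
  unfold VE
  refine continuous_finsetProd _ fun i _ => continuous_finsetProd _ fun j _ => ?_
  split_ifs
  · exact (Real.continuous_rpow_const hθ.le).comp (by fun_prop)
  · exact continuous_const

lemma VE_lim (θ : ℝ) (hθ : 0 < θ) {n : ℕ} (x : Fin n → ℝ) :
    Tendsto (fun ε => VE θ ε x) (𝓝 0) (𝓝 (VE θ 0 x)) := by
  have : Continuous (fun ε => VE θ ε x) := by
    unfold VE
    refine continuous_finsetProd _ fun i _ => continuous_finsetProd _ fun j _ => ?_
    split_ifs
    · exact (Real.continuous_rpow_const hθ.le).comp (by fun_prop)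
    · exact continuous_const
  exact this.tendsto 0

lemma VE_le (θ ε : ℝ) (hθ : 0 < θ) (hε : 0 ≤ ε) (hε1 : ε ≤ 1) {n : ℕ} (x : Fin n → ℝ)
    (hx : ∀ i, x i ∈ Ioo (0:ℝ) 1) : VE θ ε x ≤ ∏ _i : Fin n, ∏ _j : Fin n, (2:ℝ)^θ := by
  refine Finset.prod_le_prod (fun i _ => Finset.prod_nonneg fun j _ => ?_) fun i _ =>
    Finset.prod_le_prod (fun j _ => ?_) fun j _ => ?_
  · split_ifs <;> positivity
  · split_ifs <;> positivity
  · split_ifs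
    · refine Real.rpow_le_rpow (by positivity) ?_ hθ.le
      have := hx i; have := hx j
      simp only [mem_Ioo] at *
      nlinarith
    · exact Real.one_le_rpow (by norm_num) hθ.le

lemma VE_zero (θ : ℝ) (hθ : 0 < θ) {n : ℕ} (x : Fin (n+1) → ℝ) (k : Fin n) (h : x 0 = x k.succ) :
    VE θ 0 x = 0 := by
  rw [VE_succ, Finset.prod_eq_zero (Finset.mem_univ k), zero_mul]
  simp [h, Real.zero_rpow hθ.ne']

lemma VE_deriv (θ ε : ℝ) (hε : 0 < ε) {n : ℕ} (z : Fin n → ℝ) (t : ℝ) :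
    HasDerivAt (fun t => VE θ ε (Fin.cons t z : Fin (n+1) → ℝ))
      (VE θ ε (Fin.cons t z : Fin (n+1) → ℝ) * ∑ k : Fin n, 2 * θ * (t - z k) / ((t - z k)^2 + ε)) t := by
  have e : ∀ t : ℝ, VE θ ε (Fin.cons t z : Fin (n+1) → ℝ)
      = Real.exp (∑ k, Real.log ((t - z k)^2 + ε) * θ) * VE θ ε z := by
    intro t
    rw [VE_succ, Real.exp_sum]
    simp only [Fin.cons_zero, Fin.cons_succ]
    congr 1
    refine Finset.prod_congr rfl fun k _ => ?_
    rw [Real.rpow_def_of_pos (by positivity)]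
  simp_rw [e]
  have h1 : HasDerivAt (fun t => ∑ k, Real.log ((t - z k)^2 + ε) * θ)
      (∑ k : Fin n, 2 * θ * (t - z k) / ((t - z k)^2 + ε)) t := by
    apply HasDerivAt.fun_sum
    intro k _
    have h2 : HasDerivAt (fun t => (t - z k)^2 + ε) (2 * (t - z k)) t := by
      simpa using (((hasDerivAt_id t).sub_const (z k)).pow 2).add_const ε
    convert! (h2.log (by positivity)).mul_const θ using 1
    ring
  convert! (h1.exp).mul_const (VE θ ε z) using 1
  ring

lemma wN_perm (n : ℕ) (a b : ℝ) (x : Fin n → ℝ) (σ : Equiv.Perm (Fin n)) :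
    wN n a b (x ∘ σ) = wN n a b x := by
  unfold wN
  exact Equiv.prod_comp σ (fun i => w1 a b (x i))

lemma muN_perm (n : ℕ) (σ : Equiv.Perm (Fin n)) (f : (Fin n → ℝ) → ℝ) :
    ∫ x, f (x ∘ σ) ∂(muN n) = ∫ x, f x ∂(muN n) := by
  have h := measurePreserving_piCongrLeft (fun _ : Fin n => mu1) σ.symm
  have := h.integral_comp' f
  unfold muN
  rw [← this]
  congr 1
  funext x
  congr 1
  funext i
  have := Equiv.piCongrLeft_apply_apply (fun _ : Fin n => ℝ) σ.symm x (σ i)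
  simp only [Equiv.symm_apply_apply] at this
  rw [MeasurableEquiv.coe_piCongrLeft, this]
  rfl

lemma eval_deriv (n : ℕ) (G : MvPolynomial (Fin (n+1)) ℝ) (z : Fin n → ℝ) (t : ℝ) :
    HasDerivAt (fun t => eval (Fin.cons t z : Fin (n+1) → ℝ) G) (eval (Fin.cons t z : Fin (n+1) → ℝ) (pderiv 0 G)) t := by
  induction G using MvPolynomial.induction_on with
  | C r => simpa using hasDerivAt_const t r
  | add p q hp hq => simpa using hp.fun_add hq
  | mul_X p i hp =>
    have hi : HasDerivAt (fun t => (Fin.cons t z : Fin (n+1) → ℝ) i) (if i = 0 then 1 else 0) t := by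
      refine Fin.cases ?_ (fun j => ?_) i
      · simpa using hasDerivAt_id' t
      · simpa using hasDerivAt_const t (z j)
    simp only [map_mul, eval_X]
    convert! hp.mul hi using 1
    rw [Derivation.leibniz]
    simp [pderiv_X, Pi.single_apply]
    split_ifs with h0
    · subst h0; simp; ring
    · simp [h0]; ring

lemma eval_cont (n : ℕ) (G : MvPolynomial (Fin n) ℝ) : Continuous fun x : Fin n → ℝ => eval x G :=
  MvPolynomial.continuous_eval G

/-- regularized loop equation -/
lemma loop_eps (n : ℕ) (θ a b ε : ℝ) (hθ : 0 < θ) (ha : -1 < a) (hb : -1 < b) (hε : 0 < ε)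
    (G : MvPolynomial (Fin (n+1)) ℝ) (Q : Fin n → MvPolynomial (Fin (n+1)) ℝ)
    (hQ : ∀ k : Fin n, (X 0 - X k.succ) * Q k = G - rename (Equiv.swap 0 k.succ) G) :
    ∫ x, eval x (X 0 * (1 - X 0) * pderiv 0 G + (C (a+1) - C (a+1+(b+1)) * X 0) * G) * VE θ ε x * wN (n+1) a b x ∂(muN (n+1))
    + θ * ∑ k : Fin n, ∫ x, eval x (X k.succ * (1 - X k.succ) * Q k + (1 - X 0 - X k.succ) * G)
        * ((x 0 - x k.succ)^2 / ((x 0 - x k.succ)^2 + ε)) * VE θ ε x * wN (n+1) a b x ∂(muN (n+1)) = 0 := by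
  have hV := VE_cont θ ε hθ (n := n+1)
  have hne : ∀ (x : Fin (n+1) → ℝ) (k : Fin n), (x 0 - x k.succ)^2 + ε ≠ 0 := fun x k => by positivity
  have h := n_dim n a b ha hb (fun x => eval x G * VE θ ε x)
    (fun x => eval x (pderiv 0 G) * VE θ ε x + eval x G * (VE θ ε x * ∑ k : Fin n, 2 * θ * (x 0 - x k.succ) / ((x 0 - x k.succ)^2 + ε)))
    ((eval_cont _ G).mul hV) (by
      have := eval_cont _ G
      have := eval_cont _ (pderiv 0 G)
      have : Continuous fun x : Fin (n+1) → ℝ => ∑ k : Fin n, 2 * θ * (x 0 - x k.succ) / ((x 0 - x k.succ)^2 + ε) :=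
        continuous_finsetSum _ fun k _ => Continuous.div (by fun_prop) (by fun_prop) (fun x => hne x k)
      fun_prop) (by
      intro z t
      have := (eval_deriv n G z t).fun_mul (VE_deriv θ ε hε z t)
      simpa using this)
  set J : Fin n → (Fin (n+1) → ℝ) → ℝ := fun k x => x 0 * (1 - x 0) * eval x G * (2 * θ * (x 0 - x k.succ) / ((x 0 - x k.succ)^2 + ε)) * VE θ ε x * wN (n+1) a b x with hJ
  have hJi : ∀ k, Integrable (J k) (muN (n+1)) := by
    intro k
    refine int_bdd _ a b ha hb _ ?_
    have := eval_cont _ G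
    have : Continuous fun x : Fin (n+1) → ℝ => 2 * θ * (x 0 - x k.succ) / ((x 0 - x k.succ)^2 + ε) :=
      Continuous.div (by fun_prop) (by fun_prop) (fun x => hne x k)
    fun_prop
  have hmain : Integrable (fun x => eval x (X 0 * (1 - X 0) * pderiv 0 G + (C (a+1) - C (a+1+(b+1)) * X 0) * G) * VE θ ε x * wN (n+1) a b x) (muN (n+1)) :=
    int_bdd _ a b ha hb _ ((eval_cont _ _).mul hV)
  have hsplit : ∫ x, eval x (X 0 * (1 - X 0) * pderiv 0 G + (C (a+1) - C (a+1+(b+1)) * X 0) * G) * VE θ ε x * wN (n+1) a b x ∂(muN (n+1)) + ∑ k, ∫ x, J k x ∂(muN (n+1)) = 0 := by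
    rw [← integral_finsetSum _ (fun k _ => hJi k), ← integral_add hmain (integrable_finsetSum _ fun k _ => hJi k), ← h]
    congr 1
    funext x
    simp only [hJ, map_add, map_mul, map_sub, eval_X, eval_C, map_one]
    simp only [← Finset.sum_mul, ← Finset.mul_sum]
    ring
  rw [← hsplit]
  congr 1
  rw [Finset.mul_sum]
  refine Finset.sum_congr rfl fun k _ => ?_
  have hsw : ∫ x, J k (x ∘ Equiv.swap 0 k.succ) ∂(muN (n+1)) = ∫ x, J k x ∂(muN (n+1)) := muN_perm _ _ _
  have hJi' : Integrable (fun x => J k (x ∘ Equiv.swap 0 k.succ)) (muN (n+1)) := by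
    refine (int_bdd _ a b ha hb (fun x => x k.succ * (1 - x k.succ) * eval x (rename (Equiv.swap 0 k.succ) G) * (2 * θ * (x k.succ - x 0) / ((x k.succ - x 0)^2 + ε)) * VE θ ε x) ?_).congr ?_
    · have := eval_cont _ (rename (Equiv.swap 0 k.succ) G)
      have : Continuous fun x : Fin (n+1) → ℝ => 2 * θ * (x k.succ - x 0) / ((x k.succ - x 0)^2 + ε) :=
        Continuous.div (by fun_prop) (by fun_prop) (fun x => by positivity)
      fun_prop
    · refine Eventually.of_forall fun x => ?_
      simp only [hJ]
      rw [wN_perm, VE_perm _ _ hε.le, eval_rename]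
      simp
  have : ∫ x, J k x ∂(muN (n+1)) = ∫ x, (J k x + J k (x ∘ Equiv.swap 0 k.succ)) / 2 ∂(muN (n+1)) := by
    rw [integral_div, integral_add (hJi k) hJi', hsw]; ring
  rw [this, ← integral_const_mul]
  congr 1
  funext x
  simp only [hJ]
  rw [wN_perm, VE_perm _ _ hε.le]
  have hq : (x 0 - x k.succ) * eval x (Q k) = eval x G - eval (x ∘ Equiv.swap 0 k.succ) G := by
    have := congrArg (eval x) (hQ k)
    rw [map_mul, map_sub, map_sub, eval_rename] at this
    simpa using this
  have hE : eval (x ∘ Equiv.swap 0 k.succ) G = eval x G - (x 0 - x k.succ) * eval x (Q k) := by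
    rw [hq]; ring
  rw [hE]
  simp only [Function.comp, Equiv.swap_apply_left, Equiv.swap_apply_right, map_add, map_mul, map_sub, eval_X, map_one]
  have h1 := hne x k
  have h2 : (x k.succ - x 0)^2 + ε ≠ 0 := by positivity
  rw [show (x k.succ - x 0)^2 = (x 0 - x k.succ)^2 by ring]
  field_simp
  ring

end JMF

namespace JMF
open MeasureTheory MvPolynomial Set Filter Topology

/-- The E-side functional. -/
noncomputable def lE (n : ℕ) (θ a b : ℝ) (hθ : 0 < θ) (ha : -1 < a) (hb : -1 < b) :
    MvPolynomial (Fin (n+1)) ℝ →ₗ[ℝ] ℂ where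
  toFun G := ((∫ x, eval x G * VE θ 0 x * wN (n+1) a b x ∂(muN (n+1)) : ℝ) : ℂ)
  map_add' G H := by
    rw [← Complex.ofReal_add, ← integral_add
      (int_bdd (n+1) a b ha hb (fun x => eval x G * VE θ 0 x) ((eval_cont _ _).mul (VE_cont θ 0 hθ)))
      (int_bdd (n+1) a b ha hb (fun x => eval x H * VE θ 0 x) ((eval_cont _ _).mul (VE_cont θ 0 hθ)))]
    congr 2; funext x; simp; ring
  map_smul' r G := by
    simp only [smul_eval, mul_assoc, integral_const_mul]
    simp

lemma lE_apply (n : ℕ) (θ a b : ℝ) (hθ : 0 < θ) (ha : -1 < a) (hb : -1 < b) (G) :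
    lE n θ a b hθ ha hb G = ((∫ x, eval x G * VE θ 0 x * wN (n+1) a b x ∂(muN (n+1)) : ℝ) : ℂ) := rfl

lemma lE_sym (n : ℕ) (θ a b : ℝ) (hθ : 0 < θ) (ha : -1 < a) (hb : -1 < b) :
    SymL n (lE n θ a b hθ ha hb) := by
  intro σ G
  rw [lE_apply, lE_apply, ← muN_perm (n+1) σ (fun x => eval x G * VE θ 0 x * wN (n+1) a b x)]
  congr 2; funext x
  rw [VE_perm _ _ le_rfl, wN_perm, eval_rename]

lemma lE_dct (n : ℕ) (θ a b : ℝ) (hθ : 0 < θ) (ha : -1 < a) (hb : -1 < b)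
    (G : MvPolynomial (Fin (n+1)) ℝ) (s : ℝ → (Fin (n+1) → ℝ) → ℝ) (hs : ∀ ε, 0 < ε → Continuous (s ε))
    (hs1 : ∀ ε x, 0 < ε → |s ε x| ≤ 1)
    (hl : ∀ x, Tendsto (fun ε => s ε x * VE θ ε x) (𝓝[>] 0) (𝓝 (VE θ 0 x))) :
    Tendsto (fun ε => ∫ x, eval x G * s ε x * VE θ ε x * wN (n+1) a b x ∂(muN (n+1))) (𝓝[>] 0)
      (𝓝 (∫ x, eval x G * VE θ 0 x * wN (n+1) a b x ∂(muN (n+1)))) := by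
  have hb0 := (int_bdd (n+1) a b ha hb (fun x => eval x G * ∏ _i : Fin (n+1), ∏ _j : Fin (n+1), (2:ℝ)^θ)
    ((eval_cont _ _).mul continuous_const)).norm
  refine tendsto_integral_filter_of_dominated_convergence _ ?_ ?_ hb0 ?_
  · filter_upwards [self_mem_nhdsWithin] with ε hε
    exact (int_bdd (n+1) a b ha hb _ (((eval_cont _ _).mul (hs ε hε)).mul (VE_cont θ ε hθ))).aestronglyMeasurable
  · filter_upwards [self_mem_nhdsWithin, nhdsWithin_le_nhds (Iio_mem_nhds (show (0:ℝ) < 1 by norm_num))] with ε hε h1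
    have hε' : 0 < ε := hε
    filter_upwards [muN_mem (n+1)] with x hx
    rw [norm_mul, norm_mul _ (wN (n+1) a b x)]
    refine mul_le_mul_of_nonneg_right ?_ (norm_nonneg (wN (n+1) a b x))
    rw [norm_mul, norm_mul, norm_mul, mul_assoc]
    refine mul_le_mul_of_nonneg_left ?_ (norm_nonneg (eval x G))
    have h3 := VE_le θ ε hθ hε'.le (le_of_lt h1) x hx
    have h4 := VE_nonneg θ ε hε'.le x
    rw [Real.norm_eq_abs, Real.norm_eq_abs, Real.norm_eq_abs, abs_of_nonneg h4,
      abs_of_nonneg (h4.trans h3)]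
    calc _ ≤ 1 * VE θ ε x := mul_le_mul_of_nonneg_right (hs1 ε x hε') h4
      _ ≤ _ := by rw [one_mul]; exact h3
  · refine Eventually.of_forall fun x => ?_
    have := ((hl x).const_mul (eval x G)).mul_const (wN (n+1) a b x)
    refine this.congr fun ε => ?_
    ring

lemma lE_loop (n : ℕ) (θ a b : ℝ) (hθ : 0 < θ) (ha : -1 < a) (hb : -1 < b) :
    Loop n θ (a+1) (a+1+(b+1)) (lE n θ a b hθ ha hb) := by
  intro G Q hQ
  have h1 := lE_dct n θ a b hθ ha hb (X 0 * (1 - X 0) * pderiv 0 G + (C (a+1) - C (a+1+(b+1)) * X 0) * G)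
    (fun _ _ => 1) (fun _ _ => continuous_const) (by simp)
    (fun x => by simpa using (VE_lim θ hθ x).mono_left nhdsWithin_le_nhds)
  have h2 : ∀ k : Fin n, _ := fun k => lE_dct n θ a b hθ ha hb (X k.succ * (1 - X k.succ) * Q k + (1 - X 0 - X k.succ) * G)
    (fun ε x => (x 0 - x k.succ)^2 / ((x 0 - x k.succ)^2 + ε))
    (fun ε hε => Continuous.div (by fun_prop) (by fun_prop) (fun x => by positivity))
    (fun ε x hε => by
      rw [abs_of_nonneg (by positivity)]
      exact div_le_one_of_le₀ (by linarith) (by positivity))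
    (fun x => by
      have h0 : Tendsto (fun ε => VE θ ε x) (𝓝[>] 0) (𝓝 (VE θ 0 x)) := (VE_lim θ hθ x).mono_left nhdsWithin_le_nhds
      by_cases hx : x 0 = x k.succ
      · simp [hx, VE_zero θ hθ x k hx]
      · have hd : (x 0 - x k.succ)^2 ≠ 0 := pow_ne_zero _ (sub_ne_zero.2 hx)
        have : Tendsto (fun ε => (x 0 - x k.succ)^2 / ((x 0 - x k.succ)^2 + ε)) (𝓝 0) (𝓝 ((x 0 - x k.succ)^2 / ((x 0 - x k.succ)^2 + 0))) :=
          tendsto_const_nhds.div (tendsto_const_nhds.add tendsto_id) (by simpa using hd)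
        rw [add_zero, div_self hd] at this
        simpa using (this.mono_left nhdsWithin_le_nhds).mul h0)
  have h3 := h1.add ((tendsto_finsetSum Finset.univ (fun k _ => h2 k)).const_mul θ)
  have h4 := tendsto_nhds_unique_of_eventuallyEq h3 tendsto_const_nhds (by
    filter_upwards [self_mem_nhdsWithin] with ε hε
    have := loop_eps n θ a b ε hθ ha hb hε G Q hQ
    simpa only [mul_one] using this)
  have h5 : X 0 * (1 - X 0) * pderiv 0 G + θ • ∑ k : Fin n, X k.succ * (1 - X k.succ) * Q k
      + θ • ∑ k : Fin n, (1 - X 0 - X k.succ) * G + (C (a+1) - C (a+1+(b+1)) * X 0) * G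
      = (X 0 * (1 - X 0) * pderiv 0 G + (C (a+1) - C (a+1+(b+1)) * X 0) * G)
        + θ • ∑ k : Fin n, (X k.succ * (1 - X k.succ) * Q k + (1 - X 0 - X k.succ) * G) := by
    rw [Finset.sum_add_distrib, smul_add]; ring
  rw [h5, map_add, LinearMap.map_smul, map_sum]
  simp only [lE_apply]
  have := congrArg (fun r : ℝ => (r : ℂ)) h4
  simpa using this

lemma Z_pos (n : ℕ) (θ a b : ℝ) (hθ : 0 < θ) (ha : -1 < a) (hb : -1 < b) :
    0 < ∫ x, VE θ 0 x * wN (n+1) a b x ∂(muN (n+1)) := by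
  have hi := int_bdd (n+1) a b ha hb _ (VE_cont θ 0 hθ (n := n+1))
  have hw : ∀ x : Fin (n+1) → ℝ, (∀ i, x i ∈ Ioo (0:ℝ) 1) → 0 < wN (n+1) a b x := by
    intro x hx
    refine Finset.prod_pos fun i _ => mul_pos (Real.rpow_pos_of_pos (hx i).1 _) (Real.rpow_pos_of_pos (by linarith [(hx i).2]) _)
  rw [integral_pos_iff_support_of_nonneg_ae _ hi]
  · let U : Set (Fin (n+1) → ℝ) := univ.pi fun i : Fin (n+1) => Ioo (((i:ℕ):ℝ)/(n+1)) ((((i:ℕ):ℝ)+1)/(n+1))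
    have hn : (0:ℝ) < n + 1 := by positivity
    have hsub : ∀ i : Fin (n+1), Ioo (((i:ℕ):ℝ)/(n+1)) ((((i:ℕ):ℝ)+1)/(n+1)) ⊆ Ioo (0:ℝ) 1 := by
      intro i t ht
      refine ⟨lt_of_le_of_lt (by positivity) ht.1, lt_of_lt_of_le ht.2 ?_⟩
      rw [div_le_one hn]
      have : (i:ℕ) + 1 ≤ n + 1 := i.2
      exact_mod_cast this
    have hU : 0 < muN (n+1) U := by
      unfold muN
      rw [Measure.pi_pi]
      rw [pos_iff_ne_zero, Finset.prod_ne_zero_iff]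
      intro i _
      rw [← pos_iff_ne_zero]
      unfold mu1
      rw [Measure.restrict_apply measurableSet_Ioo, inter_eq_left.2 (hsub i), Real.volume_Ioo]
      rw [ENNReal.ofReal_pos, ← sub_div]
      simp only [add_sub_cancel_left]; positivity
    refine lt_of_lt_of_le hU (measure_mono fun x hx => ?_)
    have hx' : ∀ i : Fin (n+1), x i ∈ Ioo (((i:ℕ):ℝ)/(n+1)) ((((i:ℕ):ℝ)+1)/(n+1)) := fun i => hx i (mem_univ i)
    rw [Function.mem_support]
    refine (mul_pos ?_ (hw x (fun i => hsub i (hx' i)))).ne'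
    refine Finset.prod_pos fun i _ => Finset.prod_pos fun j _ => ?_
    split_ifs with hij
    · have h1 : x i < x j := by
        refine (hx' i).2.trans_le (le_trans ?_ (hx' j).1.le)
        have : (i:ℕ) + 1 ≤ j := hij
        gcongr
        exact_mod_cast this
      have : 0 < (x i - x j)^2 + 0 := by have := sub_ne_zero.2 h1.ne; positivity
      positivity
    · norm_num
  · filter_upwards [muN_mem (n+1)] with x hx
    exact mul_nonneg (VE_nonneg _ _ le_rfl _) (hw x hx).le

lemma density_eq (n : ℕ) (θ α : ℝ) (M : ℕ) (x : Fin n → ℝ) :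
    jacobiDensity θ α M n x = VE θ 0 x * wN n (θ*α-1) (θ * ((M : ℝ) - (n : ℝ)) + θ - 1) x := by
  unfold jacobiDensity VE wN w1
  congr 1
  rw [Finset.prod_filter, ← Finset.univ_product_univ, Finset.prod_product]
  refine Finset.prod_congr rfl fun i _ => Finset.prod_congr rfl fun j _ => ?_
  split_ifs
  · rw [add_zero, ← sq_abs, ← Real.rpow_natCast, ← Real.rpow_mul (abs_nonneg _)]; norm_num
  · rfl

lemma restrict_eq (n : ℕ) : (volume.restrict (Set.univ.pi fun _ : Fin n => Set.Icc (0 : ℝ) 1)) = muN n := by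
  have := Measure.restrict_pi_pi (fun _ : Fin n => (volume : Measure ℝ)) (fun _ => Icc (0:ℝ) 1)
  rw [volume_pi, this]
  unfold muN mu1
  rw [Measure.restrict_congr_set Ioo_ae_eq_Icc]

lemma expect_eq (n : ℕ) (θ α : ℝ) (hθ : 0 < θ) (M : ℕ)
    (ha : -1 < θ*α-1) (hb : -1 < θ * ((M : ℝ) - ((n+1 : ℕ) : ℝ)) + θ - 1) (f : (Fin (n+1) → ℝ) → ℝ) :
    ∫ y, f y ∂ jacobiEnsemble θ α M (n+1)
     = (∫ x, VE θ 0 x * wN (n+1) (θ*α-1) (θ * ((M : ℝ) - ((n+1 : ℕ) : ℝ)) + θ - 1) x ∂(muN (n+1)))⁻¹ *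
       ∫ x, f x * VE θ 0 x * wN (n+1) (θ*α-1) (θ * ((M : ℝ) - ((n+1 : ℕ) : ℝ)) + θ - 1) x ∂(muN (n+1)) := by
  have hi := int_bdd (n+1) _ _ ha hb _ (VE_cont θ 0 hθ (n := n+1))
  have hnn : ∀ᵐ x ∂(muN (n+1)), 0 ≤ VE θ 0 x * wN (n+1) (θ*α-1) (θ * ((M : ℝ) - ((n+1 : ℕ) : ℝ)) + θ - 1) x := by
    filter_upwards [muN_mem (n+1)] with x hx
    refine mul_nonneg (VE_nonneg _ _ le_rfl _) (Finset.prod_nonneg fun i _ => mul_nonneg (Real.rpow_nonneg (hx i).1.le _) (Real.rpow_nonneg (by linarith [(hx i).2]) _))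
  unfold jacobiEnsemble
  rw [integral_smul_measure]
  unfold jacobiMeasureRaw
  simp_rw [density_eq]
  rw [restrict_eq]
  rw [withDensity_apply _ MeasurableSet.univ, Measure.restrict_univ,
    ← ofReal_integral_eq_lintegral_ofReal hi hnn, smul_eq_mul]
  congr 1
  · rw [ENNReal.toReal_inv, ENNReal.toReal_ofReal (integral_nonneg_of_ae hnn)]
  · have hm : Measurable fun x : Fin (n+1) → ℝ => VE θ 0 x * wN (n+1) (θ*α-1) (θ * ((M : ℝ) - ((n+1 : ℕ) : ℝ)) + θ - 1) x := by
      refine (VE_cont θ 0 hθ).measurable.mul ?_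
      unfold wN w1
      fun_prop
    rw [integral_withDensity_eq_integral_toReal_smul hm.ennreal_ofReal (by simp)]
    refine integral_congr_ae ?_
    filter_upwards [hnn] with x hx
    rw [ENNReal.toReal_ofReal hx, smul_eq_mul]; ring

/-- Expectation of polynomials agrees with any normalized solution of the loop equations. -/
theorem expect_poly (n : ℕ) (θ α : ℝ) (hθ : 0 < θ) (hα : 0 < α) (M : ℕ) (hM : n + 1 ≤ M)
    (L : MvPolynomial (Fin (n+1)) ℝ →ₗ[ℝ] ℂ) (hL1 : L 1 = 1) (hs : SymL n L)
    (hL : Loop n θ (θ*(α-1) + θ) (θ*(α+M-1) + θ - θ * n) L) (G : MvPolynomial (Fin (n+1)) ℝ) :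
    ((∫ y, eval y G ∂ jacobiEnsemble θ α M (n+1) : ℝ) : ℂ) = L G := by
  have hM' : ((n+1 : ℕ) : ℝ) ≤ M := by exact_mod_cast hM
  have ha : -1 < θ*α-1 := by have := mul_pos hθ hα; linarith
  have hb : -1 < θ * ((M : ℝ) - ((n+1 : ℕ) : ℝ)) + θ - 1 := by
    have := mul_nonneg hθ.le (sub_nonneg.2 hM'); linarith
  have hZ := Z_pos n θ _ _ hθ ha hb
  rw [expect_eq n θ α hθ M ha hb]
  set Z := ∫ x, VE θ 0 x * wN (n+1) (θ*α-1) (θ * ((M : ℝ) - ((n+1 : ℕ) : ℝ)) + θ - 1) x ∂(muN (n+1)) with hZd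
  have hZC : (Z : ℂ) ≠ 0 := by exact_mod_cast hZ.ne'
  set E := lE n θ _ _ hθ ha hb with hE
  have hEL := lE_loop n θ _ _ hθ ha hb
  have hES := lE_sym n θ _ _ hθ ha hb
  have e1 : θ*(α-1) + θ = θ*α-1+1 := by ring
  have e2 : θ*(α+M-1) + θ - θ * n = θ*α-1+1 + (θ * ((M : ℝ) - ((n+1 : ℕ) : ℝ)) + θ - 1 + 1) := by
    push_cast; ring
  rw [e1, e2] at hL
  have hD := uniq (n := n) (θ := θ) (a := θ*α-1+1) (c := θ*α-1+1 + (θ * ((M : ℝ) - ((n+1 : ℕ) : ℝ)) + θ - 1 + 1))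
    hθ (by linarith) (E - Z • L) ?_ ?_ ?_
  · have h := congrArg (fun K : MvPolynomial (Fin (n+1)) ℝ →ₗ[ℝ] ℂ => K G) hD
    simp only [LinearMap.sub_apply, LinearMap.smul_apply, LinearMap.zero_apply, sub_eq_zero] at h
    rw [hE, lE_apply] at h
    rw [Complex.ofReal_mul, h, Complex.ofReal_inv, Complex.real_smul, inv_mul_cancel_left₀ hZC]
  · intro σ G
    simp only [LinearMap.sub_apply, LinearMap.smul_apply]
    rw [hs, hE, hES]
  · intro G Q hQ
    rw [LinearMap.sub_apply, LinearMap.smul_apply, hL G Q hQ, hE, hEL G Q hQ]; simp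
  · rw [LinearMap.sub_apply, LinearMap.smul_apply, hL1, hE, lE_apply, hZd]
    simp

end JMF

namespace JMF
open Ug

section
variable {n : ℕ}

/-- region -/
def Om (n : ℕ) (c : ℂ) (R : ℝ) : Set (Ug n) := {r | ∀ j, ‖r.1 j - c‖ < R}

lemma Om_mono {c : ℂ} {R R' : ℝ} (h : R' ≤ R) {r : Ug n} (hr : r ∈ Om n c R') : r ∈ Om n c R :=
  fun j => (hr j).trans_le h

lemma Om_perm {c : ℂ} {R : ℝ} {r : Ug n} (hr : r ∈ Om n c R) (σ) : perm σ r ∈ Om n c R :=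
  fun j => hr (σ j)

lemma Om_cyc {c : ℂ} {R : ℝ} {r : Ug n} (hr : r ∈ Om n c (R - 1)) : cyc r ∈ Om n c R := by
  intro j
  refine Fin.cases ?_ (fun j => ?_) j
  · rw [cyc_zero]
    have := hr (Fin.last n)
    calc ‖r.1 (Fin.last n) - 1 - c‖ = ‖(r.1 (Fin.last n) - c) - 1‖ := by ring_nf
      _ ≤ ‖r.1 (Fin.last n) - c‖ + ‖(1:ℂ)‖ := norm_sub_le _ _
      _ < R := by rw [norm_one]; linarith
  · rw [cyc_succ]
    have := hr j.castSucc
    linarith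

/-- integral representation on a region -/
def PR (c : ℂ) (ρ R : ℝ) (f : ℂ → VV n) (ψ : VV n) : Prop :=
  ∀ r ∈ Om n c R, CircleIntegrable (fun v => f v r) c ρ ∧ ψ r = ∮ v in C(c, ρ), f v r

lemma PR.congr {c : ℂ} {ρ R : ℝ} (hρ : 0 ≤ ρ) {f f' : ℂ → VV n} {ψ ψ' : VV n} (h : PR c ρ R f ψ)
    (hf : ∀ r ∈ Om n c R, ∀ v ∈ Metric.sphere c ρ, f v r = f' v r) (hψ : ∀ r ∈ Om n c R, ψ r = ψ' r) :
    PR c ρ R f' ψ' := by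
  intro r hr
  obtain ⟨h1, h2⟩ := h r hr
  refine ⟨?_, ?_⟩
  · have e : (fun t : ℝ => f' (circleMap c ρ t) r) = fun t : ℝ => f (circleMap c ρ t) r :=
      funext fun t => (hf r hr _ (circleMap_mem_sphere c hρ t)).symm
    change IntervalIntegrable (fun t : ℝ => f' (circleMap c ρ t) r) _ _ _
    rw [e]; exact h1
  · rw [← hψ r hr, h2]
    exact circleIntegral.integral_congr hρ fun v hv => hf r hr v hv

lemma PR.mono {c : ℂ} {ρ R R' : ℝ} (h' : R' ≤ R) {f : ℂ → VV n} {ψ : VV n} (h : PR c ρ R f ψ) :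
    PR c ρ R' f ψ := fun r hr => h r (Om_mono h' hr)

/-- operators compatible with integral representations -/
def Deg (c : ℂ) (d : ℝ) (O : Module.End ℝ (VV n)) : Prop :=
  (∀ (z : ℂ) (ψ : VV n), O (z • ψ) = z • O ψ) ∧
  ∀ ρ R f ψ, PR c ρ R f ψ → PR c ρ (R - d) (fun v => O (f v)) (O ψ)

lemma ci_const_mul {f : ℂ → ℂ} {c : ℂ} {ρ : ℝ} (h : CircleIntegrable f c ρ) (z : ℂ) :
    CircleIntegrable (fun v => z * f v) c ρ := h.const_smul (a := z)

lemma cint_const_mul (f : ℂ → ℂ) (c : ℂ) (ρ : ℝ) (z : ℂ) :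
    (∮ v in C(c, ρ), z * f v) = z * ∮ v in C(c, ρ), f v := by
  have := circleIntegral.integral_smul z f c ρ
  simpa using this

lemma Deg.T (θ : ℝ) (c : ℂ) {i : ℕ} (hi : i < n) : Deg c 0 (Tn n θ i) := by
  rw [Tn_of_lt θ hi]
  generalize (⟨i, by omega⟩ : Fin (n+1)) = a
  generalize (⟨i+1, by omega⟩ : Fin (n+1)) = b
  refine ⟨?_, ?_⟩
  · intro z ψ
    ext r
    simp only [Top_apply, Pi.smul_apply, smul_eq_mul]
    ring
  · intro ρ R f ψ h r hr
    rw [sub_zero] at hr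
    obtain ⟨h1, h2⟩ := h r hr
    obtain ⟨h3, h4⟩ := h _ (Om_perm hr (Equiv.swap a b))
    simp only [Top_apply]
    have h5 : CircleIntegrable (fun v => θ / (r.1 a - r.1 b) * (f v r - f v (perm (Equiv.swap a b) r))) c ρ :=
      ci_const_mul (h1.sub h3) (θ / (r.1 a - r.1 b))
    refine ⟨h3.add h5, ?_⟩
    refine Eq.trans ?_ (circleIntegral.integral_add h3 h5).symm
    rw [cint_const_mul, circleIntegral.integral_sub h1 h3, h2, h4]

lemma Deg.pop (g : ℂ → ℂ) (c : ℂ) : Deg (n := n) c 1 (pop g) := by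
  refine ⟨?_, ?_⟩
  · intro z ψ
    ext r
    simp only [pop_apply, Pi.smul_apply, smul_eq_mul]
    ring
  · intro ρ R f ψ h r hr
    obtain ⟨h1, h2⟩ := h _ (Om_cyc hr)
    simp only [pop_apply]
    exact ⟨ci_const_mul h1 _, by rw [cint_const_mul, h2]⟩

lemma Deg.mul {c : ℂ} {d d' : ℝ} {O O' : Module.End ℝ (VV n)} (h : Deg c d O) (h' : Deg c d' O') :
    Deg c (d' + d) (O * O') := by
  refine ⟨?_, ?_⟩
  · intro z ψ
    simp only [Module.End.mul_apply]
    rw [h'.1, h.1]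
  · intro ρ R f ψ hP
    have := h.2 _ _ _ _ (h'.2 _ _ _ _ hP)
    rwa [sub_sub] at this

lemma Deg.one (c : ℂ) : Deg (n := n) c 0 1 := ⟨fun _ _ => rfl, fun ρ R f ψ hP => by simpa using hP⟩

lemma Deg.add {c : ℂ} {d : ℝ} {O O' : Module.End ℝ (VV n)} (h : Deg c d O) (h' : Deg c d O') :
    Deg c d (O + O') := by
  refine ⟨?_, ?_⟩
  · intro z ψ
    simp only [LinearMap.add_apply]
    rw [h'.1, h.1, smul_add]
  · intro ρ R f ψ hP r hr
    obtain ⟨h1, h2⟩ := h.2 _ _ _ _ hP r hr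
    obtain ⟨h3, h4⟩ := h'.2 _ _ _ _ hP r hr
    simp only [LinearMap.add_apply, Pi.add_apply]
    exact ⟨h1.add h3, by rw [circleIntegral.integral_add h1 h3, h2, h4]⟩

lemma Deg.smul {c : ℂ} {d : ℝ} {O : Module.End ℝ (VV n)} (h : Deg c d O) (x : ℝ) :
    Deg c d (x • O) := by
  refine ⟨?_, ?_⟩
  · intro z ψ
    simp only [LinearMap.smul_apply]
    rw [h.1, smul_comm]
  · intro ρ R f ψ hP r hr
    obtain ⟨h1, h2⟩ := h.2 _ _ _ _ hP r hr
    simp only [LinearMap.smul_apply, Pi.smul_apply, Complex.real_smul]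
    exact ⟨ci_const_mul h1 _, by rw [cint_const_mul, h2]⟩

/-- partial words -/
noncomputable def Wd (n : ℕ) (θ : ℝ) : ℕ → Module.End ℝ (VV n)
  | 0 => 1
  | i+1 => Tn n θ i * Wd n θ i

lemma Deg.Wd (θ : ℝ) (c : ℂ) (i : ℕ) (hi : i ≤ n) : Deg c 0 (Wd n θ i) := by
  induction i with
  | zero => exact Deg.one c
  | succ i ih => rw [JMF.Wd]; simpa using (Deg.T θ c (show i < n by omega)).mul (ih (by omega))

lemma Deg.W (θ : ℝ) (c : ℂ) (i : ℕ) (hi : i ≤ n) : Deg c 0 (W (Tn n θ) i) := by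
  induction i with
  | zero => exact Deg.one c
  | succ i ih => rw [JMF.W]; simpa using (ih (by omega)).mul (Deg.T θ c (show i < n by omega))

/-- `Fin' = -θ ∑ T_{i-1} ... T_0` -/
noncomputable def FinO (n : ℕ) (θ : ℝ) : Module.End ℝ (VV n) :=
  (-θ) • ∑ i ∈ Finset.range (n+1), Wd n θ i

lemma Deg.FinO (θ : ℝ) (c : ℂ) : Deg c 0 (FinO n θ) := by
  refine Deg.smul ?_ _
  have : ∀ k, k ≤ n → Deg c 0 (∑ i ∈ Finset.range (k+1), JMF.Wd n θ i) := by
    intro k hk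
    induction k with
    | zero => simpa using Deg.Wd θ c 0 (by omega)
    | succ k ih =>
      rw [Finset.sum_range_succ]
      exact (ih (by omega)).add (Deg.Wd θ c (k+1) hk)
  exact this n le_rfl

lemma Deg.X0 (θ : ℝ) (g : ℂ → ℂ) (c : ℂ) : Deg c 1 (Xo n (Tn n θ) (JMF.pop g) 0) := by
  simpa [Xo] using (Deg.W (n := n) θ c n le_rfl).mul (Deg.pop g c)

/-- elementary factor -/
noncomputable def tt (θ : ℝ) (v r : ℂ) : ℂ := (v - r - θ) / (v - r)

/-- the functions `q_i` -/
noncomputable def qq (n : ℕ) (θ : ℝ) (i : ℕ) (v : ℂ) (r : Ug n) : ℂ :=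
  if h : i < n + 1 then (v - r.1 ⟨i, h⟩)⁻¹ * ∏ j ∈ Finset.univ.filter (fun j : Fin (n+1) => i < (j : ℕ)), tt θ v (r.1 j) else 0

lemma T_local (θ : ℝ) {i : ℕ} (hi : i < n) (ψ : VV n) (r : Ug n) (S s1 s2 : ℂ)
    (h1 : ψ r = s1 * S) (h2 : ψ (perm (Equiv.swap ⟨i, by omega⟩ ⟨i+1, by omega⟩) r) = s2 * S) :
    Tn n θ i ψ r = (s2 + θ / (r.1 ⟨i, by omega⟩ - r.1 ⟨i+1, by omega⟩) * (s1 - s2)) * S := by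
  rw [Tn_of_lt θ hi, Top_apply, h1, h2]; ring

lemma prod_filter_swap (θ : ℝ) {i : ℕ} (hi : i < n) (v : ℂ) (r : Ug n) :
    ∏ j ∈ Finset.univ.filter (fun j : Fin (n+1) => i + 1 < (j : ℕ)), tt θ v ((perm (Equiv.swap ⟨i, by omega⟩ ⟨i+1, by omega⟩) r).1 j)
     = ∏ j ∈ Finset.univ.filter (fun j : Fin (n+1) => i + 1 < (j : ℕ)), tt θ v (r.1 j) := by
  refine Finset.prod_congr rfl fun j hj => ?_
  simp only [Finset.mem_filter, Finset.mem_univ, true_and] at hj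
  rw [perm_val, Equiv.swap_apply_of_ne_of_ne] <;> rw [Ne, Fin.ext_iff] <;> simp <;> omega

lemma prod_filter_succ (θ : ℝ) {i : ℕ} (hi : i < n) (v : ℂ) (r : Ug n) :
    ∏ j ∈ Finset.univ.filter (fun j : Fin (n+1) => i < (j : ℕ)), tt θ v (r.1 j)
     = tt θ v (r.1 ⟨i+1, by omega⟩) * ∏ j ∈ Finset.univ.filter (fun j : Fin (n+1) => i + 1 < (j : ℕ)), tt θ v (r.1 j) := by
  have : Finset.univ.filter (fun j : Fin (n+1) => i < (j : ℕ)) =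
     insert ⟨i+1, by omega⟩ (Finset.univ.filter (fun j : Fin (n+1) => i + 1 < (j : ℕ))) := by
    ext j
    simp only [Finset.mem_filter, Finset.mem_univ, true_and, Finset.mem_insert, Fin.ext_iff]
    omega
  rw [this, Finset.prod_insert (by simp)]

/-- `T_i (q_{i+1} S) = q_i S` -/
lemma T_qq (θ : ℝ) {i : ℕ} (hi : i < n) (v : ℂ) (r : Ug n) (S : VV n)
    (hS : S (perm (Equiv.swap ⟨i, by omega⟩ ⟨i+1, by omega⟩) r) = S r) (ψ : VV n)
    (hv : ∀ j, v ≠ r.1 j) (h1 : ψ r = qq n θ (i+1) v r * S r)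
    (h2 : ψ (perm (Equiv.swap ⟨i, by omega⟩ ⟨i+1, by omega⟩) r) = qq n θ (i+1) v (perm (Equiv.swap ⟨i, by omega⟩ ⟨i+1, by omega⟩) r) * S r) :
    Tn n θ i ψ r = qq n θ i v r * S r := by
  rw [T_local θ hi ψ r _ _ _ h1 h2]
  congr 1
  unfold qq
  rw [dif_pos (by omega), dif_pos (by omega), dif_pos (by omega), prod_filter_swap θ hi, prod_filter_succ θ hi,
    perm_val, Equiv.swap_apply_right]
  have e1 := sub_ne_zero.2 (hv ⟨i, by omega⟩)
  have e2 := sub_ne_zero.2 (hv ⟨i+1, by omega⟩)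
  have e3 := r.ne (i := ⟨i, by omega⟩) (j := ⟨i+1, by omega⟩) (by simp)
  unfold tt
  field_simp
  ring

/-- `T_i (q_i S) = q_{i+1} S` -/
lemma T_qq' (θ : ℝ) {i : ℕ} (hi : i < n) (v : ℂ) (r : Ug n) (S : VV n)
    (hS : S (perm (Equiv.swap ⟨i, by omega⟩ ⟨i+1, by omega⟩) r) = S r) (ψ : VV n)
    (hv : ∀ j, v ≠ r.1 j) (h1 : ψ r = qq n θ i v r * S r)
    (h2 : ψ (perm (Equiv.swap ⟨i, by omega⟩ ⟨i+1, by omega⟩) r) = qq n θ i v (perm (Equiv.swap ⟨i, by omega⟩ ⟨i+1, by omega⟩) r) * S r) :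
    Tn n θ i ψ r = qq n θ (i+1) v r * S r := by
  rw [T_local θ hi ψ r _ _ _ h1 h2]
  congr 1
  unfold qq
  rw [dif_pos (by omega), dif_pos (by omega), dif_pos (by omega), prod_filter_succ θ hi, prod_filter_succ θ hi, prod_filter_swap θ hi,
    perm_val, perm_val, Equiv.swap_apply_right, Equiv.swap_apply_left]
  have e1 := sub_ne_zero.2 (hv ⟨i, by omega⟩)
  have e2 := sub_ne_zero.2 (hv ⟨i+1, by omega⟩)
  have e3 := r.ne (i := ⟨i, by omega⟩) (j := ⟨i+1, by omega⟩) (by simp)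
  unfold tt
  field_simp
  ring

/-- `Fin' (q_0 S) = (∏ t - 1) S`. -/
lemma FinO_qq (θ : ℝ) (v : ℂ) (S : VV n) (hS : ∀ σ r, S (perm σ r) = S r) (ψ : VV n) (r : Ug n)
    (hv : ∀ j, v ≠ r.1 j) (h : ∀ r : Ug n, (∀ j, v ≠ r.1 j) → ψ r = qq n θ 0 v r * S r) :
    FinO n θ ψ r = ((∏ j, tt θ v (r.1 j)) - 1) * S r := by
  have key : ∀ i, i ≤ n → ∀ r : Ug n, (∀ j, v ≠ r.1 j) → Wd n θ i ψ r = qq n θ i v r * S r := by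
    intro i hi
    induction i with
    | zero => intro r hr; exact h r hr
    | succ i ih =>
      intro r hr
      rw [Wd, Module.End.mul_apply]
      refine T_qq' θ (by omega) v r S (hS _ _) _ hr (ih (by omega) r hr) ?_
      rw [ih (by omega) _ (fun j => by simpa using hr _), hS]
  have tel : ∀ i, i ≤ n → (∏ j ∈ Finset.univ.filter (fun j : Fin (n+1) => i < (j : ℕ)), tt θ v (r.1 j))
      - θ * ∑ k ∈ Finset.range (i+1), qq n θ k v r = ∏ j, tt θ v (r.1 j) := by
    intro i hi
    induction i with
    | zero =>
      have e0 := sub_ne_zero.2 (hv 0)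
      have : (∏ j, tt θ v (r.1 j)) = tt θ v (r.1 0) * ∏ j ∈ Finset.univ.filter (fun j : Fin (n+1) => 0 < (j : ℕ)), tt θ v (r.1 j) := by
        have h1 : (Finset.univ : Finset (Fin (n+1))) = insert 0 (Finset.univ.filter (fun j : Fin (n+1) => 0 < (j : ℕ))) := by
          ext j
          simp only [Finset.mem_filter, Finset.mem_univ, true_and, Finset.mem_insert, Fin.ext_iff, Fin.val_zero, true_iff]
          exact Nat.eq_zero_or_pos _
        conv_lhs => rw [h1]
        rw [Finset.prod_insert (by simp)]
      rw [this]
      simp only [zero_add, Finset.sum_range_one, qq, dif_pos (Nat.succ_pos n)]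
      generalize ∏ j ∈ Finset.univ.filter (fun j : Fin (n+1) => 0 < (j : ℕ)), tt θ v (r.1 j) = P
      unfold tt
      change _ = _
      have : (⟨0, Nat.succ_pos n⟩ : Fin (n+1)) = 0 := rfl
      rw [this]
      field_simp
    | succ i ih =>
      rw [← ih (by omega), prod_filter_succ θ (show i < n by omega), Finset.sum_range_succ _ (i+1)]
      have : qq n θ (i+1) v r = (v - r.1 ⟨i+1, by omega⟩)⁻¹ * ∏ j ∈ Finset.univ.filter (fun j : Fin (n+1) => i + 1 < (j : ℕ)), tt θ v (r.1 j) := by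
        rw [qq, dif_pos]
      rw [this]
      have e0 := sub_ne_zero.2 (hv ⟨i+1, by omega⟩)
      generalize ∏ j ∈ Finset.univ.filter (fun j : Fin (n+1) => i + 1 < (j : ℕ)), tt θ v (r.1 j) = P
      unfold tt
      field_simp
      ring
  have t0 := tel n le_rfl
  rw [Finset.filter_false_of_mem (fun j _ => by have := j.2; omega), Finset.prod_empty] at t0
  rw [← t0]
  simp only [FinO, LinearMap.smul_apply, Pi.smul_apply, LinearMap.sum_apply, Finset.sum_apply, Complex.real_smul]
  rw [Finset.sum_congr rfl (fun i hi => key i (by simpa [Nat.lt_succ_iff] using hi) r hv), ← Finset.sum_mul]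
  push_cast
  ring

/-- The `X_0` step. -/
lemma X0_step (θ : ℝ) (g G : ℂ → ℂ) (c : ℂ) (ρ : ℝ) (hρ : 0 ≤ ρ) (χ S : VV n) (hS : ∀ σ r, S (perm σ r) = S r)
    (hχ : ∀ r ∈ Om n c ρ, χ (cyc r) = G (r.1 (Fin.last n)) * S r)
    (hd : DifferentiableOn ℂ (fun v => g v * G v) (Metric.closedBall c ρ)) :
    PR c ρ ρ (fun v r => (2 * Real.pi * Complex.I)⁻¹ * (g v * G v) * (qq n θ 0 v r * S r))
      (Xo n (Tn n θ) (pop g) 0 χ) := by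
  have hne : ∀ r ∈ Om n c ρ, ∀ v ∈ Metric.sphere c ρ, ∀ j, v ≠ r.1 j := by
    intro r hr v hv j h
    have := hr j
    rw [← h, ← dist_eq_norm, Metric.mem_sphere.1 hv] at this
    exact lt_irrefl _ this
  have base : PR c ρ ρ (fun v r => (2 * Real.pi * Complex.I)⁻¹ * (g v * G v) * (qq n θ n v r * S r)) (pop g χ) := by
    intro r hr
    have hq : ∀ v, qq n θ n v r = (v - r.1 (Fin.last n))⁻¹ := by
      intro v
      rw [qq, dif_pos (by omega), Finset.filter_false_of_mem (fun j _ => by have := j.2; omega), Finset.prod_empty, mul_one]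
      rfl
    have hw : r.1 (Fin.last n) ∈ Metric.ball c ρ := by
      rw [Metric.mem_ball, dist_eq_norm]; exact hr _
    simp only [hq]
    constructor
    · refine ContinuousOn.circleIntegrable hρ ?_
      refine ((continuousOn_const.mul (hd.continuousOn.mono Metric.sphere_subset_closedBall))).mul
        (ContinuousOn.mul ?_ continuousOn_const)
      exact ContinuousOn.inv₀ (by fun_prop) (fun v hv => sub_ne_zero.2 (hne r hr v hv _))
    · rw [pop_apply, hχ r hr]
      have h := hd.circleIntegral_sub_inv_smul hw
      simp only [smul_eq_mul] at h
      have e : ∀ v, (2 * Real.pi * Complex.I)⁻¹ * (g v * G v) * ((v - r.1 (Fin.last n))⁻¹ * S r)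
        = ((2 * Real.pi * Complex.I)⁻¹ * S r) * ((v - r.1 (Fin.last n))⁻¹ * (g v * G v)) := fun v => by ring
      simp only [e]
      rw [cint_const_mul, h]
      have := Complex.two_pi_I_ne_zero
      field_simp
  have step : ∀ i, i ≤ n → ∀ ψ, PR c ρ ρ (fun v r => (2 * Real.pi * Complex.I)⁻¹ * (g v * G v) * (qq n θ i v r * S r)) ψ →
      PR c ρ ρ (fun v r => (2 * Real.pi * Complex.I)⁻¹ * (g v * G v) * (qq n θ 0 v r * S r)) (W (Tn n θ) i ψ) := by
    intro i hi
    induction i with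
    | zero => intro ψ h; exact h
    | succ i ih =>
      intro ψ h
      rw [W, Module.End.mul_apply]
      refine ih (by omega) _ ?_
      have h2 := (Deg.T θ c (show i < n by omega)).2 _ _ _ _ h
      rw [sub_zero] at h2
      refine h2.congr hρ ?_ (fun _ _ => rfl)
      intro r hr v hv
      have := T_qq θ (show i < n by omega) v r (fun r => (2 * Real.pi * Complex.I)⁻¹ * (g v * G v) * S r) (by simp only [hS])
        (fun r => (2 * Real.pi * Complex.I)⁻¹ * (g v * G v) * (qq n θ (i+1) v r * S r)) (hne r hr v hv)
        (by ring) (by simp only [hS]; ring)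
      rw [this]; ring
  exact step n le_rfl _ base

end
end JMF

namespace JMF
open Ug

section
variable {n : ℕ}

lemma mem_far {θ : ℝ} (hθ : 0 < θ) {c x u : ℂ} {R R' : ℝ} (hx : ‖x - c‖ ≤ R) (hu : ‖u - c‖ = R') (h : max θ 1 < R' - R) :
    u - x ≠ 0 ∧ u - x + 1 ≠ 0 ∧ u - x - θ ≠ 0 ∧ u - x + 1 - θ ≠ 0 := by
  have hm : max θ 1 < ‖u - x‖ := by
    have : ‖u - c‖ ≤ ‖u - x‖ + ‖x - c‖ := by
      have := norm_add_le (u - x) (x - c); simpa using this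
    linarith
  have key : ∀ z : ℂ, ‖z‖ ≤ max θ 1 → u - x ≠ z := by
    intro z hz h0; rw [h0] at hm; linarith
  refine ⟨key 0 (by simp), ?_, ?_, ?_⟩
  · intro h0; exact key (-1) (by simp) (by linear_combination h0)
  · intro h0; exact key θ (by simp [abs_of_pos hθ]) (by linear_combination h0)
  · intro h0
    refine key (((θ - 1 : ℝ)) : ℂ) ?_ (by push_cast; linear_combination h0)
    rw [Complex.norm_real, Real.norm_eq_abs, abs_le]
    constructor
    · have := le_max_right θ 1; linarith
    · have := le_max_left θ 1; linarith

lemma tt_shift {θ : ℝ} {u x : ℂ} (h : u - x ≠ 0 ∧ u - x + 1 ≠ 0 ∧ u - x - θ ≠ 0 ∧ u - x + 1 - θ ≠ 0) :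
    tt θ u (x - 1) = crossF θ (u - x) * tt θ u x := by
  obtain ⟨h1, h2, h3, h4⟩ := h
  unfold tt crossF
  rw [show u - (x - 1) = u - x + 1 by ring]
  field_simp

lemma tt_shift' {θ : ℝ} {u x : ℂ} (h : u - x ≠ 0 ∧ u - x + 1 ≠ 0 ∧ u - x - θ ≠ 0 ∧ u - x + 1 - θ ≠ 0) :
    (u - (x - 1))⁻¹ = (u - x + 1 - θ)⁻¹ * crossF θ (u - x) * tt θ u x := by
  obtain ⟨h1, h2, h3, h4⟩ := h
  unfold tt crossF
  rw [show u - (x - 1) = u - x + 1 by ring]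
  field_simp

lemma tt_cyc (θ : ℝ) (u : ℂ) (r : Ug n)
    (h : u - r.1 (Fin.last n) ≠ 0 ∧ u - r.1 (Fin.last n) + 1 ≠ 0 ∧ u - r.1 (Fin.last n) - θ ≠ 0 ∧ u - r.1 (Fin.last n) + 1 - θ ≠ 0) :
    ∏ j, tt θ u ((cyc r).1 j) = crossF θ (u - r.1 (Fin.last n)) * ∏ j, tt θ u (r.1 j) := by
  rw [Fin.prod_univ_succ, Fin.prod_univ_castSucc]
  simp only [cyc_zero, cyc_succ]
  rw [tt_shift h]; ring

lemma qq_cyc (θ : ℝ) (u : ℂ) (r : Ug n)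
    (h : u - r.1 (Fin.last n) ≠ 0 ∧ u - r.1 (Fin.last n) + 1 ≠ 0 ∧ u - r.1 (Fin.last n) - θ ≠ 0 ∧ u - r.1 (Fin.last n) + 1 - θ ≠ 0) :
    qq n θ 0 u (cyc r) = (u - r.1 (Fin.last n) + 1 - θ)⁻¹ * crossF θ (u - r.1 (Fin.last n)) * ∏ j, tt θ u (r.1 j) := by
  have e : Finset.univ.filter (fun j : Fin (n+1) => 0 < (j : ℕ)) = Finset.univ.map (Fin.succEmb n) := by
    ext j
    simp only [Finset.mem_filter, Finset.mem_univ, true_and, Finset.mem_map, Fin.coe_succEmb]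
    constructor
    · intro hj; exact ⟨j.pred (by rintro rfl; simp at hj), by simp⟩
    · rintro ⟨i, rfl⟩; simp
  rw [qq, dif_pos (Nat.succ_pos n), e, Finset.prod_map, Fin.prod_univ_castSucc]
  have : (⟨0, Nat.succ_pos n⟩ : Fin (n+1)) = 0 := rfl
  rw [this]
  simp only [cyc_zero, Fin.coe_succEmb, cyc_succ]
  rw [tt_shift' h]; ring

/-- chain factor -/
noncomputable def kap (θ : ℝ) (ch : ℕ → Bool) (b : ℕ) (u : ℕ → ℂ) : ℂ :=
  if ch b then (u (b+1) - u b + 1 - θ)⁻¹ else 1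

/-- kernel part -/
noncomputable def KP (θ : ℝ) (ch : ℕ → Bool) (g : ℂ → ℂ) (K : ℕ) (a : ℕ) (u : ℕ → ℂ) : ℂ :=
  ∏ b ∈ Finset.Ico a K, (g (u b) * kap θ ch b u * ∏ q ∈ Finset.Ico (b+1) K, crossF θ (u q - u b))

/-- product of `t`s -/
noncomputable def Gm (n : ℕ) (θ : ℝ) (K : ℕ) (a : ℕ) (u : ℕ → ℂ) : VV n :=
  fun r => ∏ b ∈ Finset.Ico a K, ∏ j, tt θ (u b) (r.1 j)

/-- psi -/
noncomputable def psi (n : ℕ) (θ : ℝ) (K : ℕ) (a : ℕ) (u : ℕ → ℂ) : VV n :=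
  fun r => qq n θ 0 (u a) r * Gm n θ K (a+1) u r

/-- operators -/
noncomputable def Oo (n : ℕ) (θ : ℝ) (ch : ℕ → Bool) (g : ℂ → ℂ) : ℕ → Module.End ℝ (VV n)
  | 0 => FinO n θ
  | a+1 => if ch a then Oo n θ ch g a * Xo n (Tn n θ) (pop g) 0
      else Oo n θ ch g a * Xo n (Tn n θ) (pop g) 0 * FinO n θ

lemma Deg.Oo (θ : ℝ) (ch : ℕ → Bool) (g : ℂ → ℂ) (c : ℂ) (a : ℕ) : Deg c a (JMF.Oo n θ ch g a) := by
  induction a with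
  | zero => simpa [JMF.Oo] using Deg.FinO θ c
  | succ a ih =>
    rw [JMF.Oo]
    split_ifs
    · have := ih.mul (Deg.X0 θ g c)
      rwa [add_comm, ← Nat.cast_add_one] at this
    · have := (ih.mul (Deg.X0 θ g c)).mul (Deg.FinO θ c)
      rwa [zero_add, add_comm, ← Nat.cast_add_one] at this

/-- iterated integral -/
noncomputable def IterInt (c : ℂ) (ρ : ℕ → ℝ) (f : (ℕ → ℂ) → ℂ) : ℕ → (ℕ → ℂ) → ℂ
  | 0, u => f u
  | a+1, u => ∮ v in C(c, ρ a), (2 * Real.pi * Complex.I)⁻¹ * IterInt c ρ f a (Function.update u a v)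

lemma Gm_perm (θ : ℝ) (K a : ℕ) (u : ℕ → ℂ) (σ) (r : Ug n) : Gm n θ K a u (perm σ r) = Gm n θ K a u r := by
  unfold Gm
  refine Finset.prod_congr rfl fun b _ => ?_
  exact Equiv.prod_comp σ (fun j => tt θ (u b) (r.1 j))

lemma Gm_congr (θ : ℝ) (K a : ℕ) (u u' : ℕ → ℂ) (h : ∀ b, a ≤ b → b < K → u b = u' b) :
    Gm n θ K a u = Gm n θ K a u' := by
  ext r
  unfold Gm
  refine Finset.prod_congr rfl fun b hb => ?_
  rw [Finset.mem_Ico] at hb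
  rw [h b hb.1 hb.2]

lemma Gm_succ (θ : ℝ) (K a : ℕ) (ha : a < K) (u : ℕ → ℂ) (r : Ug n) :
    Gm n θ K a u r = (∏ j, tt θ (u a) (r.1 j)) * Gm n θ K (a+1) u r := by
  unfold Gm; exact Finset.prod_eq_prod_Ico_succ_bot ha _

lemma KP_congr (θ : ℝ) (ch : ℕ → Bool) (g : ℂ → ℂ) (K a : ℕ) (u u' : ℕ → ℂ) (hch : ch (K-1) = false) (h : ∀ b, a ≤ b → b < K → u b = u' b) :
    KP θ ch g K a u = KP θ ch g K a u' := by
  unfold KP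
  refine Finset.prod_congr rfl fun b hb => ?_
  rw [Finset.mem_Ico] at hb
  have h2 : ∏ q ∈ Finset.Ico (b+1) K, crossF θ (u q - u b) = ∏ q ∈ Finset.Ico (b+1) K, crossF θ (u' q - u' b) := by
    refine Finset.prod_congr rfl fun q hq => ?_
    rw [Finset.mem_Ico] at hq
    rw [h b hb.1 hb.2, h q (by omega) hq.2]
  have h3 : kap θ ch b u = kap θ ch b u' := by
    unfold kap
    by_cases hb' : b = K - 1
    · subst hb'; simp [hch]
    · rw [h b hb.1 hb.2, h (b+1) (by omega) (by omega)]
  rw [h2, h3, h b hb.1 hb.2]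

lemma KP_succ (θ : ℝ) (ch : ℕ → Bool) (g : ℂ → ℂ) (K a : ℕ) (ha : a < K) (u : ℕ → ℂ) :
    KP θ ch g K a u = (g (u a) * kap θ ch a u * ∏ q ∈ Finset.Ico (a+1) K, crossF θ (u q - u a)) * KP θ ch g K (a+1) u := by
  unfold KP; exact Finset.prod_eq_prod_Ico_succ_bot ha _

lemma cross_diff {θ : ℝ} (hθ : 0 < θ) {c u : ℂ} {R R' : ℝ} (hu : ‖u - c‖ = R') (h : max θ 1 < R' - R) :
    DifferentiableOn ℂ (fun x => crossF θ (u - x)) (Metric.closedBall c R) := by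
  intro x hx
  rw [Metric.mem_closedBall, dist_eq_norm] at hx
  obtain ⟨_, h2, h3, _⟩ := mem_far hθ hx hu h
  unfold crossF
  refine DifferentiableAt.differentiableWithinAt ?_
  refine DifferentiableAt.div (by fun_prop) (by fun_prop) (mul_ne_zero h2 h3)

lemma inv_diff {θ : ℝ} (hθ : 0 < θ) {c u : ℂ} {R R' : ℝ} (hu : ‖u - c‖ = R') (h : max θ 1 < R' - R) :
    DifferentiableOn ℂ (fun x => (u - x + 1 - θ)⁻¹) (Metric.closedBall c R) := by
  intro x hx
  rw [Metric.mem_closedBall, dist_eq_norm] at hx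
  obtain ⟨_, h2, h3, h4⟩ := mem_far hθ hx hu h
  refine DifferentiableAt.differentiableWithinAt ?_
  exact DifferentiableAt.inv (by fun_prop) h4

lemma cint_sub_zero {f h : ℂ → ℂ} {c : ℂ} {R : ℝ} (hh : CircleIntegrable h c R) (h0 : (∮ v in C(c, R), h v) = 0) :
    (∮ v in C(c, R), (f v - h v)) = ∮ v in C(c, R), f v := by
  by_cases hf : CircleIntegrable f c R
  · rw [circleIntegral.integral_sub hf hh, h0, sub_zero]
  · rw [circleIntegral.integral_undef hf, circleIntegral.integral_undef]
    intro h1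
    apply hf
    have := h1.add hh
    convert! this using 1
    ext v; simp

lemma KP_upd (θ : ℝ) (ch : ℕ → Bool) (g : ℂ → ℂ) (K a : ℕ) (ha : a < K) (hch : ch (K-1) = false) (u : ℕ → ℂ) (v : ℂ) :
    KP θ ch g K a (Function.update u a v) =
      (g v * ((if ch a then (u (a+1) - v + 1 - θ)⁻¹ else 1) * ∏ q ∈ Finset.Ico (a+1) K, crossF θ (u q - v))) * KP θ ch g K (a+1) u := by
  rw [KP_succ θ ch g K a ha, KP_congr θ ch g K (a+1) (Function.update u a v) u hch]
  · congr 1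
    rw [mul_assoc]
    congr 1
    · simp
    congr 1
    · unfold kap; simp
    · refine Finset.prod_congr rfl fun q hq => ?_
      rw [Finset.mem_Ico] at hq
      rw [Function.update_self, Function.update_of_ne (by omega)]
  · intro b hb _
    rw [Function.update_of_ne (by omega)]

/-- analyticity of the kernel in the current variable -/
lemma ker_diff {θ : ℝ} (hθ : 0 < θ) (ch : ℕ → Bool) (K a : ℕ) (hch : ch (K-1) = false) (ha : a < K) (c : ℂ) (ρ : ℕ → ℝ)
    (hρ : ∀ a b, a < b → b < K → max θ 1 < ρ b - ρ a) (u : ℕ → ℂ)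
    (hu : ∀ b, a < b → b < K → ‖u b - c‖ = ρ b) :
    DifferentiableOn ℂ (fun v => (if ch a then (u (a+1) - v + 1 - θ)⁻¹ else 1) * ∏ q ∈ Finset.Ico (a+1) K, crossF θ (u q - v))
      (Metric.closedBall c (ρ a)) := by
  refine DifferentiableOn.mul ?_ ?_
  · split_ifs with h
    · have : a + 1 < K := by
        by_contra hc
        have : a = K - 1 := by omega
        rw [this, hch] at h; exact absurd h (by simp)
      exact inv_diff hθ (hu (a+1) (by omega) this) (hρ _ _ (by omega) this)
    · exact differentiableOn_const _
  · refine DifferentiableOn.fun_finsetProd fun q hq => ?_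
    rw [Finset.mem_Ico] at hq
    exact cross_diff hθ (hu q (by omega) hq.2) (hρ _ _ (by omega) hq.2)

lemma KP_zero {θ : ℝ} (hθ : 0 < θ) (ch : ℕ → Bool) (g : ℂ → ℂ) (hg : Differentiable ℂ g) (K a : ℕ) (hch : ch (K-1) = false) (ha : a < K) (c : ℂ) (ρ : ℕ → ℝ)
    (hρ0 : 0 ≤ ρ a)
    (hρ : ∀ a b, a < b → b < K → max θ 1 < ρ b - ρ a) (u : ℕ → ℂ)
    (hu : ∀ b, a < b → b < K → ‖u b - c‖ = ρ b) :
    CircleIntegrable (fun v => KP θ ch g K a (Function.update u a v)) c (ρ a) ∧ (∮ v in C(c, ρ a), KP θ ch g K a (Function.update u a v)) = 0 := by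
  have hd : DifferentiableOn ℂ (fun v => KP θ ch g K a (Function.update u a v)) (Metric.closedBall c (ρ a)) := by
    simp only [KP_upd θ ch g K a ha hch]
    exact (hg.differentiableOn.mul (ker_diff hθ ch K a hch ha c ρ hρ u hu)).mul (differentiableOn_const _)
  refine ⟨(hd.continuousOn.mono Metric.sphere_subset_closedBall).circleIntegrable hρ0, ?_⟩
  have := (DiffContOnCl.mk (hd.mono Metric.ball_subset_closedBall) (hd.continuousOn.mono Metric.closure_ball_subset_closedBall)).circleIntegral_eq_zero hρ0
  exact this

end
end JMF

namespace JMF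
open Ug

section
variable {n : ℕ}

lemma Gm_cyc {θ : ℝ} (hθ : 0 < θ) (K a a' : ℕ) (haa : a < a') (c : ℂ) (ρ : ℕ → ℝ)
    (hρ : ∀ a b, a < b → b < K → max θ 1 < ρ b - ρ a) (u : ℕ → ℂ)
    (hu : ∀ b, a < b → b < K → ‖u b - c‖ = ρ b) (r : Ug n) (hr : r ∈ Om n c (ρ a)) :
    Gm n θ K a' u (cyc r) = (∏ q ∈ Finset.Ico a' K, crossF θ (u q - r.1 (Fin.last n))) * Gm n θ K a' u r := by
  unfold Gm
  rw [← Finset.prod_mul_distrib]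
  refine Finset.prod_congr rfl fun q hq => ?_
  rw [Finset.mem_Ico] at hq
  exact tt_cyc θ _ r (mem_far hθ (hr _).le (hu q (by omega) hq.2) (hρ _ _ (by omega) hq.2))

lemma psi_cyc {θ : ℝ} (hθ : 0 < θ) (K a : ℕ) (ha : a + 1 < K) (c : ℂ) (ρ : ℕ → ℝ)
    (hρ : ∀ a b, a < b → b < K → max θ 1 < ρ b - ρ a) (u : ℕ → ℂ)
    (hu : ∀ b, a < b → b < K → ‖u b - c‖ = ρ b) (r : Ug n) (hr : r ∈ Om n c (ρ a)) :
    psi n θ K (a+1) u (cyc r) = ((u (a+1) - r.1 (Fin.last n) + 1 - θ)⁻¹ * ∏ q ∈ Finset.Ico (a+1) K, crossF θ (u q - r.1 (Fin.last n))) * Gm n θ K (a+1) u r := by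
  unfold psi
  rw [Gm_cyc hθ K a (a+1+1) (by omega) c ρ hρ u hu r hr,
    qq_cyc θ _ r (mem_far hθ (hr _).le (hu (a+1) (by omega) ha) (hρ _ _ (by omega) ha)),
    Gm_succ θ K (a+1) ha, Finset.prod_eq_prod_Ico_succ_bot ha]
  ring

lemma rho_lin {θ : ℝ} {K : ℕ} {ρ : ℕ → ℝ} (hρ : ∀ a b, a < b → b < K → max θ 1 < ρ b - ρ a) (a : ℕ) (ha : a < K) :
    ρ 0 + a ≤ ρ a := by
  induction a with
  | zero => simp
  | succ a ih =>
    have := hρ a (a+1) (by omega) ha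
    have h1 := le_max_right θ 1
    have := ih (by omega)
    push_cast; linarith

lemma psi_upd (θ : ℝ) (K a : ℕ) (u : ℕ → ℂ) (v : ℂ) :
    psi n θ K a (Function.update u a v) = fun r => qq n θ 0 v r * Gm n θ K (a+1) u r := by
  ext r
  unfold psi
  rw [Function.update_self, Gm_congr θ K (a+1) (Function.update u a v) u (fun b hb _ => Function.update_of_ne (by omega) _ _)]

/-- Applying `Oo a * X_0` to a function which behaves well under `cyc`. -/
lemma OX_step {θ : ℝ} (ch : ℕ → Bool) (g : ℂ → ℂ) (hg : Differentiable ℂ g) (K a : ℕ) (ha : a < K) (hch : ch (K-1) = false)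
    (hθ : 0 < θ) (c : ℂ) (ρ : ℕ → ℝ) (hρ0 : ∀ a, a < K → 0 ≤ ρ a)
    (hρ : ∀ a b, a < b → b < K → max θ 1 < ρ b - ρ a) (u : ℕ → ℂ)
    (hu : ∀ b, a < b → b < K → ‖u b - c‖ = ρ b) (χ : VV n)
    (hχ : ∀ r ∈ Om n c (ρ a), χ (cyc r) = ((if ch a then (u (a+1) - r.1 (Fin.last n) + 1 - θ)⁻¹ else 1) * ∏ q ∈ Finset.Ico (a+1) K, crossF θ (u q - r.1 (Fin.last n))) * Gm n θ K (a+1) u r)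
    (r : Ug n) (hr : r ∈ Om n c (ρ 0)) :
    KP θ ch g K (a+1) u * Oo n θ ch g a (Xo n (Tn n θ) (pop g) 0 χ) r =
      ∮ v in C(c, ρ a), (2 * Real.pi * Complex.I)⁻¹ * (KP θ ch g K a (Function.update u a v) * Oo n θ ch g a (psi n θ K a (Function.update u a v)) r) := by
  have h1 := X0_step θ g (fun x => (if ch a then (u (a+1) - x + 1 - θ)⁻¹ else 1) * ∏ q ∈ Finset.Ico (a+1) K, crossF θ (u q - x))
    c (ρ a) (hρ0 a ha) χ (Gm n θ K (a+1) u) (Gm_perm θ K (a+1) u) hχ (hg.differentiableOn.mul (ker_diff hθ ch K a hch ha c ρ hρ u hu))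
  have h2 := (Deg.Oo (n := n) θ ch g c a).2 _ _ _ _ h1 r (Om_mono (by have := rho_lin hρ a ha; linarith) hr)
  rw [h2.2, ← cint_const_mul]
  congr 1
  ext v
  beta_reduce
  have e : (fun r => (2 * Real.pi * Complex.I)⁻¹ * (g v * ((if ch a then (u (a+1) - v + 1 - θ)⁻¹ else 1) * ∏ q ∈ Finset.Ico (a+1) K, crossF θ (u q - v))) * (qq n θ 0 v r * Gm n θ K (a+1) u r) : VV n)
     = ((2 * Real.pi * Complex.I)⁻¹ * (g v * ((if ch a then (u (a+1) - v + 1 - θ)⁻¹ else 1) * ∏ q ∈ Finset.Ico (a+1) K, crossF θ (u q - v)))) • psi n θ K a (Function.update u a v) := by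
    ext r
    rw [psi_upd]; rfl
  rw [KP_upd θ ch g K a ha hch, e, (Deg.Oo (n := n) θ ch g c a).1, Pi.smul_apply, smul_eq_mul]
  ring

lemma FinO_psi {θ : ℝ} (K a : ℕ) (ha : a < K) (u : ℕ → ℂ) (r : Ug n) (hr : ∀ j, u a ≠ r.1 j) :
    FinO n θ (psi n θ K a u) r = Gm n θ K a u r - Gm n θ K (a+1) u r := by
  rw [FinO_qq θ (u a) (Gm n θ K (a+1) u) (Gm_perm θ K _ u) (psi n θ K a u) r hr (fun _ _ => rfl), Gm_succ θ K a ha]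
  ring

theorem claim {θ : ℝ} (ch : ℕ → Bool) (g : ℂ → ℂ) (hg : Differentiable ℂ g) (K : ℕ) (hch : ch (K-1) = false)
    (hθ : 0 < θ) (c : ℂ) (ρ : ℕ → ℝ) (hρ0 : ∀ a, a < K → 0 ≤ ρ a)
    (hρ : ∀ a b, a < b → b < K → max θ 1 < ρ b - ρ a) (r : Ug n) (hr : r ∈ Om n c (ρ 0)) (a : ℕ) (ha : a < K) (u : ℕ → ℂ)
    (hu : ∀ b, a < b → b < K → ‖u b - c‖ = ρ b) :
    (∮ v in C(c, ρ a), (2 * Real.pi * Complex.I)⁻¹ * (KP θ ch g K a (Function.update u a v) * Oo n θ ch g a (psi n θ K a (Function.update u a v)) r))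
     = IterInt c ρ (fun u => KP θ ch g K 0 u * Gm n θ K 0 u r) (a+1) u := by
  induction a generalizing u with
  | zero =>
    rw [IterInt]
    simp only [IterInt, Oo]
    obtain ⟨z1, z2⟩ := KP_zero hθ ch g hg K 0 hch ha c ρ (hρ0 0 ha) hρ u hu
    rw [← cint_sub_zero (f := fun v => (2 * Real.pi * Complex.I)⁻¹ * (KP θ ch g K 0 (Function.update u 0 v) * Gm n θ K 0 (Function.update u 0 v) r))
      (ci_const_mul z1 ((2 * Real.pi * Complex.I)⁻¹ * Gm n θ K 1 u r)) (by rw [cint_const_mul, z2, mul_zero])]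
    refine circleIntegral.integral_congr (hρ0 0 ha) fun v hv => ?_
    beta_reduce
    rw [FinO_psi K 0 ha]
    · rw [Gm_congr θ K (0+1) (Function.update u 0 v) u (fun b hb _ => Function.update_of_ne (by omega) _ _)]
      ring
    · intro j h
      rw [Function.update_self] at h
      have := hr j
      rw [← h, ← dist_eq_norm, Metric.mem_sphere.1 hv] at this
      exact lt_irrefl _ this
  | succ a ih =>
    rw [IterInt]
    have hw : ∀ v ∈ Metric.sphere c (ρ (a+1)), ∀ b, a < b → b < K → ‖Function.update u (a+1) v b - c‖ = ρ b := by
      intro v hv b hb hb'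
      by_cases h : b = a + 1
      · subst h
        rw [Function.update_self, ← dist_eq_norm]; exact hv
      · rw [Function.update_of_ne h]; exact hu b (by omega) hb'
    by_cases hc : ch a = true
    · refine circleIntegral.integral_congr (hρ0 _ ha) fun v hv => ?_
      beta_reduce
      congr 1
      rw [← ih (by omega) _ (hw v hv), ← OX_step ch g hg K a (by omega) hch hθ c ρ hρ0 hρ _ (hw v hv) (psi n θ K (a+1) (Function.update u (a+1) v))
        (fun r hr => by rw [if_pos hc]; exact psi_cyc hθ K a ha c ρ hρ _ (hw v hv) r hr) r hr, Oo, if_pos hc]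
      rfl
    · obtain ⟨z1, z2⟩ := KP_zero hθ ch g hg K (a+1) hch ha c ρ (hρ0 _ ha) hρ u hu
      set X := Xo n (Tn n θ) (pop g) 0 with hX
      rw [← cint_sub_zero (f := fun v => (2 * Real.pi * Complex.I)⁻¹ * IterInt c ρ (fun u => KP θ ch g K 0 u * Gm n θ K 0 u r) (a+1) (Function.update u (a+1) v))
        (ci_const_mul z1 ((2 * Real.pi * Complex.I)⁻¹ * Oo n θ ch g a (X (Gm n θ K (a+2) u)) r)) (by rw [cint_const_mul, z2, mul_zero])]
      refine circleIntegral.integral_congr (hρ0 _ ha) fun v hv => ?_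
      beta_reduce
      have e2 : Gm n θ K (a+2) (Function.update u (a+1) v) = Gm n θ K (a+2) u :=
        Gm_congr θ K (a+2) (Function.update u (a+1) v) u (fun b hb _ => Function.update_of_ne (by omega) _ _)
      rw [← ih (by omega) _ (hw v hv), ← OX_step ch g hg K a (by omega) hch hθ c ρ hρ0 hρ _ (hw v hv)
        (FinO n θ (psi n θ K (a+1) (Function.update u (a+1) v)) + Gm n θ K (a+2) u) ?_ r hr, Oo, if_neg hc]
      · simp only [Module.End.mul_apply, map_add, Pi.add_apply, ← hX]
        ring
      · intro r hr
        rw [Pi.add_apply, FinO_psi K (a+1) ha, ← e2, sub_add_cancel, if_neg hc, one_mul]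
        · exact Gm_cyc hθ K a (a+1) (by omega) c ρ hρ _ (hw v hv) r hr
        · intro j h
          rw [Function.update_self] at h
          have hR : cyc r ∈ Om n c (ρ (a+1)) := by
            refine Om_cyc (Om_mono ?_ hr)
            have := hρ a (a+1) (by omega) ha
            have := le_max_right θ 1
            linarith
          have := hR j
          rw [← h, ← dist_eq_norm, Metric.mem_sphere.1 hv] at this
          exact lt_irrefl _ this

theorem claim_final {θ : ℝ} (ch : ℕ → Bool) (g : ℂ → ℂ) (hg : Differentiable ℂ g) (K : ℕ) (hch : ch K = false)
    (hθ : 0 < θ) (c : ℂ) (ρ : ℕ → ℝ) (hρ0 : ∀ a, a < K + 1 → 0 ≤ ρ a)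
    (hρ : ∀ a b, a < b → b < K + 1 → max θ 1 < ρ b - ρ a) (r : Ug n) (hr : r ∈ Om n c (ρ 0)) (u : ℕ → ℂ) :
    Oo n θ ch g K (Xo n (Tn n θ) (pop g) 0 (fun _ => 1)) r =
      IterInt c ρ (fun u => KP θ ch g (K+1) 0 u * Gm n θ (K+1) 0 u r) (K+1) u := by
  rw [← claim ch g hg (K+1) hch hθ c ρ hρ0 hρ r hr K (by omega) u (fun b hb hb' => by omega),
    ← OX_step ch g hg (K+1) K (by omega) hch hθ c ρ hρ0 hρ u (fun b hb hb' => by omega) (fun _ => 1) ?_ r hr]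
  · simp [KP]
  · intro r hr
    simp [hch, Gm]

end
end JMF

namespace JMF
open Ug MvPolynomial

section
variable {n : ℕ}

lemma Wd_semi (θ : ℝ) (g : ℂ → ℂ) (i : ℕ) (hi : i ≤ n) (k : ℕ) :
    Wd n θ i * Xo n (Tn n θ) (pop g) 0 ^ k = Xo n (Tn n θ) (pop g) i ^ k * Wd n θ i := by
  induction i with
  | zero => simp [Wd]
  | succ i ih =>
    rw [Wd, mul_assoc, ih (by omega), ← mul_assoc, ← mul_assoc]
    congr 1
    exact (SemiconjBy.pow_right ((model (n := n) θ g).TX i (by omega) : SemiconjBy _ _ _) k)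

lemma Wd_inv (θ : ℝ) (ψ : VV n) (hψ : ∀ i < n, Tn n θ i ψ = ψ) (i : ℕ) (hi : i ≤ n) : Wd n θ i ψ = ψ := by
  induction i with
  | zero => rfl
  | succ i ih => rw [Wd, Module.End.mul_apply, ih (by omega), hψ i (by omega)]

/-- power sum operators -/
noncomputable def Pk (n : ℕ) (θ : ℝ) (g : ℂ → ℂ) (k : ℕ) : Module.End ℝ (VV n) :=
  ∑ i : Fin (n+1), Xo n (Tn n θ) (pop g) i ^ k

lemma FinO_X (θ : ℝ) (g : ℂ → ℂ) (k : ℕ) (ψ : VV n) (hψ : ∀ i < n, Tn n θ i ψ = ψ) :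
    FinO n θ ((Xo n (Tn n θ) (pop g) 0 ^ k) ψ) = (-θ) • Pk n θ g k ψ := by
  rw [FinO, LinearMap.smul_apply, Pk]
  congr 1
  rw [LinearMap.sum_apply, LinearMap.sum_apply, Finset.sum_range]
  refine Finset.sum_congr rfl fun i _ => ?_
  rw [← Module.End.mul_apply, Wd_semi θ g i (by omega), Module.End.mul_apply, Wd_inv θ ψ hψ i (by omega)]

lemma Pk_comm (θ : ℝ) (g : ℂ → ℂ) (k : ℕ) (i : ℕ) (hi : i < n) : Tn n θ i * Pk n θ g k = Pk n θ g k * Tn n θ i := by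
  have h := model (n := n) θ g
  rw [Pk, Finset.mul_sum, Finset.sum_mul]
  rw [← Equiv.sum_comp (Equiv.swap (⟨i, by omega⟩ : Fin (n+1)) ⟨i+1, by omega⟩) (fun j => Xo n (Tn n θ) (pop g) j ^ k * Tn n θ i)]
  refine Finset.sum_congr rfl fun j _ => ?_
  by_cases h1 : j = ⟨i, by omega⟩
  · subst h1
    rw [Equiv.swap_apply_left]
    exact (SemiconjBy.pow_right (h.TX i hi : SemiconjBy _ _ _) k)
  by_cases h2 : j = ⟨i+1, by omega⟩
  · subst h2
    rw [Equiv.swap_apply_right]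
    exact (SemiconjBy.pow_right (h.TX' i hi : SemiconjBy _ _ _) k)
  rw [Equiv.swap_apply_of_ne_of_ne h1 h2]
  rw [Fin.ext_iff] at h1 h2
  simp only at h1 h2
  exact (h.L4 j i (by omega) hi (by omega) (by omega)).pow_right k

lemma Pk_inv (θ : ℝ) (g : ℂ → ℂ) (k : ℕ) (ψ : VV n) (hψ : ∀ i < n, Tn n θ i ψ = ψ) :
    ∀ i < n, Tn n θ i (Pk n θ g k ψ) = Pk n θ g k ψ := by
  intro i hi
  rw [← Module.End.mul_apply, Pk_comm θ g k i hi, Module.End.mul_apply, hψ i hi]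

/-- word -/
noncomputable def Rw (n : ℕ) (θ : ℝ) (ch : ℕ → Bool) (g : ℂ → ℂ) : ℕ → Module.End ℝ (VV n)
  | 0 => 1
  | 1 => FinO n θ * Xo n (Tn n θ) (pop g) 0
  | a+2 => Rw n θ ch g (a+1) * (if ch a then 1 else FinO n θ) * Xo n (Tn n θ) (pop g) 0

lemma Oo_Rw (θ : ℝ) (ch : ℕ → Bool) (g : ℂ → ℂ) (a : ℕ) :
    Oo n θ ch g a * Xo n (Tn n θ) (pop g) 0 = Rw n θ ch g (a+1) := by
  induction a with
  | zero => rfl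
  | succ a ih =>
    rw [Rw, ← ih, Oo]
    split_ifs <;> simp

/-- partial sums -/
def psm (k : ℕ → ℕ) (i : ℕ) : ℕ := ∑ j ∈ Finset.range i, k j

lemma psm_succ (k : ℕ → ℕ) (i : ℕ) : psm k (i+1) = psm k i + k i := Finset.sum_range_succ _ _

lemma psm_mono (k : ℕ → ℕ) (hk : ∀ i, 0 < k i) : StrictMono (psm k) :=
  strictMono_nat_of_lt_succ fun i => by rw [psm_succ]; have := hk i; omega

open Classical in
/-- chain indicator -/
noncomputable def chn (k : ℕ → ℕ) (a : ℕ) : Bool := decide (¬ ∃ i, psm k i = a + 1)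

lemma chn_block (k : ℕ → ℕ) (hk : ∀ i, 0 < k i) (i j : ℕ) (hj : j + 1 < k i) : chn k (psm k i + j) = true := by
  simp only [chn, decide_eq_true_eq]
  rintro ⟨i', h⟩
  have h1 : psm k i < psm k i' := by omega
  have h2 : psm k i' < psm k (i+1) := by rw [psm_succ]; omega
  rw [(psm_mono k hk).lt_iff_lt] at h1 h2
  omega

lemma chn_end (k : ℕ → ℕ) (i a : ℕ) (h : psm k i = a + 1) : chn k a = false := by
  simp only [chn, decide_eq_false_iff_not, not_not]
  exact ⟨i, h⟩

lemma Rw_block (θ : ℝ) (g : ℂ → ℂ) (k : ℕ → ℕ) (hk : ∀ i, 0 < k i) (i j : ℕ) (hj : j < k i) :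
    Rw n θ (chn k) g (psm k i + (j + 1)) = Rw n θ (chn k) g (psm k i) * (FinO n θ * Xo n (Tn n θ) (pop g) 0 ^ (j+1)) := by
  induction j with
  | zero =>
    rcases hp : psm k i with _ | p
    · simp [Rw]
    · rw [show p + 1 + (0 + 1) = p + 2 by omega, Rw, chn_end k i p hp]
      simp [mul_assoc]
  | succ j ih =>
    have e := ih (by omega)
    have h2 := chn_block k hk i j hj
    rw [show psm k i + (j + 1 + 1) = psm k i + j + 2 by omega, Rw, h2, if_pos rfl, mul_one,
      show psm k i + j + 1 = psm k i + (j + 1) by omega, e, pow_succ _ (j+1)]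
    simp only [mul_assoc]

lemma Rw_word (θ : ℝ) (g : ℂ → ℂ) (k : ℕ → ℕ) (hk : ∀ i, 0 < k i)
    (φ : MvPolynomial (Fin (n+1)) ℝ →ₐ[ℝ] Module.End ℝ (VV n)) (hφ : ∀ i : Fin (n+1), φ (X i) = Xo n (Tn n θ) (pop g) i)
    (i : ℕ) (ψ : VV n) (hψ : ∀ i < n, Tn n θ i ψ = ψ) :
    Rw n θ (chn k) g (psm k i) ψ = (-θ) ^ i • φ (∏ j ∈ Finset.range i, psum (Fin (n+1)) ℝ (k j)) ψ := by
  induction i generalizing ψ with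
  | zero => simp [psm, Rw]
  | succ i ih =>
    have hp : ∀ k, φ (psum (Fin (n+1)) ℝ k) = Pk n θ g k := by
      intro k
      simp [psum, Pk, hφ]
    obtain ⟨q, hq⟩ : ∃ q, k i = q + 1 := ⟨k i - 1, by have := hk i; omega⟩
    rw [psm_succ, hq, Rw_block θ g k hk i q (by omega), ← hq, Module.End.mul_apply, Module.End.mul_apply,
      FinO_X θ g _ ψ hψ, map_smul, ih _ (Pk_inv θ g _ ψ hψ), Finset.prod_range_succ, map_mul, hp, Module.End.mul_apply,
      smul_smul, pow_succ, mul_comm]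

/-- The nested contour formula for entire `g`. -/
theorem contour_big {θ : ℝ} (hθ : 0 < θ) (g : ℂ → ℂ) (hg : Differentiable ℂ g) (k : ℕ → ℕ) (hk : ∀ i, 0 < k i) (m : ℕ)
    (φ : MvPolynomial (Fin (n+1)) ℝ →ₐ[ℝ] Module.End ℝ (VV n)) (hφ : ∀ i : Fin (n+1), φ (X i) = Xo n (Tn n θ) (pop g) i)
    (c : ℂ) (ρ : ℕ → ℝ) (hρ0 : ∀ a, a < psm k (m+1) → 0 ≤ ρ a)
    (hρ : ∀ a b, a < b → b < psm k (m+1) → max θ 1 < ρ b - ρ a) (r : Ug n) (hr : r ∈ Om n c (ρ 0)) (u : ℕ → ℂ) :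
    (-θ : ℂ) ^ (m+1) * φ (∏ j ∈ Finset.range (m+1), psum (Fin (n+1)) ℝ (k j)) (fun _ => 1) r =
      IterInt c ρ (fun u => KP θ (chn k) g (psm k (m+1)) 0 u * Gm n θ (psm k (m+1)) 0 u r) (psm k (m+1)) u := by
  obtain ⟨K, hK⟩ : ∃ K, psm k (m+1) = K + 1 := ⟨psm k (m+1) - 1, by rw [psm_succ]; have := hk m; omega⟩
  have h1 := Rw_word θ g k hk φ hφ (m+1) (fun _ => 1) (fun i hi => Tn_one n θ i hi)
  rw [hK] at hρ0 hρ h1 ⊢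
  rw [← claim_final (chn k) g hg K (chn_end k _ _ hK) hθ c ρ hρ0 hρ r hr u]
  rw [← Module.End.mul_apply, Oo_Rw, h1]
  simp [Complex.real_smul]

end
end JMF

namespace JMF
open MeasureTheory Complex

/-- the torus -/
def Tor {n : ℕ} (c : Fin n → ℂ) (R : Fin n → ℝ) : Set (Fin n → ℂ) := {u | ∀ j, ‖u j - c j‖ = R j}

lemma torusMap_mem {n : ℕ} (c : Fin n → ℂ) (R : Fin n → ℝ) (hR : ∀ j, 0 ≤ R j) (t : Fin n → ℝ) : torusMap c R t ∈ Tor c R := by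
  intro j
  simp [torusMap, abs_of_nonneg (hR j)]

lemma torusMap_cont {n : ℕ} (c : Fin n → ℂ) (R : Fin n → ℝ) : Continuous (torusMap c R) := by
  unfold torusMap; fun_prop

lemma tor_int {n : ℕ} {c : Fin n → ℂ} {R : Fin n → ℝ} (hR : ∀ j, 0 ≤ R j) {f : (Fin n → ℂ) → ℂ} (hf : ContinuousOn f (Tor c R)) :
    TorusIntegrable f c R := by
  unfold TorusIntegrable
  refine ContinuousOn.integrableOn_compact isCompact_Icc ?_
  exact (hf.comp_continuous (torusMap_cont c R) (torusMap_mem c R hR)).continuousOn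

lemma insert_mem {n : ℕ} {c : Fin (n+1) → ℂ} {R : Fin (n+1) → ℝ} (i : Fin (n+1)) {x : ℂ} {y : Fin n → ℂ}
    (hx : ‖x - c i‖ = R i) (hy : y ∈ Tor (c ∘ i.succAbove) (R ∘ i.succAbove)) : i.insertNth (α := fun _ => ℂ) x y ∈ Tor c R := by
  intro j
  refine Fin.succAboveCases i ?_ (fun j => ?_) j
  · simpa using hx
  · simpa using hy j

lemma insert_cont {n : ℕ} (i : Fin (n+1)) : Continuous (fun p : ℂ × (Fin n → ℂ) => i.insertNth (α := fun _ => ℂ) p.1 p.2) := by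
  refine continuous_pi fun j => ?_
  refine Fin.succAboveCases i ?_ (fun j => ?_) j
  · simpa using continuous_fst
  · simp; fun_prop

lemma torus_inner {n : ℕ} (c : Fin (n+1) → ℂ) (R : Fin (n+1) → ℝ) (hR : ∀ j, 0 ≤ R j) (f : (Fin (n+1) → ℂ) → ℂ) (hf : ContinuousOn f (Tor c R))
    (i : Fin (n+1)) :
    (∯ x in T(c, R), f x) = ∯ y in T(c ∘ i.succAbove, R ∘ i.succAbove), ∮ x in C(c i, R i), f (i.insertNth x y) := by
  rw [torusIntegral_succAbove (tor_int hR hf) i, circleIntegral_def_Icc]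
  simp only [torusIntegral, circleIntegral_def_Icc, ← integral_smul]
  rw [integral_integral_swap]
  · refine integral_congr_ae (Filter.Eventually.of_forall fun t => ?_)
    refine integral_congr_ae (Filter.Eventually.of_forall fun s => ?_)
    exact smul_comm _ _ _
  · rw [Measure.prod_restrict]
    refine ContinuousOn.integrableOn_compact (isCompact_Icc.prod isCompact_Icc) ?_
    refine Continuous.continuousOn ?_
    unfold Function.uncurry
    simp only [smul_eq_mul]
    refine Continuous.mul ?_ (Continuous.mul ?_ ?_)
    · simp only [deriv_circleMap]; fun_prop
    · fun_prop
    · have h2 : ∀ p : ℝ × (Fin n → ℝ), i.insertNth (α := fun _ => ℂ) (circleMap (c i) (R i) p.1) (torusMap (c ∘ i.succAbove) (R ∘ i.succAbove) p.2) ∈ Tor c R := by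
        intro p
        refine insert_mem i ?_ (torusMap_mem _ _ (fun j => hR _) _)
        rw [← dist_eq_norm]
        exact circleMap_mem_sphere _ (hR i) _
      refine hf.comp_continuous ?_ h2
      exact (insert_cont i).comp ((by fun_prop : Continuous fun p : ℝ × (Fin n → ℝ) => circleMap (c i) (R i) p.1).prodMk
        ((torusMap_cont _ _).comp continuous_snd))

lemma torus_congr {n : ℕ} {c : Fin n → ℂ} {R : Fin n → ℝ} (hR : ∀ j, 0 ≤ R j) {f g : (Fin n → ℂ) → ℂ} (h : ∀ u ∈ Tor c R, f u = g u) :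
    (∯ x in T(c, R), f x) = ∯ x in T(c, R), g x := by
  unfold torusIntegral
  congr 1; ext t
  beta_reduce
  rw [h _ (torusMap_mem c R hR t)]

/-- deformation of one radius -/
lemma torus_move {n : ℕ} (c : Fin (n+1) → ℂ) (R R' : Fin (n+1) → ℝ) (hR : ∀ j, 0 < R j) (i : Fin (n+1))
    (h1 : ∀ j, j ≠ i → R' j = R j) (h2 : R i ≤ R' i) (f : (Fin (n+1) → ℂ) → ℂ)
    (hf : ∀ u, (∀ j, j ≠ i → ‖u j - c j‖ = R j) → R i ≤ ‖u i - c i‖ → ‖u i - c i‖ ≤ R' i → DifferentiableAt ℂ f u) :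
    (∯ x in T(c, R'), f x) = ∯ x in T(c, R), f x := by
  have hR' : ∀ j, 0 < R' j := by
    intro j
    by_cases h : j = i
    · subst h; exact (hR j).trans_le h2
    · rw [h1 j h]; exact hR j
  rw [torus_inner c R (fun j => (hR j).le) f ?_ i, torus_inner c R' (fun j => (hR' j).le) f ?_ i]
  · have e : R' ∘ i.succAbove = R ∘ i.succAbove := by
      ext j; exact h1 _ (Fin.succAbove_ne i j)
    rw [e]
    refine torus_congr (fun j => (hR _).le) fun y hy => ?_
    have hd : ∀ x, R i ≤ ‖x - c i‖ → ‖x - c i‖ ≤ R' i → DifferentiableAt ℂ (fun x => f (i.insertNth (α := fun _ => ℂ) x y)) x := by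
      intro x hx1 hx2
      have : DifferentiableAt ℂ (fun x => i.insertNth (α := fun _ => ℂ) x y) x := by
        rw [differentiableAt_pi]
        intro j
        refine Fin.succAboveCases i ?_ (fun j => ?_) j
        · simp
        · simp
      refine DifferentiableAt.comp x (hf _ ?_ ?_ ?_) this
      · intro j hj
        obtain ⟨j', rfl⟩ := Fin.exists_succAbove_eq hj
        simpa using hy j'
      · simpa using hx1
      · simpa using hx2
    refine Complex.circleIntegral_eq_of_differentiable_on_annulus_off_countable (hR i) h2 Set.countable_empty ?_ ?_
    · intro x hx
      simp only [Set.mem_sdiff, Metric.mem_closedBall, Metric.mem_ball, dist_eq_norm, not_lt] at hx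
      exact (hd x hx.2 hx.1).continuousAt.continuousWithinAt
    · intro x hx
      simp only [Set.mem_sdiff, Metric.mem_closedBall, Metric.mem_ball, dist_eq_norm, not_le, Set.mem_empty_iff_false, not_false_eq_true, and_true] at hx
      exact hd x hx.2.le hx.1.le
  · intro u hu
    refine (hf u (fun j hj => ?_) ?_ ?_).continuousAt.continuousWithinAt
    · rw [hu j, h1 j hj]
    · rw [hu i]; exact h2
    · rw [hu i]
  · intro u hu
    refine (hf u (fun j hj => hu j) ?_ ?_).continuousAt.continuousWithinAt
    · rw [hu i]
    · rw [hu i]; exact h2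

/-- simultaneous deformation of all radii by a shift -/
lemma torus_shift {n : ℕ} (c : Fin n → ℂ) (R : Fin n → ℝ) (hR : ∀ j, 0 < R j) (D : ℝ)
    (hRD : ∀ a b, a < b → D < R b - R a) (s : ℝ) (hs : 0 ≤ s) (f : (Fin n → ℂ) → ℂ)
    (hf : ∀ u : Fin n → ℂ, (∀ j, 0 < ‖u j - c j‖) → (∀ a b, a < b → D < ‖u b - c b‖ - ‖u a - c a‖) → DifferentiableAt ℂ f u) :
    (∯ x in T(c, fun j => R j + s), f x) = ∯ x in T(c, R), f x := by
  rcases n with _ | n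
  · simp
  have key : ∀ p, p ≤ n + 1 → (∯ x in T(c, fun j => R j + s), f x) = ∯ x in T(c, fun j => if (j : ℕ) < p then R j else R j + s), f x := by
    intro p
    induction p with
    | zero => simp
    | succ p ih =>
      intro hp
      rw [ih (by omega)]
      refine torus_move c _ _ ?_ ⟨p, by omega⟩ ?_ ?_ f ?_
      · intro j; have := hR j; split_ifs <;> linarith
      · intro j hj
        rw [Ne, Fin.ext_iff] at hj
        dsimp only at hj ⊢
        split_ifs <;> first | rfl | omega
      · simp [hs]
      · intro u hu hu1 hu2
        simp only [Nat.lt_succ_self, if_true, lt_irrefl, if_false] at hu1 hu2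
        have hb : ∀ j : Fin (n+1), (j : ℕ) < p → ‖u j - c j‖ = R j := by
          intro j hj
          rw [hu j (by rw [Ne, Fin.ext_iff]; dsimp only; omega), if_pos (by omega)]
        have hc : ∀ j : Fin (n+1), p < (j : ℕ) → ‖u j - c j‖ = R j + s := by
          intro j hj
          rw [hu j (by rw [Ne, Fin.ext_iff]; dsimp only; omega), if_neg (by omega)]
        have hlo : ∀ j, R j ≤ ‖u j - c j‖ ∧ ‖u j - c j‖ ≤ R j + s := by
          intro j
          rcases lt_trichotomy (j : ℕ) p with h | h | h
          · rw [hb j h]; exact ⟨le_rfl, by linarith⟩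
          · have : j = ⟨p, by omega⟩ := Fin.ext h
            rw [this]; exact ⟨hu1, hu2⟩
          · rw [hc j h]; exact ⟨by linarith, le_rfl⟩
        refine hf u (fun j => (hR j).trans_le (hlo j).1) fun a b hab => ?_
        have h0 := hRD a b hab
        rw [Fin.lt_def] at hab
        rcases lt_or_ge (a : ℕ) p with h | h
        · rw [hb a h]; have := (hlo b).1; linarith
        · rw [hc b (by omega)]; have := (hlo a).2; linarith
  rw [key (n+1) le_rfl]
  congr 1
  ext j
  rw [if_pos j.2]

end JMF

namespace JMF
open MeasureTheory Complex Ug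

/-- extension of a finite vector -/
def exv (K : ℕ) (y : Fin K → ℂ) (u : ℕ → ℂ) : ℕ → ℂ := fun b => if h : b < K then y ⟨b, h⟩ else u b

lemma exv_cont (K : ℕ) (u : ℕ → ℂ) : Continuous (fun y : Fin K → ℂ => exv K y u) := by
  refine continuous_pi fun b => ?_
  unfold exv
  split_ifs <;> fun_prop

lemma exv_diff (K : ℕ) (u : ℕ → ℂ) (b : ℕ) : Differentiable ℂ (fun y : Fin K → ℂ => exv K y u b) := by
  unfold exv
  split_ifs <;> fun_prop

lemma iter_torus (c : ℂ) (ρ : ℕ → ℝ) (F : (ℕ → ℂ) → ℂ) (Kt : ℕ) (hρ0 : ∀ b < Kt, 0 ≤ ρ b)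
    (hF : ContinuousOn F {u | ∀ b < Kt, ‖u b - c‖ = ρ b}) (K : ℕ) (hK : K ≤ Kt) (u : ℕ → ℂ)
    (hu : ∀ b, K ≤ b → b < Kt → ‖u b - c‖ = ρ b) :
    IterInt c ρ F K u = (2 * Real.pi * I)⁻¹ ^ K * ∯ y in T(fun _ : Fin K => c, fun j : Fin K => ρ j), F (exv K y u) := by
  induction K generalizing u with
  | zero =>
    have : exv 0 (fun _ => c) u = u := by ext b; simp [exv]
    simp [IterInt, this]
  | succ K ih =>
    rw [IterInt, torusIntegral_succAbove (tor_int (fun j => hρ0 _ (by omega)) ?_) (Fin.last K)]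
    · rw [← cint_const_mul]
      refine circleIntegral.integral_congr (hρ0 _ (by omega)) fun v hv => ?_
      beta_reduce
      rw [ih (by omega), pow_succ', mul_assoc]
      · have e : ∀ y : Fin K → ℂ, exv K y (Function.update u K v) = exv (K+1) ((Fin.last K).insertNth (α := fun _ => ℂ) v y) u := by
          intro y
          ext b
          unfold exv
          by_cases h1 : b < K
          · rw [dif_pos h1, dif_pos (by omega), Fin.insertNth_last']
            exact (Fin.snoc_castSucc (α := fun _ => ℂ) v y ⟨b, h1⟩).symm
          · rw [dif_neg h1]
            by_cases h2 : b = K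
            · subst h2
              rw [Function.update_self, dif_pos (by omega), Fin.insertNth_last']
              exact (Fin.snoc_last (α := fun _ => ℂ) v y).symm
            · rw [Function.update_of_ne h2, dif_neg (by omega)]
        have e2 : (fun j : Fin (K+1) => ρ j) ∘ (Fin.last K).succAbove = (fun j : Fin K => ρ j) := by
          funext j; simp
        have e3 : (fun _ : Fin (K+1) => c) ∘ (Fin.last K).succAbove = (fun _ : Fin K => c) := rfl
        rw [e2, e3]
        simp only [e]
        exact (mul_assoc _ _ _).symm
      · intro b hb hb'
        by_cases h : b = K
        · subst h
          rw [Function.update_self, ← dist_eq_norm]; exact hv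
        · rw [Function.update_of_ne h]; exact hu b (by omega) hb'
    · refine hF.comp (exv_cont _ _).continuousOn ?_
      intro y hy b hb
      beta_reduce
      unfold exv
      split_ifs with h
      · exact hy ⟨b, h⟩
      · exact hu b (by omega) hb

lemma telescope (n : ℕ) (θ : ℝ) (hθ : 0 < θ) (hi : Irrational θ) (u : ℂ) (hu : ∀ j, u ≠ (r0 n θ hθ hi).1 j) :
    ∏ j, tt θ u ((r0 n θ hθ hi).1 j) = u / (u + θ * (n + 1 : ℕ)) := by
  have hu' : ∀ j, j < n + 1 → u + θ * ((j:ℕ) + 1) ≠ 0 := by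
    intro j hj h0
    apply hu ⟨j, hj⟩
    rw [r0_val]
    linear_combination h0
  simp only [r0_val]
  rw [Fin.prod_univ_eq_prod_range (fun j => tt θ u (-(θ : ℂ) * ((j:ℕ) + 1)))]
  have : ∀ p, p ≤ n → ∏ j ∈ Finset.range (p+1), tt θ u (-(θ : ℂ) * ((j:ℕ) + 1)) = u / (u + θ * (p + 1 : ℕ)) := by
    intro p
    induction p with
    | zero => simp [tt]
    | succ p ih =>
      intro hp
      rw [Finset.prod_range_succ, ih (by omega)]
      have h1 := hu' p (by omega)
      have h2 := hu' (p+1) (by omega)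
      unfold tt
      push_cast at h2 ⊢
      have e : u - -(θ:ℂ) * (p + 1 + 1) = u + θ * (p + 1 + 1) := by ring
      rw [e]
      have e2 : u + (θ:ℂ) * (p + 1 + 1) - θ = u + θ * (p+1) := by ring
      rw [e2]
      field_simp
  exact this n le_rfl

/-- full integrand -/
noncomputable def Fullf (θ : ℝ) (N : ℕ) (ch : ℕ → Bool) (g : ℂ → ℂ) (K : ℕ) (w : ℕ → ℂ) : ℂ :=
  KP θ ch g K 0 w * ∏ b ∈ Finset.Ico 0 K, (w b / (w b + θ * (N : ℂ)))

lemma diff_prod {E ι : Type*} [NormedAddCommGroup E] [NormedSpace ℂ E] {s : Finset ι} {f : ι → E → ℂ} {x : E}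
    (h : ∀ i ∈ s, DifferentiableAt ℂ (f i) x) : DifferentiableAt ℂ (fun y => ∏ i ∈ s, f i y) x := by
  classical
  induction s using Finset.induction_on with
  | empty => simp
  | insert a s ha ih =>
    simp only [Finset.prod_insert ha]
    exact (h a (by simp)).mul (ih fun i hi => h i (by simp [hi]))

lemma Fullf_diff {θ : ℝ} (hθ : 0 < θ) (N : ℕ) (ch : ℕ → Bool) (g : ℂ → ℂ) (K : ℕ) (hch : ch (K-1) = false) (u : ℕ → ℂ) (y : Fin K → ℂ)
    (h0 : ∀ j, 0 < ‖y j - -((θ * N : ℝ) : ℂ)‖)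
    (h1 : ∀ a b, a < b → max θ 1 < ‖y b - -((θ * N : ℝ) : ℂ)‖ - ‖y a - -((θ * N : ℝ) : ℂ)‖)
    (hg : ∀ j, DifferentiableAt ℂ g (y j)) :
    DifferentiableAt ℂ (fun y => Fullf θ N ch g K (exv K y u)) y := by
  have hy : ∀ b (h : b < K), exv K y u b = y ⟨b, h⟩ := fun b h => dif_pos h
  have hd : ∀ b, DifferentiableAt ℂ (fun y : Fin K → ℂ => exv K y u b) y := fun b => (exv_diff K u b) y
  have far : ∀ a b, a < b → b < K → exv K y u b - exv K y u a ≠ 0 ∧ exv K y u b - exv K y u a + 1 ≠ 0 ∧ exv K y u b - exv K y u a - θ ≠ 0 ∧ exv K y u b - exv K y u a + 1 - θ ≠ 0 := by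
    intro a b hab hb
    rw [hy a (by omega), hy b hb]
    exact mem_far hθ le_rfl rfl (h1 _ _ (by simpa using hab))
  unfold Fullf KP
  refine DifferentiableAt.mul ?_ ?_
  · refine diff_prod fun b hb => ?_
    rw [Finset.mem_Ico] at hb
    refine DifferentiableAt.mul (DifferentiableAt.mul ?_ ?_) ?_
    · refine DifferentiableAt.comp (g := g) y ?_ (hd b)
      rw [hy b hb.2]; exact hg _
    · unfold kap
      split_ifs with h
      · have : b + 1 < K := by
          by_contra hc
          have : b = K - 1 := by omega
          rw [this, hch] at h; exact absurd h (by simp)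
        refine DifferentiableAt.inv ?_ (far b (b+1) (by omega) this).2.2.2
        exact (((hd (b+1)).sub (hd b)).add_const _).sub_const _
      · exact differentiableAt_const _
    · refine diff_prod fun q hq => ?_
      rw [Finset.mem_Ico] at hq
      obtain ⟨_, f2, f3, _⟩ := far b q (by omega) hq.2
      unfold crossF
      have hs : DifferentiableAt ℂ (fun y : Fin K → ℂ => exv K y u q - exv K y u b) y := (hd q).sub (hd b)
      simp only [div_eq_mul_inv]
      exact (hs.mul ((hs.add_const _).sub_const _)).mul (((hs.add_const _).mul (hs.sub_const _)).inv (mul_ne_zero f2 f3))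
  · refine diff_prod fun b hb => ?_
    rw [Finset.mem_Ico] at hb
    simp only [div_eq_mul_inv]
    refine (hd b).mul (((hd b).add_const _).inv ?_)
    rw [hy b hb.2]
    have := norm_pos_iff.1 (h0 ⟨b, hb.2⟩)
    intro hh; apply this; push_cast; linear_combination hh

theorem contour_small {n : ℕ} {θ : ℝ} (hθ : 0 < θ) (hi : Irrational θ) (g : ℂ → ℂ) (hg : Differentiable ℂ g) (k : ℕ → ℕ) (hk : ∀ i, 0 < k i) (m : ℕ)
    (φ : MvPolynomial (Fin (n+1)) ℝ →ₐ[ℝ] Module.End ℝ (VV n)) (hφ : ∀ i : Fin (n+1), φ (MvPolynomial.X i) = Xo n (Tn n θ) (pop g) i)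
    (ρ : ℕ → ℝ) (hρ0 : ∀ a, a < psm k (m+1) → 0 < ρ a)
    (hρ : ∀ a b, a < b → b < psm k (m+1) → max θ 1 < ρ b - ρ a) :
    (-θ : ℂ) ^ (m+1) * φ (∏ j ∈ Finset.range (m+1), MvPolynomial.psum (Fin (n+1)) ℝ (k j)) (fun _ => 1) (r0 n θ hθ hi) =
      (2 * Real.pi * I)⁻¹ ^ (psm k (m+1)) * ∯ y in T(fun _ : Fin (psm k (m+1)) => -((θ * (n+1 : ℕ) : ℝ) : ℂ), fun j : Fin (psm k (m+1)) => ρ j),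
        Fullf θ (n+1) (chn k) g (psm k (m+1)) (exv (psm k (m+1)) y 0) := by
  obtain ⟨K, hK⟩ : ∃ K, psm k (m+1) = K + 1 := ⟨psm k (m+1) - 1, by rw [psm_succ]; have := hk m; omega⟩
  have hch : chn k (psm k (m+1) - 1) = false := chn_end k (m+1) _ (by omega)
  set s : ℝ := θ * (n+1 : ℕ) with hs
  have hs0 : 0 < s := by positivity
  set c : ℂ := -((s : ℝ) : ℂ) with hc
  have hr : ∀ x, 0 < x → r0 n θ hθ hi ∈ Om n c (x + s) := by
    intro x hx j
    rw [r0_val, hc, hs]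
    have : -(θ:ℂ) * ((j:ℕ)+1) - -((θ * (n+1:ℕ) : ℝ) : ℂ) = ((θ * (n - (j:ℕ)) : ℝ) : ℂ) := by push_cast; ring
    rw [this, norm_real, Real.norm_eq_abs, abs_of_nonneg]
    · have : θ * (n - (j:ℕ)) ≤ θ * (n+1:ℕ) := by
        refine mul_le_mul_of_nonneg_left ?_ hθ.le
        push_cast
        have : (0:ℝ) ≤ (j:ℕ) := by positivity
        linarith
      linarith
    · have : ((j:ℕ):ℝ) ≤ n := by exact_mod_cast (Nat.lt_succ_iff.1 j.2)
      refine mul_nonneg hθ.le (by linarith)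
  rw [contour_big hθ g hg k hk m φ hφ c (fun a => ρ a + s) (fun a ha => by have := hρ0 a ha; linarith)
    (fun a b hab hb => by have := hρ a b hab hb; linarith) (r0 n θ hθ hi) (hr _ (hρ0 0 (by omega))) 0]
  clear_value s
  generalize hKt : psm k (m+1) = Kt at *
  have far : ∀ v : ℂ, s < ‖v - c‖ → ∀ j, v ≠ (r0 n θ hθ hi).1 j := by
    intro v hv j h
    have h2 : ‖v - c‖ ≤ s := by
      refine le_of_forall_pos_lt_add fun x hx => ?_
      have := hr x hx j
      rw [← h] at this; linarith
    linarith
  have hFull : ∀ w : ℕ → ℂ, (∀ b < Kt, ‖w b - c‖ = ρ b + s) →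
      KP θ (chn k) g Kt 0 w * Gm n θ Kt 0 w (r0 n θ hθ hi) = Fullf θ (n+1) (chn k) g Kt w := by
    intro w hw
    rw [Fullf, Gm]
    congr 1
    refine Finset.prod_congr rfl fun b hb => ?_
    rw [Finset.mem_Ico] at hb
    exact telescope n θ hθ hi (w b) (far _ (by rw [hw b hb.2]; have := hρ0 b hb.2; linarith))
  have hpos : ∀ j : Fin Kt, 0 < ρ j := fun j => hρ0 j j.2
  have hgap : ∀ a b : Fin Kt, a < b → max θ 1 < ρ b - ρ a := fun a b hab => hρ a b hab b.2
  have hdiff : ∀ y : Fin Kt → ℂ, (∀ j, 0 < ‖y j - c‖) → (∀ a b, a < b → max θ 1 < ‖y b - c‖ - ‖y a - c‖) →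
      DifferentiableAt ℂ (fun y => Fullf θ (n+1) (chn k) g Kt (exv Kt y 0)) y := by
    intro y h0 h1
    rw [hc, hs] at h0 h1
    exact Fullf_diff hθ (n+1) (chn k) g Kt hch 0 y h0 h1 (fun j => hg _)
  rw [iter_torus c (fun a => ρ a + s) _ Kt (fun a ha => by have := hρ0 a ha; linarith) ?_ Kt le_rfl 0 (fun b hb hb' => by omega)]
  · congr 1
    rw [← torus_shift (fun _ => c) (fun j : Fin Kt => ρ j) hpos (max θ 1) hgap s hs0.le _ hdiff]
    refine torus_congr (fun j => by have := hpos j; linarith) fun y hy => ?_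
    apply hFull
    intro b hb
    have := hy ⟨b, hb⟩
    rw [exv, dif_pos hb]; exact this
  · have h1 : ContinuousOn (fun y => Fullf θ (n+1) (chn k) g Kt (exv Kt y 0)) (Tor (fun _ => c) (fun j : Fin Kt => ρ j + s)) := by
      intro y hy
      refine (hdiff y ?_ ?_).continuousAt.continuousWithinAt
      · intro j; rw [hy j]; have := hpos j; linarith
      · intro a b hab; rw [hy a, hy b]; have := hgap a b hab; linarith
    have h2 : ContinuousOn (fun w : ℕ → ℂ => Fullf θ (n+1) (chn k) g Kt (exv Kt (fun j : Fin Kt => w j) 0)) {u | ∀ b < Kt, ‖u b - c‖ = ρ b + s} := by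
      refine h1.comp (Continuous.continuousOn (by fun_prop)) ?_
      intro w hw j
      exact hw j j.2
    refine h2.congr fun w hw => ?_
    beta_reduce
    rw [hFull w hw, Fullf, Fullf]
    have e : ∀ b, b < Kt → w b = exv Kt (fun j : Fin Kt => w j) 0 b := by
      intro b hb; rw [exv, dif_pos hb]
    rw [KP_congr θ (chn k) g Kt 0 w (exv Kt (fun j : Fin Kt => w j) 0) hch (fun b _ hb => e b hb)]
    congr 1
    refine Finset.prod_congr rfl fun b hb => ?_
    rw [Finset.mem_Ico] at hb
    rw [← e b hb.2]

end JMF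

namespace JMF
open MeasureTheory Complex Ug Filter Topology

lemma approx (A B : ℝ) : ∃ G : ℕ → ℂ → ℂ, (∀ p, Differentiable ℂ (G p)) ∧
    ∀ p : ℕ, ∀ u : ℂ, ‖u + p‖ ≤ p + B - 1 / ((p:ℝ)+1) → ‖G p u - (u - A) / (u - B)‖ ≤ 1 / ((p:ℝ)+1) := by
  have : ∀ p : ℕ, ∃ G : ℂ → ℂ, Differentiable ℂ G ∧
    ∀ u : ℂ, ‖u + p‖ ≤ p + B - 1 / ((p:ℝ)+1) → ‖G u - (u - A) / (u - B)‖ ≤ 1 / ((p:ℝ)+1) := by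
    intro p
    have he : 0 < 1 / ((p:ℝ)+1) := by positivity
    rcases lt_or_ge (p + B - 1 / ((p:ℝ)+1)) 0 with hr | hr
    · refine ⟨fun _ => 0, differentiable_const _, fun u hu => ?_⟩
      have := norm_nonneg (u + p); linarith
    set e := 1 / ((p:ℝ)+1) with hed
    set D : ℝ := p + B with hD
    have hD0 : 0 < D := by linarith
    set q := (D - e) / D with hq
    have hq0 : 0 ≤ q := div_nonneg hr hD0.le
    have hq1 : q < 1 := by rw [hq, div_lt_one hD0]; linarith
    have hlim : Tendsto (fun J => |B - A| / D * (q ^ J / (1 - q))) atTop (𝓝 (|B - A| / D * (0 / (1 - q)))) :=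
      ((tendsto_pow_atTop_nhds_zero_of_lt_one hq0 hq1).div_const _).const_mul _
    rw [zero_div, mul_zero] at hlim
    obtain ⟨J, hJ⟩ := (hlim.eventually_lt_const he).exists
    refine ⟨fun u => 1 - (B - A) / D * ∑ j ∈ Finset.range J, ((u + p) / D) ^ j, by fun_prop, fun u hu => ?_⟩
    have hDC : (D : ℂ) ≠ 0 := by exact_mod_cast hD0.ne'
    have hz : ‖(u + p) / D‖ ≤ q := by
      rw [norm_div, norm_real, Real.norm_eq_abs, abs_of_pos hD0, hq]
      gcongr
    set z := (u + p) / D with hzd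
    have hu1 : u - B = D * (z - 1) := by
      rw [hzd, mul_sub, mul_div_cancel₀ _ hDC, hD]; push_cast; ring
    have h1q : 0 < 1 - q := by linarith
    have hz1' : 1 - q ≤ ‖z - 1‖ := by
      rw [norm_sub_rev]
      have := norm_sub_norm_le 1 z
      rw [norm_one] at this; linarith
    have hz1 : z - 1 ≠ 0 := norm_pos_iff.1 (by linarith)
    have e1 : 1 - (B - A) / D * ∑ j ∈ Finset.range J, z ^ j - (u - A) / (u - B) = - ((B - A) / D * (z ^ J / (z - 1))) := by
      rw [geom_sum_eq (sub_ne_zero.1 hz1), show u - A = (u - B) + (B - A) by ring, hu1]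
      field_simp
      ring
    beta_reduce
    rw [e1, norm_neg, norm_mul, norm_div, norm_div, norm_pow, norm_real, Real.norm_eq_abs, abs_of_pos hD0]
    refine le_trans ?_ hJ.le
    rw [← ofReal_sub, norm_real, Real.norm_eq_abs]
    gcongr
  choose G h1 h2 using this
  exact ⟨G, h1, h2⟩

/-- pointwise convergence of operators -/
def Cv {n : ℕ} (a : ℕ → Module.End ℝ (VV n)) (b : Module.End ℝ (VV n)) : Prop :=
  ∀ (ψ : ℕ → VV n) (χ : VV n), (∀ r, Tendsto (fun p => ψ p r) atTop (𝓝 (χ r))) →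
    ∀ r, Tendsto (fun p => a p (ψ p) r) atTop (𝓝 (b χ r))

section
variable {n : ℕ}
lemma Cv.mul {a a' : ℕ → Module.End ℝ (VV n)} {b b' : Module.End ℝ (VV n)} (h : Cv a b) (h' : Cv a' b') :
    Cv (fun p => a p * a' p) (b * b') := by
  intro ψ χ hψ
  exact h _ _ (h' _ _ hψ)

lemma Cv.one : Cv (fun _ => (1 : Module.End ℝ (VV n))) 1 := fun _ _ hψ => hψ

lemma Cv.pow {a : ℕ → Module.End ℝ (VV n)} {b : Module.End ℝ (VV n)} (h : Cv a b) (k : ℕ) :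
    Cv (fun p => a p ^ k) (b ^ k) := by
  induction k with
  | zero => simpa using Cv.one
  | succ k ih => simpa only [pow_succ] using ih.mul h

lemma Cv.sum {ι : Type*} {s : Finset ι} {a : ι → ℕ → Module.End ℝ (VV n)} {b : ι → Module.End ℝ (VV n)} (h : ∀ i ∈ s, Cv (a i) (b i)) :
    Cv (fun p => ∑ i ∈ s, a i p) (∑ i ∈ s, b i) := by
  intro ψ χ hψ r
  simp only [LinearMap.sum_apply, Finset.sum_apply]
  exact tendsto_finsetSum _ fun i hi => h i hi _ _ hψ r

lemma Cv_Tn (θ : ℝ) (i : ℕ) : Cv (fun _ => Tn n θ i) (Tn n θ i) := by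
  intro ψ χ hψ r
  by_cases h : i < n
  · rw [Tn_of_lt θ h]
    simp only [Top_apply]
    exact (hψ _).add (((hψ _).sub (hψ _)).const_mul _)
  · simp only [JMF.Tn, dif_neg h, Module.End.one_apply]
    exact hψ r

lemma Cv_W (θ : ℝ) (j : ℕ) : Cv (fun _ => W (JMF.Tn n θ) j) (W (JMF.Tn n θ) j) := by
  induction j with
  | zero => exact Cv.one
  | succ j ih => exact ih.mul (Cv_Tn θ j)

lemma Cv_Xo (θ : ℝ) (g : ℕ → ℂ → ℂ) (g0 : ℂ → ℂ) (hg : ∀ u : ℂ, u.re < 0 → Tendsto (fun p => g p u) atTop (𝓝 (g0 u))) (i : ℕ) :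
    Cv (fun p => Xo n (JMF.Tn n θ) (pop (g p)) i) (Xo n (JMF.Tn n θ) (pop g0) i) := by
  induction i with
  | zero =>
    refine (Cv_W θ n).mul ?_
    intro ψ χ hψ r
    simp only [pop_apply]
    exact (hg _ (r.2.1 _)).mul (hψ _)
  | succ i ih => exact ((Cv_Tn θ i).mul ih).mul (Cv_Tn θ i)

lemma Cv_word (θ : ℝ) (g : ℕ → ℂ → ℂ) (g0 : ℂ → ℂ) (hg : ∀ u : ℂ, u.re < 0 → Tendsto (fun p => g p u) atTop (𝓝 (g0 u)))
    (φ : ℕ → MvPolynomial (Fin (n+1)) ℝ →ₐ[ℝ] Module.End ℝ (VV n)) (φ0 : MvPolynomial (Fin (n+1)) ℝ →ₐ[ℝ] Module.End ℝ (VV n))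
    (hφ : ∀ p, ∀ i : Fin (n+1), φ p (MvPolynomial.X i) = Xo n (JMF.Tn n θ) (pop (g p)) i)
    (hφ0 : ∀ i : Fin (n+1), φ0 (MvPolynomial.X i) = Xo n (JMF.Tn n θ) (pop g0) i) (k : ℕ → ℕ) (m : ℕ) :
    Cv (fun p => φ p (∏ j ∈ Finset.range m, MvPolynomial.psum (Fin (n+1)) ℝ (k j)))
      (φ0 (∏ j ∈ Finset.range m, MvPolynomial.psum (Fin (n+1)) ℝ (k j))) := by
  induction m with
  | zero => simpa using Cv.one
  | succ m ih =>
    simp only [Finset.prod_range_succ, map_mul]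
    refine ih.mul ?_
    simp only [MvPolynomial.psum, map_sum, map_pow, hφ, hφ0]
    exact Cv.sum fun i _ => (Cv_Xo θ g g0 hg i).pow _
end

lemma torus_tendsto {n : ℕ} {c : Fin n → ℂ} {R : Fin n → ℝ} (hR : ∀ j, 0 ≤ R j) (f : ℕ → (Fin n → ℂ) → ℂ) (f0 : (Fin n → ℂ) → ℂ) (C : ℝ)
    (hc : ∀ p, ContinuousOn (f p) (Tor c R)) (hb : ∀ᶠ p in atTop, ∀ u ∈ Tor c R, ‖f p u‖ ≤ C)
    (hl : ∀ u ∈ Tor c R, Tendsto (fun p => f p u) atTop (𝓝 (f0 u))) :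
    Tendsto (fun p => ∯ u in T(c, R), f p u) atTop (𝓝 (∯ u in T(c, R), f0 u)) := by
  unfold torusIntegral
  refine tendsto_integral_filter_of_dominated_convergence (fun _ => (∏ i, |R i|) * C) ?_ ?_ ?_ ?_
  · refine Eventually.of_forall fun p => ?_
    exact (tor_int hR (hc p)).function_integrable.aestronglyMeasurable
  · filter_upwards [hb] with p hp
    refine Eventually.of_forall fun t => ?_
    have h := hp _ (torusMap_mem c R hR t)
    rw [norm_smul]
    refine mul_le_mul (le_of_eq ?_) h (norm_nonneg _) (Finset.prod_nonneg fun _ _ => abs_nonneg _)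
    rw [norm_prod]
    refine Finset.prod_congr rfl fun i _ => ?_
    rw [norm_mul, norm_mul, norm_I, mul_one, norm_exp_ofReal_mul_I, mul_one, norm_real, Real.norm_eq_abs]
  · rw [← IntegrableOn]
    exact continuousOn_const.integrableOn_compact isCompact_Icc
  · refine Eventually.of_forall fun t => ?_
    exact (hl _ (torusMap_mem c R hR t)).const_smul _

lemma Tor_compact {n : ℕ} (c : Fin n → ℂ) (R : Fin n → ℝ) : IsCompact (Tor c R) := by
  have : Tor c R = Set.univ.pi fun j => Metric.sphere (c j) (R j) := by
    ext u; simp [Tor, dist_eq_norm]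
  rw [this]
  exact isCompact_univ_pi fun j => isCompact_sphere _ _

lemma Fullf_fac (θ : ℝ) (N : ℕ) (ch : ℕ → Bool) (g : ℂ → ℂ) (K : ℕ) (w : ℕ → ℂ) :
    Fullf θ N ch g K w = (∏ b ∈ Finset.Ico 0 K, g (w b)) * Fullf θ N ch (fun _ => 1) K w := by
  unfold Fullf KP
  simp only [Finset.prod_mul_distrib, Finset.prod_const_one, one_mul]
  ring

theorem contour_rat {n : ℕ} {θ : ℝ} (hθ : 0 < θ) (hi : Irrational θ) (A B : ℝ) (hB : 0 ≤ B) (k : ℕ → ℕ) (hk : ∀ i, 0 < k i) (m : ℕ)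
    (g : ℂ → ℂ) (hg : ∀ u, g u = (u - A) / (u - B))
    (φ : MvPolynomial (Fin (n+1)) ℝ →ₐ[ℝ] Module.End ℝ (VV n)) (hφ : ∀ i : Fin (n+1), φ (MvPolynomial.X i) = Xo n (Tn n θ) (pop g) i)
    (ρ : ℕ → ℝ) (hρ0 : ∀ a, a < psm k (m+1) → 0 < ρ a)
    (hρ : ∀ a b, a < b → b < psm k (m+1) → max θ 1 < ρ b - ρ a)
    (hρt : ∀ a, a < psm k (m+1) → ρ a < θ * (n+1 : ℕ) + B) :
    (-θ : ℂ) ^ (m+1) * φ (∏ j ∈ Finset.range (m+1), MvPolynomial.psum (Fin (n+1)) ℝ (k j)) (fun _ => 1) (r0 n θ hθ hi) =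
      (2 * Real.pi * I)⁻¹ ^ (psm k (m+1)) * ∯ y in T(fun _ : Fin (psm k (m+1)) => -((θ * (n+1 : ℕ) : ℝ) : ℂ), fun j : Fin (psm k (m+1)) => ρ j),
        Fullf θ (n+1) (chn k) g (psm k (m+1)) (exv (psm k (m+1)) y 0) := by
  obtain ⟨G, hGd, hG⟩ := approx A B
  have hlim1 : Tendsto (fun p : ℕ => 1 / ((p:ℝ)+1)) atTop (𝓝 0) := tendsto_one_div_add_atTop_nhds_zero_nat
  have hpt : ∀ u : ℂ, (∀ᶠ p : ℕ in atTop, ‖u + p‖ ≤ p + B - 1 / ((p:ℝ)+1)) → Tendsto (fun p => G p u) atTop (𝓝 (g u)) := by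
    intro u hu
    rw [tendsto_iff_norm_sub_tendsto_zero]
    refine squeeze_zero' (Eventually.of_forall fun _ => norm_nonneg _) ?_ hlim1
    filter_upwards [hu] with p hp
    rw [hg]; exact hG p u hp
  have hre : ∀ u : ℂ, u.re < 0 → ∀ᶠ p : ℕ in atTop, ‖u + p‖ ≤ p + B - 1 / ((p:ℝ)+1) := by
    intro u hu
    obtain ⟨P, hP⟩ := exists_nat_gt ((‖u‖^2 + 2) / (2 * (-u.re)))
    filter_upwards [eventually_ge_atTop (max P 1)] with p hp
    have hp1 : (1:ℝ) ≤ p := by exact_mod_cast (le_max_right P 1).trans hp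
    have hpP : (P:ℝ) ≤ p := by exact_mod_cast (le_max_left P 1).trans hp
    have h1 : ‖u‖^2 + 2 < p * (2 * (-u.re)) := by
      rw [← div_lt_iff₀ (by linarith)]; linarith
    have he : 1 / ((p:ℝ)+1) ≤ 1 := by rw [div_le_one (by positivity)]; linarith
    have he0 : 0 < 1 / ((p:ℝ)+1) := by positivity
    have he2 : p * (1 / ((p:ℝ)+1)) ≤ 1 := by rw [mul_one_div, div_le_one (by positivity)]; linarith
    have h2 : ‖u + p‖ ≤ p - 1 / ((p:ℝ)+1) := by
      refine abs_le_of_sq_le_sq' ?_ (by linarith) |>.2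
      have h3 : ‖u + p‖^2 = ‖u‖^2 + 2 * p * u.re + p^2 := by
        rw [← normSq_eq_norm_sq, ← normSq_eq_norm_sq, normSq_apply, normSq_apply]
        simp; ring
      rw [h3]
      nlinarith
    linarith
  choose ψ hψ using fun p => exists_ev (fun i : Fin (n+1) => Xo n (Tn n θ) (pop (G p)) i)
    (fun i j => (model (n := n) θ (G p)).L5 i j (by omega) (by omega))
  have hL : Tendsto (fun p => (-θ : ℂ) ^ (m+1) * ψ p (∏ j ∈ Finset.range (m+1), MvPolynomial.psum (Fin (n+1)) ℝ (k j)) (fun _ => 1) (r0 n θ hθ hi)) atTop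
      (𝓝 ((-θ : ℂ) ^ (m+1) * φ (∏ j ∈ Finset.range (m+1), MvPolynomial.psum (Fin (n+1)) ℝ (k j)) (fun _ => 1) (r0 n θ hθ hi))) := by
    refine Tendsto.const_mul _ ?_
    exact Cv_word θ G g (fun u hu => hpt u (hre u hu)) ψ φ hψ hφ k (m+1) (fun _ _ => 1) (fun _ => 1) (fun r => tendsto_const_nhds) _
  refine tendsto_nhds_unique hL ?_
  simp only [fun p => contour_small hθ hi (G p) (hGd p) k hk m (ψ p) (hψ p) ρ hρ0 hρ]
  refine Tendsto.const_mul _ ?_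
  have hch : chn k (psm k (m+1) - 1) = false := chn_end k (m+1) _ (by
    rw [psm_succ]; have := hk m; omega)
  generalize hKt : psm k (m+1) = Kt at *
  set s : ℝ := θ * (n+1 : ℕ) with hs
  have hs0 : 0 < s := by positivity
  set c : ℂ := -((s : ℝ) : ℂ) with hc
  have hball : ∀ᶠ p : ℕ in atTop, ∀ b < Kt, ∀ u : ℂ, ‖u - c‖ = ρ b → ‖u + p‖ ≤ p + B - 1 / ((p:ℝ)+1) := by
    have h1 : ∀ b ∈ Finset.range Kt, ∀ᶠ p : ℕ in atTop, 1 / ((p:ℝ)+1) < s + B - ρ b := by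
      intro b hb
      have := hρt b (Finset.mem_range.1 hb)
      exact hlim1.eventually_lt_const (by linarith)
    obtain ⟨P, hP⟩ := exists_nat_gt s
    filter_upwards [(Filter.eventually_all_finset _).2 h1, eventually_ge_atTop P] with p hp hpP b hb u hu
    have hpP' : (P:ℝ) ≤ p := by exact_mod_cast hpP
    have h2 := hp b (Finset.mem_range.2 hb)
    have h3 : u + p = (u - c) + ((p - s : ℝ) : ℂ) := by rw [hc]; push_cast; ring
    rw [h3]
    refine (norm_add_le _ _).trans ?_
    rw [hu, norm_real, Real.norm_eq_abs, abs_of_nonneg (by linarith)]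
    linarith
  have hR0 : ∀ j : Fin Kt, 0 ≤ ρ j := fun j => (hρ0 j j.2).le
  have hdiff : ∀ h : ℂ → ℂ, ∀ y ∈ Tor (fun _ : Fin Kt => c) (fun j : Fin Kt => ρ j), (∀ j, DifferentiableAt ℂ h (y j)) →
      DifferentiableAt ℂ (fun y => Fullf θ (n+1) (chn k) h Kt (exv Kt y 0)) y := by
    intro h y hy hh
    refine Fullf_diff hθ (n+1) (chn k) h Kt hch 0 y ?_ ?_ hh
    · intro j; have := hy j; beta_reduce at this; rw [← hs, ← hc, this]; exact hρ0 j j.2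
    · intro a b hab
      have h1 := hy a
      have h2 := hy b
      beta_reduce at h1 h2
      rw [← hs, ← hc, h1, h2]; exact hρ a b hab b.2
  have hgd : ∀ y ∈ Tor (fun _ : Fin Kt => c) (fun j : Fin Kt => ρ j), ∀ j, DifferentiableAt ℂ g (y j) := by
    intro y hy j
    have hne : y j - B ≠ 0 := by
      intro h0
      have h1 := hy j
      beta_reduce at h1
      rw [sub_eq_zero.1 h0, hc, show (B:ℂ) - -(s:ℂ) = ((s + B : ℝ) : ℂ) by push_cast; ring, norm_real, Real.norm_eq_abs,
        abs_of_nonneg (by linarith)] at h1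
      have := hρt j j.2
      linarith
    have : g = fun u : ℂ => (u - A) / (u - B) := funext hg
    rw [this]
    exact ((differentiableAt_id.sub_const _).div (differentiableAt_id.sub_const _) hne)
  have hcont1 : ContinuousOn (fun y => Fullf θ (n+1) (chn k) (fun _ => 1) Kt (exv Kt y 0)) (Tor (fun _ : Fin Kt => c) (fun j : Fin Kt => ρ j)) :=
    fun y hy => (hdiff _ y hy fun j => differentiableAt_const _).continuousAt.continuousWithinAt
  obtain ⟨C1, hC1⟩ := (Tor_compact _ _).exists_bound_of_continuousOn hcont1
  have hcontg : ∀ j : Fin Kt, ContinuousOn (fun y : Fin Kt → ℂ => g (y j)) (Tor (fun _ : Fin Kt => c) (fun j : Fin Kt => ρ j)) :=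
    fun j y hy => (ContinuousAt.comp (f := fun y : Fin Kt → ℂ => y j) (g := g) (hgd y hy j).continuousAt (continuous_apply j).continuousAt).continuousWithinAt
  choose C2 hC2 using fun j => (Tor_compact _ _).exists_bound_of_continuousOn (hcontg j)
  have hexv : ∀ y : Fin Kt → ℂ, ∀ h : ℂ → ℂ, ∏ b ∈ Finset.Ico 0 Kt, h (exv Kt y 0 b) = ∏ j : Fin Kt, h (y j) := by
    intro y h
    rw [← Finset.range_eq_Ico, Finset.prod_range]
    refine Finset.prod_congr rfl fun j _ => ?_
    rw [exv, dif_pos j.2]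
  refine torus_tendsto hR0 _ _ ((∏ j, (1 + C2 j)) * C1) ?_ ?_ ?_
  · intro p y hy
    exact (hdiff _ y hy fun j => hGd p _).continuousAt.continuousWithinAt
  · filter_upwards [hball] with p hp y hy
    rw [Fullf_fac, hexv, norm_mul, norm_prod]
    refine mul_le_mul ?_ (hC1 y hy) (norm_nonneg _) (Finset.prod_nonneg fun j _ => ?_)
    · refine Finset.prod_le_prod (fun _ _ => norm_nonneg _) fun j _ => ?_
      have h1 := hG p (y j) (hp j j.2 (y j) (hy j))
      rw [← hg] at h1
      have h2 := hC2 j y hy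
      have h3 : ‖G p (y j)‖ ≤ ‖G p (y j) - g (y j)‖ + ‖g (y j)‖ := by
        simpa using norm_add_le (G p (y j) - g (y j)) (g (y j))
      have he : 1 / ((p:ℝ)+1) ≤ 1 := by
        rw [div_le_one (by positivity)]; have : (0:ℝ) ≤ p := by positivity
        linarith
      linarith
    · have := (norm_nonneg _).trans (hC2 j y hy); linarith
  · intro y hy
    have e : ∀ h : ℂ → ℂ, Fullf θ (n+1) (chn k) h Kt (exv Kt y 0) = (∏ j : Fin Kt, h (y j)) * Fullf θ (n+1) (chn k) (fun _ => 1) Kt (exv Kt y 0) := by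
      intro h
      rw [Fullf_fac, hexv]
    rw [e g]
    refine Tendsto.congr (fun p => (e (G p)).symm) ?_
    refine Tendsto.mul_const _ (tendsto_finsetProd _ fun j _ => hpt _ ?_)
    filter_upwards [hball] with p hp
    exact hp j j.2 _ (hy j)

/-- Moment formula for irrational `θ`. -/
theorem moment_irr (n : ℕ) (θ α : ℝ) (hθ : 0 < θ) (hi : Irrational θ) (hα : 0 < α) (M : ℕ) (hM : n + 1 ≤ M)
    (k : ℕ → ℕ) (hk : ∀ i, 0 < k i) (m : ℕ)
    (ρ : ℕ → ℝ) (hρ0 : ∀ a, a < psm k (m+1) → 0 < ρ a)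
    (hρ : ∀ a b, a < b → b < psm k (m+1) → max θ 1 < ρ b - ρ a)
    (hρt : ∀ a, a < psm k (m+1) → ρ a < θ * (n+1 : ℕ) + θ * (α + M - 1)) :
    (-θ : ℂ) ^ (m+1) * ((∫ y, ∏ i ∈ Finset.range (m+1), ∑ j : Fin (n+1), (y j) ^ (k i) ∂ jacobiEnsemble θ α M (n+1) : ℝ) : ℂ) =
      (2 * Real.pi * I)⁻¹ ^ (psm k (m+1)) * ∯ y in T(fun _ : Fin (psm k (m+1)) => -((θ * (n+1 : ℕ) : ℝ) : ℂ), fun j : Fin (psm k (m+1)) => ρ j),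
        Fullf θ (n+1) (chn k) (fun u => (u - θ * (α - 1)) / (u - θ * (α + M - 1))) (psm k (m+1)) (exv (psm k (m+1)) y 0) := by
  have hM1 : (1:ℝ) ≤ M := by
    have : 1 ≤ M := by omega
    exact_mod_cast this
  have hB : 0 ≤ θ * (α + M - 1) := mul_nonneg hθ.le (by linarith)
  have hg : ∀ u : ℂ, (fun u : ℂ => (u - θ * (α - 1)) / (u - θ * (α + M - 1))) u = (u - (θ * (α - 1) : ℝ)) / (u - (θ * (α + M - 1) : ℝ)) := by
    intro u; push_cast; rfl
  obtain ⟨φ, L, hφ, hL, hL1, hLoop, hS⟩ := algebraic_functional n θ hθ hi (θ * (α - 1)) (θ * (α + M - 1)) hB _ hg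
  have h1 := expect_poly n θ α hθ hα M hM L hL1 hS hLoop (∏ j ∈ Finset.range (m+1), MvPolynomial.psum (Fin (n+1)) ℝ (k j))
  simp only [map_prod, MvPolynomial.psum, map_sum, map_pow, MvPolynomial.eval_X] at h1
  rw [h1, hL, ← contour_rat hθ hi _ _ hB k hk m _ hg φ hφ ρ hρ0 hρ hρt]
  simp only [MvPolynomial.psum]

end JMF

namespace JMF
open MeasureTheory Complex Ug Filter Topology

lemma VE_le_one (θ : ℝ) (hθ : 0 < θ) {n : ℕ} (x : Fin n → ℝ)
    (hx : ∀ i, x i ∈ Set.Ioo (0:ℝ) 1) : VE θ 0 x ≤ 1 := by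
  refine Finset.prod_le_one (fun i _ => Finset.prod_nonneg fun j _ => ?_) fun i _ =>
    Finset.prod_le_one (fun j _ => ?_) fun j _ => ?_
  · split_ifs <;> positivity
  · split_ifs <;> positivity
  · split_ifs
    · have h1 := hx i
      have h2 := hx j
      refine Real.rpow_le_one (by positivity) ?_ hθ.le
      rw [add_zero, sq_le_one_iff_abs_le_one, abs_le]
      constructor <;> linarith [h1.1, h1.2, h2.1, h2.2]
    · exact le_rfl

lemma VE_tend (θ : ℝ) (hθ : 0 < θ) {n : ℕ} (x : Fin n → ℝ) : Tendsto (fun t => VE t 0 x) (𝓝 θ) (𝓝 (VE θ 0 x)) := by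
  unfold VE
  refine tendsto_finsetProd _ fun i _ => tendsto_finsetProd _ fun j _ => ?_
  split_ifs
  · exact Real.continuousAt_const_rpow' hθ.ne'
  · exact tendsto_const_nhds

lemma w1_tend (a b t : ℝ) (l : Filter ℝ) (A B : ℝ → ℝ) (hA : Tendsto A l (𝓝 a)) (hB : Tendsto B l (𝓝 b)) (ht : t ∈ Set.Ioo (0:ℝ) 1) :
    Tendsto (fun s => w1 (A s) (B s) t) l (𝓝 (w1 a b t)) := by
  unfold w1
  refine Tendsto.mul ?_ ?_
  · exact (Real.continuousAt_const_rpow (by linarith [ht.1] : t ≠ 0)).tendsto.comp hA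
  · exact (Real.continuousAt_const_rpow (by linarith [ht.2] : 1 - t ≠ 0)).tendsto.comp hB

lemma w1_mono (a b a' b' t : ℝ) (ha : a' ≤ a) (hb : b' ≤ b) (ht : t ∈ Set.Ioo (0:ℝ) 1) : w1 a b t ≤ w1 a' b' t := by
  unfold w1
  have h1 : 0 < 1 - t := by linarith [ht.2]
  have h0 := ht.1
  refine mul_le_mul ?_ ?_ (by positivity) (by positivity)
  · exact Real.rpow_le_rpow_of_exponent_ge ht.1 ht.2.le ha
  · exact Real.rpow_le_rpow_of_exponent_ge h1 (by linarith [ht.1]) hb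

lemma int_tend (n : ℕ) (θ α D : ℝ) (hθ : 0 < θ) (hα : 0 < α) (hD : 0 ≤ D) (f : (Fin n → ℝ) → ℝ) (hf : Continuous f) :
    Tendsto (fun s => ∫ x, f x * VE s 0 x * wN n (s*α-1) (s * D + s - 1) x ∂(muN n)) (𝓝 θ)
      (𝓝 (∫ x, f x * VE θ 0 x * wN n (θ*α-1) (θ * D + θ - 1) x ∂(muN n))) := by
  have hpos : ∀ᶠ s in 𝓝 θ, θ/2 < s := eventually_gt_nhds (by linarith)
  have ha0 : -1 < (θ/2)*α-1 := by have : 0 < (θ/2)*α := by positivity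
                                  linarith
  have hb0 : -1 < (θ/2) * D + θ/2 - 1 := by have : 0 ≤ (θ/2)*D := by positivity
                                            linarith
  refine tendsto_integral_filter_of_dominated_convergence (fun x => |f x| * wN n ((θ/2)*α-1) ((θ/2) * D + θ/2 - 1) x) ?_ ?_ ?_ ?_
  · filter_upwards [hpos] with s hs
    have hs0 : 0 < s := by linarith
    have : 0 < s * α := by positivity
    have : 0 ≤ s * D := by positivity
    exact (int_bdd n _ _ (by linarith) (by linarith) _ (hf.mul (VE_cont s 0 hs0))).aestronglyMeasurable
  · filter_upwards [hpos] with s hs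
    filter_upwards [muN_mem n] with x hx
    have hs0 : 0 < s := by linarith
    have hw : 0 ≤ wN n (s*α-1) (s * D + s - 1) x := by
      refine Finset.prod_nonneg fun i _ => ?_
      have h0 := (hx i).1
      have h1 : 0 < 1 - x i := by linarith [(hx i).2]
      unfold w1; positivity
    rw [norm_mul, norm_mul, Real.norm_eq_abs, Real.norm_eq_abs, Real.norm_eq_abs, abs_of_nonneg (VE_nonneg s 0 le_rfl x),
      abs_of_nonneg hw, mul_assoc]
    refine mul_le_mul_of_nonneg_left ?_ (abs_nonneg _)
    calc _ ≤ 1 * wN n (s*α-1) (s * D + s - 1) x := mul_le_mul_of_nonneg_right (VE_le_one s hs0 x hx) hw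
      _ ≤ _ := by
        rw [one_mul]
        refine Finset.prod_le_prod (fun i _ => ?_) fun i _ => ?_
        · have h0 := (hx i).1
          have h1 : 0 < 1 - x i := by linarith [(hx i).2]
          unfold w1; positivity
        · refine w1_mono _ _ _ _ _ ?_ ?_ (hx i)
          · have := mul_le_mul_of_nonneg_right hs.le hα.le; linarith
          · have := mul_le_mul_of_nonneg_right hs.le hD; linarith
  · exact int_bdd n _ _ ha0 hb0 _ hf.abs
  · filter_upwards [muN_mem n] with x hx
    refine ((VE_tend θ hθ x).const_mul _).mul ?_
    refine tendsto_finsetProd _ fun i _ => w1_tend _ _ _ _ _ _ ?_ ?_ (hx i)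
    · exact Continuous.tendsto (by fun_prop : Continuous fun s : ℝ => s * α - 1) θ
    · exact Continuous.tendsto (by fun_prop : Continuous fun s : ℝ => s * D + s - 1) θ

lemma expect_tend (n : ℕ) (θ α : ℝ) (hθ : 0 < θ) (hα : 0 < α) (M : ℕ) (hM : n + 1 ≤ M) (f : (Fin (n+1) → ℝ) → ℝ) (hf : Continuous f) :
    Tendsto (fun s => ∫ y, f y ∂ jacobiEnsemble s α M (n+1)) (𝓝 θ) (𝓝 (∫ y, f y ∂ jacobiEnsemble θ α M (n+1))) := by
  have hM' : 0 ≤ (M:ℝ) - ((n+1 : ℕ) : ℝ) := by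
    have : ((n+1 : ℕ) : ℝ) ≤ M := by exact_mod_cast hM
    linarith
  have hab : ∀ s, 0 < s → -1 < s*α-1 ∧ -1 < s * ((M : ℝ) - ((n+1 : ℕ) : ℝ)) + s - 1 := by
    intro s hs
    have h1 : 0 < s * α := by positivity
    have := mul_nonneg hs.le hM'
    constructor <;> linarith
  have h1 := int_tend (n+1) θ α _ hθ hα hM' f hf
  have h2 := int_tend (n+1) θ α _ hθ hα hM' (fun _ => 1) continuous_const
  simp only [one_mul] at h2
  rw [expect_eq n θ α hθ M (hab θ hθ).1 (hab θ hθ).2]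
  refine ((h2.inv₀ (Z_pos n θ _ _ hθ (hab θ hθ).1 (hab θ hθ).2).ne').mul h1).congr' ?_
  filter_upwards [eventually_gt_nhds hθ] with s hs
  rw [expect_eq n s α hs M (hab s hs).1 (hab s hs).2]

lemma torus_param {K : ℕ} (t : Set ℝ) (ht : IsOpen t) (N : ℕ) (ρ : Fin K → ℝ) (F : ℝ → (Fin K → ℂ) → ℂ)
    (hF : Continuous fun p : t × (Fin K → ℝ) => F p.1 (torusMap (fun _ => -((p.1.1 * N : ℝ) : ℂ)) ρ p.2)) (θ : ℝ) (hθ : θ ∈ t) :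
    Tendsto (fun s : ℝ => ∯ y in T(fun _ => -((s * N : ℝ) : ℂ), ρ), F s y) (𝓝 θ) (𝓝 (∯ y in T(fun _ => -((θ * N : ℝ) : ℂ), ρ), F θ y)) := by
  have : LocallyCompactSpace t := ht.locallyCompactSpace
  have h : Continuous fun s : t => ∯ y in T(fun _ => -((s.1 * N : ℝ) : ℂ), ρ), F s y := by
    unfold torusIntegral
    refine continuous_parametric_integral_of_continuous (f := fun (s : t) (x : Fin K → ℝ) =>
      (∏ i, (ρ i * exp (x i * I) * I : ℂ)) • F s (torusMap (fun _ => -((s.1 * N : ℝ) : ℂ)) ρ x)) ?_ isCompact_Icc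
    have h0 : Continuous fun p : t × (Fin K → ℝ) => (∏ i, (ρ i * exp (p.2 i * I) * I : ℂ)) := by fun_prop
    exact h0.mul hF
  have h2 : ContinuousOn (fun s : ℝ => ∯ y in T(fun _ => -((s * N : ℝ) : ℂ), ρ), F s y) t := by
    rw [continuousOn_iff_continuous_domRestrict]; exact h
  exact (h2.continuousAt (ht.mem_nhds hθ)).tendsto

theorem moment_all (n : ℕ) (θ α : ℝ) (hθ : 0 < θ) (hα : 0 < α) (M : ℕ) (hM : n + 1 ≤ M)
    (k : ℕ → ℕ) (hk : ∀ i, 0 < k i) (m : ℕ)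
    (ρ : ℕ → ℝ) (hρ0 : ∀ a, a < psm k (m+1) → 0 < ρ a)
    (hρ : ∀ a b, a < b → b < psm k (m+1) → max θ 1 < ρ b - ρ a)
    (hρt : ∀ a, a < psm k (m+1) → ρ a < θ * (n+1 : ℕ) + θ * (α + M - 1)) :
    (-θ : ℂ) ^ (m+1) * ((∫ y, ∏ i ∈ Finset.range (m+1), ∑ j : Fin (n+1), (y j) ^ (k i) ∂ jacobiEnsemble θ α M (n+1) : ℝ) : ℂ) =
      (2 * Real.pi * I)⁻¹ ^ (psm k (m+1)) * ∯ y in T(fun _ : Fin (psm k (m+1)) => -((θ * (n+1 : ℕ) : ℝ) : ℂ), fun j : Fin (psm k (m+1)) => ρ j),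
        Fullf θ (n+1) (chn k) (fun u => (u - θ * (α - 1)) / (u - θ * (α + M - 1))) (psm k (m+1)) (exv (psm k (m+1)) y 0) := by
  have hev : ∀ᶠ s in 𝓝 θ, 0 < s ∧ (∀ b ∈ Finset.range (psm k (m+1)), ∀ a ∈ Finset.range b, max s 1 < ρ b - ρ a) ∧
      ∀ a ∈ Finset.range (psm k (m+1)), ρ a < s * (n+1 : ℕ) + s * (α + M - 1) := by
    refine (eventually_gt_nhds hθ).and (Eventually.and ?_ ?_)
    · refine (eventually_all_finset _).2 fun b hb => (eventually_all_finset _).2 fun a ha => ?_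
      exact (Continuous.tendsto (by fun_prop : Continuous fun s : ℝ => max s 1) θ).eventually_lt_const
        (hρ a b (Finset.mem_range.1 ha) (Finset.mem_range.1 hb))
    · refine (eventually_all_finset _).2 fun a ha => ?_
      exact (Continuous.tendsto (by fun_prop : Continuous fun s : ℝ => s * (n+1 : ℕ) + s * (α + M - 1)) θ).eventually_const_lt
        (hρt a (Finset.mem_range.1 ha))
  obtain ⟨t, ht, hto, hθt⟩ := eventually_nhds_iff.1 hev
  have hM1 : (1:ℝ) ≤ M := by
    have : 1 ≤ M := by omega
    exact_mod_cast this
  have hne : (𝓝[{x | Irrational x}] θ).NeBot := mem_closure_iff_nhdsWithin_neBot.1 (dense_irrational θ)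
  have hL : Tendsto (fun s : ℝ => (-s : ℂ) ^ (m+1) * ((∫ y, ∏ i ∈ Finset.range (m+1), ∑ j : Fin (n+1), (y j) ^ (k i) ∂ jacobiEnsemble s α M (n+1) : ℝ) : ℂ)) (𝓝 θ)
      (𝓝 ((-θ : ℂ) ^ (m+1) * ((∫ y, ∏ i ∈ Finset.range (m+1), ∑ j : Fin (n+1), (y j) ^ (k i) ∂ jacobiEnsemble θ α M (n+1) : ℝ) : ℂ))) := by
    refine Tendsto.mul (Continuous.tendsto (by fun_prop : Continuous fun s : ℝ => (-s : ℂ) ^ (m+1)) θ) ?_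
    refine (continuous_ofReal.tendsto _).comp ?_
    exact expect_tend n θ α hθ hα M hM _ (by fun_prop)
  refine tendsto_nhds_unique (hL.mono_left (nhdsWithin_le_nhds (s := {x | Irrational x}))) ?_
  have hR : Tendsto (fun s : ℝ => (2 * Real.pi * I)⁻¹ ^ (psm k (m+1)) * ∯ y in T(fun _ : Fin (psm k (m+1)) => -((s * (n+1 : ℕ) : ℝ) : ℂ), fun j : Fin (psm k (m+1)) => ρ j),
        Fullf s (n+1) (chn k) (fun u => (u - s * (α - 1)) / (u - s * (α + M - 1))) (psm k (m+1)) (exv (psm k (m+1)) y 0)) (𝓝 θ)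
      (𝓝 ((2 * Real.pi * I)⁻¹ ^ (psm k (m+1)) * ∯ y in T(fun _ : Fin (psm k (m+1)) => -((θ * (n+1 : ℕ) : ℝ) : ℂ), fun j : Fin (psm k (m+1)) => ρ j),
        Fullf θ (n+1) (chn k) (fun u => (u - θ * (α - 1)) / (u - θ * (α + M - 1))) (psm k (m+1)) (exv (psm k (m+1)) y 0))) := by
    refine Tendsto.const_mul _ ?_
    have hch : chn k (psm k (m+1) - 1) = false := chn_end k (m+1) _ (by
      rw [psm_succ]; have := hk m; omega)
    generalize hKt : psm k (m+1) = Kt at *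
    refine torus_param t hto (n+1) (fun j : Fin Kt => ρ j) (fun s y => Fullf s (n+1) (chn k) (fun u => (u - s * (α - 1)) / (u - s * (α + M - 1))) Kt (exv Kt y 0)) ?_ θ hθt
    have hc : ∀ b, Continuous (fun p : t × (Fin Kt → ℝ) => exv Kt (torusMap (fun _ => -((p.1.1 * (n+1:ℕ) : ℝ) : ℂ)) (fun j : Fin Kt => ρ j) p.2) 0 b) := by
      intro b
      unfold exv torusMap
      split_ifs <;> fun_prop
    have hnorm : ∀ p : t × (Fin Kt → ℝ), ∀ b, b < Kt → ‖exv Kt (torusMap (fun _ => -((p.1.1 * (n+1:ℕ) : ℝ) : ℂ)) (fun j : Fin Kt => ρ j) p.2) 0 b - -((p.1.1 * (n+1:ℕ) : ℝ) : ℂ)‖ = ρ b := by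
      intro p b hb
      rw [exv, dif_pos hb]
      exact torusMap_mem _ _ (fun j => (hρ0 j j.2).le) p.2 ⟨b, hb⟩
    have hs : Continuous (fun p : t × (Fin Kt → ℝ) => ((p.1.1 : ℝ) : ℂ)) := by fun_prop
    generalize hU : (fun (p : t × (Fin Kt → ℝ)) => exv Kt (torusMap (fun _ => -((p.1.1 * (n+1:ℕ) : ℝ) : ℂ)) (fun j : Fin Kt => ρ j) p.2) 0) = U at *
    have hUp : ∀ p, exv Kt (torusMap (fun _ => -((p.1.1 * (n+1:ℕ) : ℝ) : ℂ)) (fun j : Fin Kt => ρ j) p.2) 0 = U p := fun p => congrFun hU p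
    simp only [hUp] at hc hnorm ⊢
    have far : ∀ p : t × (Fin Kt → ℝ), ∀ a b, a < b → b < Kt → U p b - U p a ≠ 0 ∧ U p b - U p a + 1 ≠ 0 ∧ U p b - U p a - (p.1.1 : ℝ) ≠ 0 ∧ U p b - U p a + 1 - (p.1.1 : ℝ) ≠ 0 := by
      intro p a b hab hb
      obtain ⟨h1, h2, h3⟩ := ht p.1.1 p.1.2
      refine mem_far (c := -((p.1.1 * (n+1:ℕ) : ℝ) : ℂ)) h1 le_rfl rfl ?_
      rw [hnorm p b hb, hnorm p a (by omega)]
      exact h2 b (Finset.mem_range.2 hb) a (Finset.mem_range.2 hab)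
    unfold Fullf KP
    refine Continuous.mul ?_ ?_
    · refine continuous_finsetProd _ fun b hb => ?_
      rw [Finset.mem_Ico] at hb
      refine Continuous.mul (Continuous.mul ?_ ?_) ?_
      · refine Continuous.div ((hc b).sub (hs.mul continuous_const)) ((hc b).sub (hs.mul continuous_const)) fun p h0 => ?_
        obtain ⟨h1, h2, h3⟩ := ht p.1.1 p.1.2
        have h4 := hnorm p b hb.2
        rw [sub_eq_zero.1 h0, show (p.1.1 : ℂ) * (α + M - 1) - -((p.1.1 * (n+1:ℕ) : ℝ) : ℂ) = ((p.1.1 * (n+1:ℕ) + p.1.1 * (α + M - 1) : ℝ) : ℂ) by push_cast; ring,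
          norm_real, Real.norm_eq_abs] at h4
        have h5 := h3 b (Finset.mem_range.2 hb.2)
        have h6 := le_abs_self (p.1.1 * ((n+1:ℕ):ℝ) + p.1.1 * (α + M - 1))
        linarith
      · unfold kap
        split_ifs with h
        · have : b + 1 < Kt := by
            by_contra hc
            have : b = Kt - 1 := by omega
            rw [this, hch] at h; exact absurd h (by simp)
          exact Continuous.inv₀ ((((hc (b+1)).sub (hc b)).add continuous_const).sub hs) fun p => (far p b (b+1) (by omega) this).2.2.2
        · exact continuous_const
      · refine continuous_finsetProd _ fun q hq => ?_
        rw [Finset.mem_Ico] at hq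
        unfold crossF
        have hd := (hc q).sub (hc b)
        exact Continuous.div (hd.mul ((hd.add continuous_const).sub hs)) ((hd.add continuous_const).mul (hd.sub hs))
          fun p => mul_ne_zero (far p b q (by omega) hq.2).2.1 (far p b q (by omega) hq.2).2.2.1
    · refine continuous_finsetProd _ fun b hb => ?_
      rw [Finset.mem_Ico] at hb
      refine Continuous.div (hc b) ((hc b).add (hs.mul continuous_const)) fun p h0 => ?_
      have h4 := hnorm p b hb.2
      rw [show U p b - -((p.1.1 * (n+1:ℕ) : ℝ) : ℂ) = U p b + (p.1.1 : ℂ) * (n+1:ℕ) by push_cast; ring, h0, norm_zero] at h4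
      have := hρ0 b hb.2
      linarith
  refine (hR.mono_left (nhdsWithin_le_nhds (s := {x | Irrational x}))).congr' ?_
  filter_upwards [self_mem_nhdsWithin, nhdsWithin_le_nhds hev] with s hsi hs
  obtain ⟨h1, h2, h3⟩ := hs
  exact (moment_irr n s α h1 hsi hα M hM k hk m ρ hρ0 (fun a b hab hb => h2 b (Finset.mem_range.2 hb) a (Finset.mem_range.2 hab))
    (fun a ha => h3 a (Finset.mem_range.2 ha))).symm

end JMF

namespace JMF
open MeasureTheory Complex

/-- extension of the exponents -/
def kx {m : ℕ} (k : Fin (m+1) → ℕ) (i : ℕ) : ℕ := if h : i < m + 1 then k ⟨i, h⟩ else 1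

section
variable {m : ℕ} (k : Fin (m+1) → ℕ)

lemma kx_val (i : Fin (m+1)) : kx k i = k i := dif_pos i.2

lemma psm_kx : ∑ i, k i = psm (kx k) (m+1) := by
  rw [psm, Finset.sum_range]
  exact Finset.sum_congr rfl fun i _ => (kx_val k i).symm

/-- the lexicographic enumeration -/
def eqv : ((i : Fin (m+1)) × Fin (k i)) ≃ Fin (psm (kx k) (m+1)) := finSigmaFinEquiv.trans (finCongr (psm_kx k))

lemma eqv_val (p : (i : Fin (m+1)) × Fin (k i)) : (eqv k p : ℕ) = psm (kx k) p.1 + p.2 := by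
  rw [eqv, Equiv.trans_apply, finCongr_apply_coe, finSigmaFinEquiv_apply, psm, Finset.sum_range]
  congr 1
  refine Finset.sum_congr rfl fun i _ => ?_
  have := kx_val k (Fin.castLE p.1.2.le i)
  rw [← this]; rfl

lemma eqv_lex (hk : ∀ i, 0 < k i) (p q : (i : Fin (m+1)) × Fin (k i)) : lexLt p q ↔ (eqv k p : ℕ) < eqv k q := by
  have hkx : ∀ i, 0 < kx k i := by
    intro i; unfold kx; split_ifs
    · exact hk _
    · exact one_pos
  have h1 : ∀ p q : (i : Fin (m+1)) × Fin (k i), p.1 < q.1 → (eqv k p : ℕ) < eqv k q := by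
    intro p q h
    rw [eqv_val, eqv_val]
    have h2 : psm (kx k) (p.1 + 1) ≤ psm (kx k) q.1 := (psm_mono _ hkx).monotone (Fin.lt_def.1 h)
    rw [psm_succ, kx_val] at h2
    have := p.2.2
    omega
  constructor
  · rintro (h | ⟨h, h'⟩)
    · exact h1 p q h
    · have e : psm (kx k) p.1 = psm (kx k) q.1 := by rw [h]
      rw [eqv_val, eqv_val]; omega
  · intro h
    rcases lt_trichotomy p.1 q.1 with h2 | h2 | h2
    · exact Or.inl h2
    · refine Or.inr ⟨h2, ?_⟩
      have e : psm (kx k) p.1 = psm (kx k) q.1 := by rw [h2]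
      rw [eqv_val, eqv_val] at h; omega
    · have := h1 q p h2; omega

lemma prod_eqv (h : ℕ → ℂ) : ∏ b ∈ Finset.Ico 0 (psm (kx k) (m+1)), h b = ∏ p, h (eqv k p) := by
  rw [← Finset.range_eq_Ico, Finset.prod_range, ← Equiv.prod_comp (eqv k)]

lemma cross_eqv (hk : ∀ i, 0 < k i) (C : ((i : Fin (m+1)) × Fin (k i)) → ((i : Fin (m+1)) × Fin (k i)) → ℂ) (D : ℕ → ℕ → ℂ)
    (hCD : ∀ p q, D (eqv k p) (eqv k q) = C p q) :
    ∏ b ∈ Finset.Ico 0 (psm (kx k) (m+1)), ∏ q ∈ Finset.Ico (b+1) (psm (kx k) (m+1)), D b q =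
      (∏ q : (i : Fin (m + 1)) × Fin (k i), ∏ p ∈ Finset.univ.filter (fun p : (i : Fin (m + 1)) × Fin (k i) => p.1 < q.1), C p q) *
      ∏ i : Fin (m + 1), ∏ b : Fin (k i), ∏ a ∈ Finset.univ.filter (fun a : Fin (k i) => a < b), C ⟨i, a⟩ ⟨i, b⟩ := by
  classical
  have e1 : ∀ b, ∏ q ∈ Finset.Ico (b+1) (psm (kx k) (m+1)), D b q = ∏ q ∈ Finset.Ico 0 (psm (kx k) (m+1)), if b < q then D b q else 1 := by
    intro b
    rw [← Finset.prod_filter]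
    refine Finset.prod_congr ?_ fun _ _ => rfl
    ext q; simp only [Finset.mem_Ico, Finset.mem_filter]; omega
  have e2 : ∏ i : Fin (m + 1), ∏ b : Fin (k i), ∏ a ∈ Finset.univ.filter (fun a : Fin (k i) => a < b), C ⟨i, a⟩ ⟨i, b⟩
      = ∏ q : (i : Fin (m + 1)) × Fin (k i), ∏ p : (i : Fin (m + 1)) × Fin (k i), if (p.1 = q.1 ∧ (p.2 : ℕ) < (q.2 : ℕ)) then C p q else 1 := by
    rw [Fintype.prod_sigma]
    refine Finset.prod_congr rfl fun i _ => Finset.prod_congr rfl fun b _ => ?_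
    rw [Fintype.prod_sigma, Finset.prod_eq_single i]
    · rw [Finset.prod_filter]
      refine Finset.prod_congr rfl fun a _ => ?_
      simp
    · intro j _ hj
      refine Finset.prod_eq_one fun a _ => ?_
      rw [if_neg]; rintro ⟨h, _⟩; exact hj h
    · simp
  rw [e2, ← Finset.prod_mul_distrib]
  simp only [e1]
  rw [Finset.prod_comm, prod_eqv]
  refine Finset.prod_congr rfl fun q _ => ?_
  rw [prod_eqv, Finset.prod_filter, ← Finset.prod_mul_distrib]
  refine Finset.prod_congr rfl fun p _ => ?_
  have h := eqv_lex k hk p q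
  rw [hCD]
  unfold lexLt at h
  by_cases h1 : p.1 < q.1
  · rw [if_pos (h.1 (Or.inl h1)), if_pos h1, if_neg, mul_one]
    rintro ⟨h2, _⟩; exact absurd h2 h1.ne
  · by_cases h2 : p.1 = q.1 ∧ (p.2 : ℕ) < (q.2 : ℕ)
    · rw [if_pos (h.1 (Or.inr h2)), if_neg h1, if_pos h2, one_mul]
    · rw [if_neg h1, if_neg h2, if_neg, one_mul]
      intro h3; rcases h.2 h3 with h4 | h4
      · exact h1 h4
      · exact h2 h4

lemma kap_eqv (hk : ∀ i, 0 < k i) (θ : ℝ) (w : ℕ → ℂ) (u : ((i : Fin (m+1)) × Fin (k i)) → ℂ) (hu : ∀ p, w (eqv k p) = u p) :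
    ∏ b ∈ Finset.Ico 0 (psm (kx k) (m+1)), kap θ (chn (kx k)) b w =
      ∏ i : Fin (m+1), ∏ a : Fin (k i - 1), (u ⟨i, ⟨(a : ℕ) + 1, by have := a.2; omega⟩⟩ - u ⟨i, ⟨(a : ℕ), by have := a.2; omega⟩⟩ + 1 - (θ : ℂ))⁻¹ := by
  have hkx : ∀ i, 0 < kx k i := by
    intro i; unfold kx; split_ifs
    · exact hk _
    · exact one_pos
  rw [prod_eqv, Fintype.prod_sigma]
  refine Finset.prod_congr rfl fun i _ => ?_
  simp only [eqv_val]
  rw [Fin.prod_univ_eq_prod_range (fun j => kap θ (chn (kx k)) (psm (kx k) i + j) w)]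
  have h0 := hk i
  have hki : k i = (k i - 1) + 1 := by omega
  rw [congrArg Finset.range hki, Finset.prod_range_succ]
  have hlast : kap θ (chn (kx k)) (psm (kx k) i + (k i - 1)) w = 1 := by
    unfold kap
    rw [chn_end (kx k) (i+1), if_neg (by simp)]
    rw [psm_succ, kx_val]; omega
  rw [hlast, mul_one, Finset.prod_range]
  refine Finset.prod_congr rfl fun a _ => ?_
  have ha := a.2
  unfold kap
  rw [chn_block (kx k) hkx i a (by rw [kx_val]; omega), if_pos rfl]
  rw [← hu, ← hu, eqv_val, eqv_val]
  rfl

lemma multi_torus (f : (((i : Fin (m+1)) × Fin (k i)) → ℂ) → ℂ) (c : ℂ) (ρ : ((i : Fin (m+1)) × Fin (k i)) → ℝ) (ρ' : Fin (psm (kx k) (m+1)) → ℝ)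
    (hρ : ∀ p, ρ' (eqv k p) = ρ p) :
    multiCircleIntegral f (fun _ => c) ρ = ∯ y in T(fun _ => c, ρ'), f (fun p => y (eqv k p)) := by
  have hmp := measurePreserving_piCongrLeft (fun _ : Fin (psm (kx k) (m+1)) => (volume : Measure ℝ)) (eqv k)
  unfold multiCircleIntegral torusIntegral
  have hv : ∀ (t : ((i : Fin (m+1)) × Fin (k i)) → ℝ) p, (MeasurableEquiv.piCongrLeft (fun _ : Fin (psm (kx k) (m+1)) => ℝ) (eqv k)) t (eqv k p) = t p := by
    intro t p
    exact Equiv.piCongrLeft_apply_apply (fun _ : Fin (psm (kx k) (m+1)) => ℝ) (eqv k) t p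
  rw [show (volume : Measure (Fin (psm (kx k) (m+1)) → ℝ)) = Measure.pi (fun _ => volume) from rfl]
  rw [← hmp.setIntegral_preimage_emb (MeasurableEquiv.measurableEmbedding _)]
  have hset : (Set.univ.pi fun _ : ((i : Fin (m+1)) × Fin (k i)) => Set.Icc 0 (2 * Real.pi)) =
      (MeasurableEquiv.piCongrLeft (fun _ : Fin (psm (kx k) (m+1)) => ℝ) (eqv k)) ⁻¹' Set.Icc 0 (fun _ => 2 * Real.pi) := by
    ext t
    simp only [Set.mem_pi, Set.mem_univ, true_imp_iff, Set.mem_preimage, Set.mem_Icc, Pi.le_def, Pi.zero_apply]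
    rw [← forall_and, ← (eqv k).forall_congr_right]
    simp only [hv]
  rw [hset]
  congr 1
  ext t
  beta_reduce
  rw [← Equiv.prod_comp (eqv k)]
  simp only [torusMap, hv, hρ, smul_eq_mul]

end

end JMF

/-- **Moment formula for a single β-Jacobi ensemble** (the `T = 1` case of the paper's
Theorem 4.1): the joint moments `E[∏ᵢ 𝔓_{kᵢ}(y)]` are given by an explicit nested
contour integral over circles centered at `−θN` with lexicographically increasing
radii, none enclosing `θ(α+M−1)`. -/
theorem jacobi_moment_formula
    (θ α : ℝ) (hθ : 0 < θ) (hα : 0 < α) (M N : ℕ) (hMN : N ≤ M) (hN : 1 ≤ N)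
    (m : ℕ) (k : Fin (m + 1) → ℕ) (hk : ∀ i, 0 < k i)
    (ρ : ((i : Fin (m + 1)) × Fin (k i)) → ℝ) (hρpos : ∀ p, 0 < ρ p)
    (hρord : ∀ p q : (i : Fin (m + 1)) × Fin (k i), lexLt p q → max θ 1 < ρ q - ρ p)
    (hρtop : ρ ⟨Fin.last m, ⟨k (Fin.last m) - 1, Nat.sub_lt (hk _) Nat.one_pos⟩⟩
        < θ * ((N : ℝ) + α + (M : ℝ) - 1)) :
    ((∫ y, ∏ i : Fin (m + 1), ∑ j : Fin N, (y j) ^ (k i)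
        ∂ jacobiEnsemble θ α M N : ℝ) : ℂ)
      = (-(θ : ℂ))⁻¹ ^ (m + 1) * ((2 * (Real.pi : ℂ) * Complex.I)⁻¹ ^ (∑ i, k i)) *
        multiCircleIntegral
          (fun u : ((i : Fin (m + 1)) × Fin (k i)) → ℂ =>
            (∏ q : (i : Fin (m + 1)) × Fin (k i),
              ∏ p ∈ Finset.univ.filter
                  (fun p : (i : Fin (m + 1)) × Fin (k i) => p.1 < q.1),
                crossF θ (u q - u p)) *
            ∏ i : Fin (m + 1),
              ((∏ a : Fin (k i - 1),
                  (u ⟨i, ⟨(a : ℕ) + 1, by have := a.2; omega⟩⟩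
                    - u ⟨i, ⟨(a : ℕ), by have := a.2; omega⟩⟩ + 1 - (θ : ℂ))⁻¹) *
               (∏ b : Fin (k i),
                  ∏ a ∈ Finset.univ.filter (fun a : Fin (k i) => a < b),
                    crossF θ (u ⟨i, b⟩ - u ⟨i, a⟩)) *
               (∏ j : Fin (k i),
                  (u ⟨i, j⟩ / (u ⟨i, j⟩ + θ * (N : ℂ))) *
                    ((u ⟨i, j⟩ - θ * ((α : ℂ) - 1)) /
                      (u ⟨i, j⟩ - θ * ((α : ℂ) + (M : ℂ) - 1))))))
          (fun _ => -((θ * (N : ℝ) : ℝ) : ℂ)) ρ := by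
  obtain ⟨n, rfl⟩ : ∃ n, N = n + 1 := ⟨N - 1, by omega⟩
  have hkx : ∀ i, 0 < JMF.kx k i := by
    intro i; unfold JMF.kx; split_ifs
    · exact hk _
    · exact one_pos
  set K := JMF.psm (JMF.kx k) (m+1) with hK
  set ρ' : ℕ → ℝ := fun a => if h : a < K then ρ ((JMF.eqv k).symm ⟨a, h⟩) else 0 with hρ'
  have hρe : ∀ p, ρ' (JMF.eqv k p) = ρ p := by
    intro p
    simp only [hρ']
    rw [dif_pos (JMF.eqv k p).2]
    simp
  have hsurj : ∀ a, a < K → ∃ p, (JMF.eqv k p : ℕ) = a := fun a ha =>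
    ⟨(JMF.eqv k).symm ⟨a, ha⟩, by simp⟩
  have hle : ∀ p, ρ p ≤ ρ ⟨Fin.last m, ⟨k (Fin.last m) - 1, Nat.sub_lt (hk _) Nat.one_pos⟩⟩ := by
    intro p
    set q : (i : Fin (m + 1)) × Fin (k i) := ⟨Fin.last m, ⟨k (Fin.last m) - 1, Nat.sub_lt (hk _) Nat.one_pos⟩⟩ with hq
    have hqv : (JMF.eqv k q : ℕ) + 1 = K := by
      rw [JMF.eqv_val, hK, JMF.psm_succ]
      have h1 : JMF.kx k m = k (Fin.last m) := JMF.kx_val k (Fin.last m)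
      have h2 := hk (Fin.last m)
      rw [h1]
      have h3 : (q.2 : ℕ) = k (Fin.last m) - 1 := rfl
      have h4 : JMF.psm (JMF.kx k) q.1 = JMF.psm (JMF.kx k) m := rfl
      omega
    have hp := (JMF.eqv k p).2
    rcases Nat.lt_or_ge (JMF.eqv k p : ℕ) (JMF.eqv k q) with h | h
    · have := hρord p q ((JMF.eqv_lex k hk p q).2 h)
      have h3 : 0 < max θ 1 := lt_max_of_lt_left hθ
      linarith
    · have : JMF.eqv k p = JMF.eqv k q := Fin.ext (by omega)
      rw [(JMF.eqv k).injective this]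
  have key := JMF.moment_all n θ α hθ hα M hMN (JMF.kx k) hkx m ρ'
    (by
      intro a ha
      obtain ⟨p, rfl⟩ := hsurj a ha
      rw [hρe]; exact hρpos p)
    (by
      intro a b hab hb
      obtain ⟨q, rfl⟩ := hsurj b hb
      obtain ⟨p, rfl⟩ := hsurj a (hab.trans hb)
      rw [hρe, hρe]; exact hρord p q ((JMF.eqv_lex k hk p q).2 hab))
    (by
      intro a ha
      obtain ⟨p, rfl⟩ := hsurj a ha
      rw [hρe]
      refine (hle p).trans_lt (hρtop.trans_eq ?_)
      ring)
  have hL : ∀ y : Fin (n+1) → ℝ, ∏ i ∈ Finset.range (m+1), ∑ j : Fin (n+1), (y j) ^ (JMF.kx k i)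
      = ∏ i : Fin (m + 1), ∑ j : Fin (n+1), (y j) ^ (k i) := by
    intro y
    rw [Finset.prod_range]
    exact Finset.prod_congr rfl fun i _ => by rw [JMF.kx_val]
  simp only [hL] at key
  have hθ' : (-(θ : ℂ)) ^ (m+1) ≠ 0 := pow_ne_zero _ (neg_ne_zero.2 (by exact_mod_cast hθ.ne'))
  rw [inv_pow, mul_assoc, eq_inv_mul_iff_mul_eq₀ hθ', key, JMF.psm_kx k]
  congr 1
  rw [JMF.multi_torus k _ _ ρ (fun j => ρ' j) hρe]
  congr 1
  funext y
  have hw : ∀ p, JMF.exv (JMF.psm (JMF.kx k) (m+1)) y 0 (JMF.eqv k p) = y (JMF.eqv k p) := by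
    intro p
    rw [JMF.exv, dif_pos (JMF.eqv k p).2]
  have hc := JMF.cross_eqv k hk (fun p q => crossF θ (y (JMF.eqv k q) - y (JMF.eqv k p)))
    (fun b q => crossF θ (JMF.exv (JMF.psm (JMF.kx k) (m+1)) y 0 q - JMF.exv (JMF.psm (JMF.kx k) (m+1)) y 0 b)) (fun p q => by rw [hw, hw])
  have hkp := JMF.kap_eqv k hk θ (JMF.exv (JMF.psm (JMF.kx k) (m+1)) y 0) (fun p => y (JMF.eqv k p)) hw
  unfold JMF.Fullf JMF.KP
  rw [Finset.prod_mul_distrib, Finset.prod_mul_distrib, hc, hkp, JMF.prod_eqv, JMF.prod_eqv]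
  simp only [hw, Finset.prod_mul_distrib, Fintype.prod_sigma]
  push_cast
  ring
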